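/- arXiv:2310.09857 — 3 statements merged into one kernel-verified Lean document; each statement's English description precedes it below -/
import Mathlib

section
/- Every oriented double ray with an even but non-zero number of turns is non-ubiquitous: there exists a digraph D containing arbitrarily many pairwise vertex-disjoint copies of R but not infinitely many pairwise vertex-disjoint copies of R. -/
/-- A copy of the digraph `H` in the digraph `D`: an injective arc-preserving map. -/
structure DCopy {V W : Type} (H : Digraph V) (D : Digraph W) where
  toFun : V → W
  inj : Function.Injective toFun
  adj : ∀ u v : V, H.Adj u v → D.Adj (toFun u) (toFun v)

/-- Two copies are vertex-disjoint if their images are disjoint. -/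
def DCopy.VDisjoint {V W : Type} {H : Digraph V} {D : Digraph W}
    (c₁ c₂ : DCopy H D) : Prop :=
  ∀ u v : V, c₁.toFun u ≠ c₂.toFun v

/-- `D` contains arbitrarily many pairwise vertex-disjoint copies of `H`. -/
def ManyDisjointCopies {V W : Type} (H : Digraph V) (D : Digraph W) : Prop :=
  ∀ k : ℕ, ∃ f : Fin k → DCopy H D, ∀ i j : Fin k, i ≠ j → (f i).VDisjoint (f j)

/-- `D` contains infinitely many pairwise vertex-disjoint copies of `H`. -/
def InfDisjointCopies {V W : Type} (H : Digraph V) (D : Digraph W) : Prop :=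
  ∃ f : ℕ → DCopy H D, ∀ i j : ℕ, i ≠ j → (f i).VDisjoint (f j)

/-- A digraph `H` is ubiquitous if every digraph containing arbitrarily many
pairwise disjoint copies of `H` contains infinitely many. -/
def Ubiquitous {V : Type} (H : Digraph V) : Prop :=
  ∀ (W : Type) (D : Digraph W), ManyDisjointCopies H D → InfDisjointCopies H D

/-- The oriented double ray on `ℤ` determined by the orientation function `o`:
`o n = true` means the arc between `n` and `n+1` points from `n` to `n+1`. -/
def doubleRay (o : ℤ → Bool) : Digraph ℤ where
  Adj u v := (v = u + 1 ∧ o u = true) ∨ (u = v + 1 ∧ o v = false)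

/-- A turn of the double ray: a vertex of in-degree 2 or out-degree 2. -/
def IsTurn (o : ℤ → Bool) (n : ℤ) : Prop := o (n - 1) ≠ o n

/-- The oriented ray on `ℕ` determined by the orientation function `r`:
`r i = true` means the arc between `i` and `i+1` points from `i` to `i+1`
(away from the root `0`). -/
def rayD (r : ℕ → Bool) : Digraph ℕ where
  Adj u v := (v = u + 1 ∧ r u = true) ∨ (u = v + 1 ∧ r v = false)

/-- The backward tail `Rv` of the double ray, as a ray rooted at `v`:
index `i` corresponds to the vertex `v - i`. -/
def backTail (o : ℤ → Bool) (v : ℤ) : ℕ → Bool := fun i => !o (v - i - 1)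

/-- The forward tail `vR` of the double ray, as a ray rooted at `v`:
index `i` corresponds to the vertex `v + i`. -/
def fwdTail (o : ℤ → Bool) (v : ℤ) : ℕ → Bool := fun i => o (v + i)

/-- A digraph homomorphism (endomorphism) of the ray `rayD r`. -/
def IsRayHom (r : ℕ → Bool) (f : ℕ → ℕ) : Prop :=
  ∀ u v : ℕ, (rayD r).Adj u v → (rayD r).Adj (f u) (f v)

/-- A ray is periodic if it has a non-trivial order-preserving endomorphism. -/
def RayPeriodic (r : ℕ → Bool) : Prop :=
  ∃ f : ℕ → ℕ, IsRayHom r f ∧ Monotone f ∧ f ≠ id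

/-- `p` is the periodicity of the ray `rayD r`: the least distance `d(v, f v)`
over all vertices `v` and non-trivial order-preserving endomorphisms `f`. -/
def RayPeriodicity (r : ℕ → Bool) (p : ℕ) : Prop :=
  IsLeast {d : ℕ | ∃ f : ℕ → ℕ, IsRayHom r f ∧ Monotone f ∧ f ≠ id ∧
    ∃ v : ℕ, Nat.dist (f v) v = d} p

/-- A digraph homomorphism (endomorphism) of the double ray `doubleRay o`. -/
def IsDRayHom (o : ℤ → Bool) (f : ℤ → ℤ) : Prop :=
  ∀ u v : ℤ, (doubleRay o).Adj u v → (doubleRay o).Adj (f u) (f v)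

/-- A double ray is periodic if it has a non-trivial order-preserving endomorphism. -/
def DRayPeriodic (o : ℤ → Bool) : Prop :=
  ∃ f : ℤ → ℤ, IsDRayHom o f ∧ Monotone f ∧ f ≠ id

/-- `p` is the periodicity of the double ray `doubleRay o`. -/
def DRayPeriodicity (o : ℤ → Bool) (p : ℕ) : Prop :=
  IsLeast {d : ℕ | ∃ f : ℤ → ℤ, IsDRayHom o f ∧ Monotone f ∧ f ≠ id ∧
    ∃ v : ℤ, (f v - v).natAbs = d} p

/-- The rays `rayD r` and `rayD r'` are isomorphic as digraphs. -/
def RayIso (r r' : ℕ → Bool) : Prop :=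
  ∃ φ : ℕ ≃ ℕ, ∀ u v : ℕ, (rayD r).Adj u v ↔ (rayD r').Adj (φ u) (φ v)

/-- The ray `rayD r` is isomorphic to a subdigraph of the ray `rayD r'`. -/
def RayLE (r r' : ℕ → Bool) : Prop :=
  ∃ f : ℕ → ℕ, Function.Injective f ∧
    ∀ u v : ℕ, (rayD r).Adj u v → (rayD r').Adj (f u) (f v)

/-- An in-ray: every arc points towards the root. -/
def IsInRay (r : ℕ → Bool) : Prop := ∀ i : ℕ, r i = false

/-- An out-ray: every arc points away from the root. -/
def IsOutRay (r : ℕ → Bool) : Prop := ∀ i : ℕ, r i = true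

namespace EvenTurns

/-- Arcs of the grid: rows go right, columns go down. -/
def GAdj (L : ℤ) (p q : ℤ × ℤ) : Prop :=
  (q.1 = p.1 + 1 ∧ q.2 = p.2 ∧ ∃ r : ℕ, p.2 = r * L ∧ 2 * (r * L) + 1 ≤ p.1) ∨
  (q.1 = p.1 ∧ p.2 = q.2 + 1 ∧ ∃ c : ℕ, p.1 = c * L ∧ -L + 1 ≤ q.2)

/-- The counterexample digraph: a grid together with one core for each natural number. -/
def BigD (o : ℤ → Bool) (N : ℤ) : Digraph ((ℤ × ℤ) ⊕ (ℕ × ℤ)) where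
  Adj u v := match u, v with
    | .inl p, .inl q => GAdj (N + 1) p q
    | .inr a, .inr b => a.1 = b.1 ∧ (doubleRay o).Adj a.2 b.2 ∧
        0 ≤ a.2 ∧ a.2 ≤ N ∧ 0 ≤ b.2 ∧ b.2 ≤ N
    | .inl p, .inr b => b.2 = 0 ∧ p.1 = b.1 * (N + 1) ∧ p.2 = -(N + 1) + 1
    | .inr a, .inl q => a.2 = N ∧ q.1 = 2 * (a.1 * (N + 1)) + 1 ∧ q.2 = a.1 * (N + 1)

/-- The standard copy number `c`. -/
def stdMap (N : ℤ) (c : ℕ) (n : ℤ) : (ℤ × ℤ) ⊕ (ℕ × ℤ) :=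
  if n < 0 then .inl (c * (N + 1), -(N + 1) - n)
  else if n ≤ N then .inr (c, n)
  else .inl (2 * (c * (N + 1)) + (n - N), c * (N + 1))

lemma no_dvd_one {L : ℤ} (hL : 2 ≤ L) {a : ℤ} (h : a * L = 1) : False := by
  have : L ∣ 1 := ⟨a, by linarith⟩
  have := Int.le_of_dvd (by norm_num) this
  omega

lemma stdMap_adj (o : ℤ → Bool) (N : ℤ) (hN : 0 < N) (hneg : ∀ n < 0, o n = true)
    (hpos : ∀ n, N ≤ n → o n = true) (c : ℕ) (u v : ℤ) (h : (doubleRay o).Adj u v) :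
    (BigD o N).Adj (stdMap N c u) (stdMap N c v) := by
  have hc : (0:ℤ) ≤ c * (N+1) := by positivity
  have h' := h
  rcases h with ⟨rfl, hu⟩ | ⟨rfl, hv⟩
  · by_cases h1 : u < -1
    · have e1 : stdMap N c u = .inl (c * (N + 1), -(N + 1) - u) := by
        rw [stdMap, if_pos (by omega)]
      have e2 : stdMap N c (u+1) = .inl (c * (N + 1), -(N + 1) - (u+1)) := by
        rw [stdMap, if_pos (by omega)]
      rw [e1, e2]
      exact Or.inr ⟨rfl, by simp; ring, c, rfl, by simp; omega⟩
    by_cases h2 : u = -1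
    · subst h2
      have e1 : stdMap N c (-1) = .inl (c * (N + 1), -(N + 1) - (-1)) := by
        rw [stdMap, if_pos (by omega)]
      have e2 : stdMap N c (-1+1) = .inr (c, 0) := by
        rw [stdMap, if_neg (by omega), if_pos (by omega)]; rfl
      rw [e1, e2]
      exact ⟨rfl, rfl, by simp⟩
    by_cases h3 : u < N
    · have e1 : stdMap N c u = .inr (c, u) := by
        rw [stdMap, if_neg (by omega), if_pos (by omega)]
      have e2 : stdMap N c (u+1) = .inr (c, u+1) := by
        rw [stdMap, if_neg (by omega), if_pos (by omega)]
      rw [e1, e2]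
      exact ⟨rfl, h', by simp; omega, by simp; omega, by simp; omega, by simp; omega⟩
    by_cases h4 : u = N
    · subst h4
      have e1 : stdMap u c u = .inr (c, u) := by
        rw [stdMap, if_neg (by omega), if_pos (by omega)]
      have e2 : stdMap u c (u+1) = .inl (2 * (c * (u + 1)) + (u + 1 - u), c * (u + 1)) := by
        rw [stdMap, if_neg (by omega), if_neg (by omega)]
      rw [e1, e2]
      exact ⟨rfl, by simp, rfl⟩
    · have e1 : stdMap N c u = .inl (2 * (c * (N + 1)) + (u - N), c * (N + 1)) := by
        rw [stdMap, if_neg (by omega), if_neg (by omega)]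
      have e2 : stdMap N c (u+1) = .inl (2 * (c * (N + 1)) + (u + 1 - N), c * (N + 1)) := by
        rw [stdMap, if_neg (by omega), if_neg (by omega)]
      rw [e1, e2]
      exact Or.inl ⟨by simp; ring, rfl, c, rfl, by simp; omega⟩
  · have a1 : 0 ≤ v := by
      by_contra hh
      rw [hneg v (by omega)] at hv; simp at hv
    have a2 : v < N := by
      by_contra hh
      rw [hpos v (by omega)] at hv; simp at hv
    have e1 : stdMap N c v = .inr (c, v) := by
      rw [stdMap, if_neg (by omega), if_pos (by omega)]
    have e2 : stdMap N c (v+1) = .inr (c, v+1) := by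
      rw [stdMap, if_neg (by omega), if_pos (by omega)]
    rw [e1, e2]
    exact ⟨rfl, h', by simp; omega, by simp; omega, by simp; omega, by simp; omega⟩

lemma stdMap_eq (N : ℤ) (hN : 0 < N) (k c c' : ℕ) (hc : k ≤ c) (hc2 : c < 2 * k)
    (hc' : k ≤ c') (hc2' : c' < 2 * k) (u v : ℤ) (h : stdMap N c u = stdMap N c' v) :
    c = c' ∧ u = v := by
  have hcanc : ∀ a b : ℕ, (a : ℤ) * (N+1) = b * (N+1) → a = b := by
    intro a b hab
    have := mul_right_cancel₀ (by omega : N + 1 ≠ 0) hab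
    exact_mod_cast this
  have hcr : ∀ a b : ℕ, ∀ t : ℤ, k ≤ a → b < 2 * k → 0 < t →
      (b : ℤ) * (N+1) = 2 * (a * (N+1)) + t → False := by
    intro a b t ha hb ht hab
    have h1 : (b : ℤ) ≤ 2 * a := by exact_mod_cast (by omega : b ≤ 2 * a)
    nlinarith
  unfold stdMap at h
  split_ifs at h <;> simp only [Sum.inl.injEq, Sum.inr.injEq, Prod.mk.injEq] at h
  · exact ⟨hcanc _ _ h.1, by omega⟩
  · exact (hcr _ _ _ hc' hc2 (by omega) h.1).elim
  · exact h
  · exact (hcr _ _ _ hc hc2' (by omega) h.1.symm).elim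
  · have := hcanc _ _ h.2
    subst this
    exact ⟨rfl, by omega⟩

lemma many (o : ℤ → Bool) (N : ℤ) (hN : 0 < N) (hneg : ∀ n < 0, o n = true)
    (hpos : ∀ n, N ≤ n → o n = true) : ManyDisjointCopies (doubleRay o) (BigD o N) := by
  intro k
  refine ⟨fun i => ⟨stdMap N (k + i), ?_, stdMap_adj o N hN hneg hpos _⟩, ?_⟩
  · intro u v h
    exact (stdMap_eq N hN k _ _ (by omega) (by omega) (by omega) (by omega) u v h).2
  · intro i j hij u v h
    have := (stdMap_eq N hN k _ _ (by omega) (by omega) (by omega) (by omega) u v h).1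
    exact hij (Fin.ext (by omega))

/-- Two distinct in-neighbours force a crossing. -/
lemma in_deg (o : ℤ → Bool) (N : ℤ) (hN : 0 < N) (u v : (ℤ × ℤ) ⊕ (ℕ × ℤ)) (p : ℤ × ℤ)
    (huv : u ≠ v) (hu : (BigD o N).Adj u (.inl p)) (hv : (BigD o N).Adj v (.inl p)) :
    (N + 1) ∣ p.1 - p.2 := by
  have hcanc : ∀ a b : ℕ, (a : ℤ) * (N+1) = b * (N+1) → a = b := by
    intro a b hab
    have := mul_right_cancel₀ (by omega : N + 1 ≠ 0) hab
    exact_mod_cast this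
  have key : ∀ (a : ℤ × ℤ) (b : ℕ × ℤ), GAdj (N+1) a p → b.2 = N →
      p.1 = 2 * (b.1 * (N + 1)) + 1 → p.2 = b.1 * (N + 1) → False := by
    rintro a b (⟨h1, h2, r, h3, h4⟩ | ⟨h1, h2, r, h3, h4⟩) h5 h6 h7
    · have := hcanc r b.1 (by linarith)
      subst this
      omega
    · apply no_dvd_one (L := N + 1) (by omega) (a := r - 2 * b.1)
      linarith
  rcases u with u | u <;> rcases v with v | v
  · change GAdj _ _ _ at hu
    change GAdj _ _ _ at hv
    rcases hu with ⟨h1, h2, r, h3, h4⟩ | ⟨h1, h2, r, h3, h4⟩ <;>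
    rcases hv with ⟨g1, g2, s, g3, g4⟩ | ⟨g1, g2, s, g3, g4⟩
    · exact (huv (by congr 1; ext <;> omega)).elim
    · exact ⟨s - r, by rw [g1, g3, h2, h3]; ring⟩
    · exact ⟨r - s, by rw [h1, h3, g2, g3]; ring⟩
    · exact (huv (by congr 1; ext <;> omega)).elim
  · exact (key u v hu hv.1 hv.2.1 hv.2.2).elim
  · exact (key v u hv hu.1 hu.2.1 hu.2.2).elim
  · have h1 := hcanc u.1 v.1 (by rw [← hu.2.2, ← hv.2.2])
    have h2 : u.2 = v.2 := by rw [hu.1, hv.1]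
    exact (huv (by congr 1; ext <;> simp [h1, h2])).elim

lemma out_deg (o : ℤ → Bool) (N : ℤ) (hN : 0 < N) (u v : (ℤ × ℤ) ⊕ (ℕ × ℤ)) (p : ℤ × ℤ)
    (huv : u ≠ v) (hu : (BigD o N).Adj (.inl p) u) (hv : (BigD o N).Adj (.inl p) v) :
    (N + 1) ∣ p.1 - p.2 := by
  have hcanc : ∀ a b : ℕ, (a : ℤ) * (N+1) = b * (N+1) → a = b := by
    intro a b hab
    have := mul_right_cancel₀ (by omega : N + 1 ≠ 0) hab
    exact_mod_cast this
  have key : ∀ (a : ℤ × ℤ), GAdj (N+1) p a → p.2 = -(N + 1) + 1 → False := by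
    rintro a (⟨h1, h2, r, h3, h4⟩ | ⟨h1, h2, r, h3, h4⟩) h7
    · apply no_dvd_one (L := N + 1) (by omega) (a := r + 1)
      linarith
    · omega
  rcases u with u | u <;> rcases v with v | v
  · change GAdj _ _ _ at hu
    change GAdj _ _ _ at hv
    rcases hu with ⟨h1, h2, r, h3, h4⟩ | ⟨h1, h2, r, h3, h4⟩ <;>
    rcases hv with ⟨g1, g2, s, g3, g4⟩ | ⟨g1, g2, s, g3, g4⟩
    · exact (huv (by congr 1; ext <;> omega)).elim
    · exact ⟨s - r, by rw [g3, h3]; ring⟩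
    · exact ⟨r - s, by rw [h3, g3]; ring⟩
    · exact (huv (by congr 1; ext <;> omega)).elim
  · exact (key u hu hv.2.2).elim
  · exact (key v hv hu.2.2).elim
  · have h1 := hcanc u.1 v.1 (by rw [← hu.2.1, ← hv.2.1])
    have h2 : u.2 = v.2 := by rw [hu.1, hv.1]
    exact (huv (by congr 1; ext <;> simp [h1, h2])).elim

lemma zero_core (o : ℤ → Bool) (N : ℤ)
    (hN : 0 < N) (hneg : ∀ n < 0, o n = true) (hpos : ∀ n, N ≤ n → o n = true) (h0 : o 0 = false)
    (f : DCopy (doubleRay o) (BigD o N)) : ∃ a, f.toFun 0 = .inr a := by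
  rcases hf : f.toFun 0 with p | a
  swap
  · exact ⟨a, rfl⟩
  exfalso
  have hadj1 : (BigD o N).Adj (f.toFun (-1)) (.inl p) := by
    rw [← hf]; exact f.adj _ _ (Or.inl ⟨by norm_num, hneg _ (by norm_num)⟩)
  have hadj2 : (BigD o N).Adj (f.toFun 1) (.inl p) := by
    rw [← hf]; exact f.adj _ _ (Or.inr ⟨by norm_num, h0⟩)
  have hdvd := in_deg o N hN _ _ p (fun h => by have := f.inj h; omega) hadj1 hadj2
  -- next turn
  have hex : ∃ t : ℕ, o t = true := ⟨N.toNat, hpos _ (by omega)⟩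
  classical
  obtain ⟨t, ht, hmin⟩ : ∃ t : ℕ, o t = true ∧ ∀ s < t, o (s : ℤ) = false :=
    ⟨Nat.find hex, Nat.find_spec hex, fun s hs => by simpa using Nat.find_min hex hs⟩
  have htN : (t : ℤ) ≤ N := by
    by_contra hh
    have := hmin N.toNat (by omega)
    rw [hpos _ (by omega)] at this; simp at this
  have ht0 : t ≠ 0 := by
    rintro rfl
    simp [h0] at ht
  have walk : ∀ k : ℕ, k ≤ t → ∃ q : ℤ × ℤ, f.toFun k = .inl q ∧ q.1 - q.2 = p.1 - p.2 - k := by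
    intro k
    induction k with
    | zero => intro _; exact ⟨p, by simpa using hf, by simp⟩
    | succ k ih =>
      intro hk
      obtain ⟨q, hq, hq2⟩ := ih (by omega)
      have hadj : (BigD o N).Adj (f.toFun ((k+1 : ℕ) : ℤ)) (.inl q) := by
        rw [← hq]; exact f.adj _ _ (Or.inr ⟨by push_cast; ring, hmin k (by omega)⟩)
      rcases hg : f.toFun ((k+1 : ℕ) : ℤ) with q' | a
      · refine ⟨q', rfl, ?_⟩
        rw [hg] at hadj
        rcases hadj with ⟨h1, h2, _⟩ | ⟨h1, h2, _⟩ <;> push_cast <;> linarith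
      · exfalso
        rw [hg] at hadj
        obtain ⟨_, h2, h3⟩ := hadj
        obtain ⟨d, hd⟩ := hdvd
        have : (N+1) ∣ ((k:ℤ) + 1) := ⟨d - a.1, by
          have e : q.1 - q.2 = a.1 * (N+1) + 1 := by rw [h2, h3]; ring
          linarith⟩
        have := Int.le_of_dvd (by positivity) this
        omega
  obtain ⟨q, hq, hq2⟩ := walk t le_rfl
  have b1 : (BigD o N).Adj (.inl q) (f.toFun (t + 1)) := by
    rw [← hq]; exact f.adj _ _ (Or.inl ⟨rfl, ht⟩)
  have b2 : (BigD o N).Adj (.inl q) (f.toFun (t - 1)) := by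
    rw [← hq]; refine f.adj _ _ (Or.inr ⟨by ring, ?_⟩)
    have := hmin (t-1) (by omega)
    rwa [Nat.cast_sub (by omega)] at this
  have hd2 := out_deg o N hN _ _ q (fun h => by have := f.inj h; omega) b1 b2
  have hd3 : (N+1) ∣ (t : ℤ) := by
    have := dvd_sub hdvd hd2
    rw [hq2] at this
    simpa using this
  have := Int.le_of_dvd (by omega) hd3
  omega

lemma core_finite (o : ℤ → Bool) (N : ℤ) (f : DCopy (doubleRay o) (BigD o N))
    (g : ℕ → ℤ) (hg : Function.Injective g) (c : ℕ)
    (h : ∀ k, ∃ j, f.toFun (g k) = .inr (c, j) ∧ 0 ≤ j ∧ j ≤ N) : False := by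
  choose j hj h1 h2 using h
  have hinj : Function.Injective j := by
    intro a b hab
    apply hg; apply f.inj; rw [hj, hj, hab]
  have : (Set.range j).Finite := (Set.finite_Icc 0 N).subset (by
    rintro _ ⟨k, rfl⟩; exact ⟨h1 k, h2 k⟩)
  exact Set.infinite_range_of_injective hinj this

lemma back_tail (o : ℤ → Bool) (N : ℤ)
    (hN : 0 < N) (hneg : ∀ n < 0, o n = true) (hpos : ∀ n, N ≤ n → o n = true) (h0 : o 0 = false) (hN1 : o (N - 1) = false)
    (f : DCopy (doubleRay o) (BigD o N)) : ∃ (c : ℕ) (m : ℕ) (p : ℕ → ℤ × ℤ),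
    (∀ j : ℕ, f.toFun (-(m : ℤ) - j) = .inl (p j)) ∧ p 0 = (c * (N+1), -(N+1) + 1) ∧
    ∀ j, GAdj (N+1) (p (j+1)) (p j) := by
  classical
  obtain ⟨⟨c, j0⟩, hc⟩ := zero_core o N hN hneg hpos h0 f
  have hstep : ∀ k : ℕ, (BigD o N).Adj (f.toFun (-((k+1 : ℕ) : ℤ))) (f.toFun (-(k : ℤ))) := by
    intro k
    exact f.adj _ _ (Or.inl ⟨by push_cast; ring, hneg _ (by push_cast; omega)⟩)
  have hex : ∃ k : ℕ, ¬ ∃ j, f.toFun (-(k : ℤ)) = .inr (c, j) := by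
    by_contra hcon
    push Not at hcon
    apply core_finite o N f (fun k => -((k+1 : ℕ) : ℤ)) (fun a b h => by simp at h; exact h) c
    intro k
    obtain ⟨j, hj⟩ := hcon (k+1)
    obtain ⟨j', hj'⟩ := hcon k
    have := hstep k
    rw [hj, hj'] at this
    exact ⟨j, hj, this.2.2.1, this.2.2.2.1⟩
  obtain ⟨m, hm, hmin⟩ : ∃ m : ℕ, (¬ ∃ j, f.toFun (-(m : ℤ)) = .inr (c, j)) ∧
      ∀ s < m, ∃ j, f.toFun (-(s : ℤ)) = .inr (c, j) :=
    ⟨Nat.find hex, Nat.find_spec hex, fun s hs => by simpa using Nat.find_min hex hs⟩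
  have hm0 : m ≠ 0 := by
    rintro rfl
    exact hm ⟨j0, by simpa using hc⟩
  obtain ⟨m', rfl⟩ := Nat.exists_eq_succ_of_ne_zero hm0
  obtain ⟨j, hj⟩ := hmin m' (by omega)
  have hs := hstep m'
  rw [hj] at hs
  have base : f.toFun (-((m'+1 : ℕ) : ℤ)) = .inl (c * (N+1), -(N+1) + 1) := by
    rcases hg : f.toFun (-((m'+1 : ℕ) : ℤ)) with p | a
    · rw [hg] at hs
      congr 1
      exact Prod.ext hs.2.1 hs.2.2
    · rw [hg] at hs
      have h1 : a.1 = c := hs.1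
      exact (hm ⟨a.2, by rw [hg, ← h1]⟩).elim
  have hgrid : ∀ i : ℕ, ∃ p, f.toFun (-((m'+1 : ℕ) : ℤ) - i) = .inl p := by
    intro i
    induction i with
    | zero => exact ⟨_, by simpa using base⟩
    | succ i ih =>
      obtain ⟨p, hp⟩ := ih
      have s1 : (BigD o N).Adj (f.toFun (-((m'+1 : ℕ) : ℤ) - (i+1 : ℕ))) (.inl p) := by
        have := hstep (m' + 1 + i)
        rw [← hp]; convert this using 2 <;> push_cast <;> ring
      have s2 : (BigD o N).Adj (f.toFun (-((m'+1 : ℕ) : ℤ) - (i+1 : ℕ) - 1))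
          (f.toFun (-((m'+1 : ℕ) : ℤ) - (i+1 : ℕ))) := by
        have := hstep (m' + 1 + i + 1)
        convert this using 2 <;> push_cast <;> ring
      rcases hg : f.toFun (-((m'+1 : ℕ) : ℤ) - (i+1 : ℕ)) with q | a
      · exact ⟨q, rfl⟩
      exfalso
      rw [hg] at s1 s2
      have ha : a.2 = N := s1.1
      rcases hg2 : f.toFun (-((m'+1 : ℕ) : ℤ) - (i+1 : ℕ) - 1) with q | b
      · rw [hg2] at s2
        have : a.2 = 0 := s2.1
        omega
      · rw [hg2] at s2
        obtain ⟨-, h2, h3, h4, -⟩ := s2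
        rcases h2 with ⟨e, ho⟩ | ⟨e, ho⟩
        · rw [show b.2 = N - 1 by omega, hN1] at ho; simp at ho
        · omega
  choose p hp using hgrid
  refine ⟨c, m'+1, p, hp, ?_, ?_⟩
  · have := hp 0
    simp only [Nat.cast_zero, sub_zero] at this
    rw [base] at this
    exact (Sum.inl.inj this).symm
  · intro i
    have := hstep (m' + 1 + i)
    have e : (BigD o N).Adj (f.toFun (-((m'+1 : ℕ) : ℤ) - (i+1 : ℕ)))
        (f.toFun (-((m'+1 : ℕ) : ℤ) - i)) := by
      convert this using 2 <;> push_cast <;> ring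
    rw [hp, hp] at e
    exact e

lemma fwd_tail (o : ℤ → Bool) (N : ℤ)
    (hN : 0 < N) (hpos : ∀ n, N ≤ n → o n = true) (h0 : o 0 = false)
    (f : DCopy (doubleRay o) (BigD o N)) : ∃ (m : ℤ) (q : ℕ → ℤ × ℤ),
    (∀ j : ℕ, f.toFun (m + j) = .inl (q j)) ∧ ∀ j, GAdj (N+1) (q j) (q (j+1)) := by
  have hstep : ∀ k : ℕ, (BigD o N).Adj (f.toFun (N + k)) (f.toFun (N + (k + 1 : ℕ))) := by
    intro k
    exact f.adj _ _ (Or.inl ⟨by push_cast; ring, hpos _ (by omega)⟩)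
  have hex : ∃ k : ℕ, ∃ p, f.toFun (N + k) = .inl p := by
    by_contra hcon
    push Not at hcon
    have hcore : ∀ k : ℕ, ∃ a, f.toFun (N + k) = .inr a := by
      intro k
      rcases hg : f.toFun (N + k) with p | a
      · exact (hcon k p hg).elim
      · exact ⟨a, rfl⟩
    choose a ha using hcore
    have hadj : ∀ k : ℕ, (BigD o N).Adj (.inr (a k)) (.inr (a (k+1))) := by
      intro k
      rw [← ha, ← ha]; exact hstep k
    have hcst : ∀ k, (a k).1 = (a 0).1 := by
      intro k
      induction k with
      | zero => rfl
      | succ k ih => rw [← ih]; exact (hadj k).1.symm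
    apply core_finite o N f (fun k => N + k) (fun x y h => by simpa using h) (a 0).1
    intro k
    exact ⟨(a k).2, by rw [ha, ← hcst k], (hadj k).2.2.1, (hadj k).2.2.2.1⟩
  obtain ⟨m, p0, hm⟩ := hex
  have hgrid : ∀ i : ℕ, ∃ p, f.toFun (N + m + i) = .inl p := by
    intro i
    induction i with
    | zero => exact ⟨_, by simpa using hm⟩
    | succ i ih =>
      obtain ⟨p, hp⟩ := ih
      have s1 : (BigD o N).Adj (.inl p) (f.toFun (N + m + (i+1 : ℕ))) := by
        have := hstep (m + i)
        rw [← hp]; convert this using 2 <;> push_cast <;> ring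
      have s2 : (BigD o N).Adj (f.toFun (N + m + (i+1 : ℕ))) (f.toFun (N + m + (i+1 : ℕ) + 1)) := by
        have := hstep (m + i + 1)
        convert this using 2 <;> push_cast <;> ring
      rcases hg : f.toFun (N + m + (i+1 : ℕ)) with q | a
      · exact ⟨q, rfl⟩
      exfalso
      rw [hg] at s1 s2
      have ha : a.2 = 0 := s1.1
      rcases hg2 : f.toFun (N + m + (i+1 : ℕ) + 1) with q | b
      · rw [hg2] at s2
        have : a.2 = N := s2.1
        omega
      · rw [hg2] at s2
        obtain ⟨-, h2, h3, h4, h5, h6⟩ := s2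
        rcases h2 with ⟨e, ho⟩ | ⟨e, ho⟩
        · rw [ha, h0] at ho; simp at ho
        · omega
  choose q hq using hgrid
  refine ⟨N + m, q, hq, ?_⟩
  intro i
  have := hstep (m + i)
  have e : (BigD o N).Adj (f.toFun (N + m + i)) (f.toFun (N + m + (i+1 : ℕ))) := by
    convert this using 2 <;> push_cast <;> ring
  rw [hq, hq] at e
  exact e

lemma back_limit (L : ℤ) (hL : 2 ≤ L) (p : ℕ → ℤ × ℤ) (hp : ∀ j, GAdj L (p (j+1)) (p j)) :
    ∃ (a : ℤ) (M : ℕ), 0 ≤ a ∧ ∀ i : ℕ, p (M + i) = (a, (p M).2 + i) := by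
  have hnn : ∀ j, 0 ≤ (p (j+1)).1 := by
    intro j
    rcases hp j with ⟨_, _, r, _, h⟩ | ⟨_, _, r, h, _⟩
    · have : (0:ℤ) ≤ r * L := by positivity
      omega
    · rw [h]; positivity
  have hanti : ∀ j, (p (j+1)).1 ≤ (p j).1 := by
    intro j
    rcases hp j with ⟨h, _⟩ | ⟨h, _⟩ <;> omega
  have hA : Antitone fun j => (p j).1 := antitone_nat_of_succ_le hanti
  obtain ⟨M, hM⟩ : ∃ M : ℕ, ∀ i, (p (M+1)).1 ≤ (p (i+1)).1 := by
    classical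
    obtain ⟨M, -, hM⟩ := (measure fun j : ℕ => (p (j+1)).1.toNat).wf.has_min Set.univ ⟨0, trivial⟩
    refine ⟨M, fun i => ?_⟩
    have h : ¬ ((p (i+1)).1.toNat < (p (M+1)).1.toNat) := hM i trivial
    have := hnn i
    have := hnn M
    omega
  refine ⟨(p (M+1)).1, M+1, hnn M, fun i => ?_⟩
  have hx : ∀ i, (p (M+1+i)).1 = (p (M+1)).1 := fun i =>
    le_antisymm (hA (by omega)) (by have := hM (M+i); rwa [show M + i + 1 = M + 1 + i by omega] at this)
  refine Prod.ext (hx i) ?_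
  induction i with
  | zero => simp
  | succ i ih =>
    simp only at ih ⊢
    have h1 := hx i
    have h2 := hx (i+1)
    rcases hp (M+1+i) with ⟨h, _⟩ | ⟨_, h, _⟩
    · rw [show M + 1 + (i+1) = M+1+i+1 by omega] at h2
      omega
    · rw [show M + 1 + (i+1) = M+1+i+1 by omega, h, ih]; push_cast; ring

lemma fwd_low (L : ℤ) (hL : 2 ≤ L) (q : ℕ → ℤ × ℤ) (hq : ∀ j, GAdj L (q j) (q (j+1))) (j : ℕ) :
    -L + 1 < (q j).2 := by
  rcases hq j with ⟨_, _, r, h, _⟩ | ⟨_, h, _, _, h'⟩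
  · have : (0:ℤ) ≤ r * L := by positivity
    omega
  · omega

lemma fwd_next (L : ℤ) (hL : 2 ≤ L) (q : ℕ → ℤ × ℤ) (hq : ∀ j, GAdj L (q j) (q (j+1))) (j : ℕ) :
    ∃ j', (q j').1 = (q j).1 + 1 ∧ (q j').2 ≤ (q j).2 := by
  by_contra hcon
  push Not at hcon
  have h : ∀ i : ℕ, (q (j+i)).1 = (q j).1 ∧ (q (j+i)).2 = (q j).2 - i := by
    intro i
    induction i with
    | zero => simp
    | succ i ih =>
      have hc := hcon (j+i+1)
      rw [show j + (i+1) = j+i+1 by omega]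
      rcases hq (j+i) with ⟨h1, h2, _⟩ | ⟨h1, h2, _⟩
      · have := hc (by omega); omega
      · push_cast; omega
  have h1 := (h ((q j).2 + L).toNat).2
  have h2 := fwd_low L hL q hq (j + ((q j).2 + L).toNat)
  have h3 := fwd_low L hL q hq j
  omega

lemma fwd_reach (L : ℤ) (hL : 2 ≤ L) (q : ℕ → ℤ × ℤ) (hq : ∀ j, GAdj L (q j) (q (j+1)))
    (d : ℕ) : ∃ j, (q j).1 = (q 0).1 + d := by
  induction d with
  | zero => exact ⟨0, by simp⟩
  | succ d ih =>
    obtain ⟨j, hj⟩ := ih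
    obtain ⟨j', h, _⟩ := fwd_next L hL q hq j
    exact ⟨j', by push_cast; omega⟩

lemma crossing (L : ℤ) (hL : 2 ≤ L) (p q : ℕ → ℤ × ℤ) (hp : ∀ j, GAdj L (p (j+1)) (p j))
    (hq : ∀ j, GAdj L (q j) (q (j+1))) (hp0 : (p 0).2 = -L + 1) (a : ℤ) (M : ℕ)
    (hM : ∀ i : ℕ, p (M + i) = (a, (p M).2 + i)) (ha : (q 0).1 ≤ a) :
    ∃ i j, p i = q j := by
  by_contra hcon
  push Not at hcon
  have hB : ∀ i j, (q j).1 = (p i).1 → (p i).2 < (q j).2 := by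
    intro i
    induction i with
    | zero => intro j _; rw [hp0]; exact fwd_low L hL q hq j
    | succ i ih =>
      intro j hj
      rcases hp i with ⟨h1, h2, _⟩ | ⟨h1, h2, _⟩
      · obtain ⟨j', h3, h4⟩ := fwd_next L hL q hq j
        have := ih j' (by omega)
        omega
      · have h3 := ih j (by omega)
        have : (p (i+1)).2 ≠ (q j).2 := fun h => hcon (i+1) j (Prod.ext hj.symm h)
        omega
  obtain ⟨j, hj⟩ := fwd_reach L hL q hq (a - (q 0).1).toNat
  have h := hB (M + ((q j).2 - (p M).2).toNat) j (by rw [hM]; simp only; omega)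
  rw [hM] at h
  simp only at h
  omega

lemma not_inf (o : ℤ → Bool) (N : ℤ) (hN : 0 < N) (hneg : ∀ n < 0, o n = true)
    (hpos : ∀ n, N ≤ n → o n = true) (h0 : o 0 = false) (hN1 : o (N - 1) = false) :
    ¬ InfDisjointCopies (doubleRay o) (BigD o N) := by
  rintro ⟨f, hf⟩
  obtain ⟨m, q, hq, hqa⟩ := fwd_tail o N hN hpos h0 (f 0)
  choose c k p hp hp0 hpa using fun i => back_tail o N hN hneg hpos h0 hN1 (f i)
  choose a M ha hM using fun i => back_limit (N+1) (by omega) (p i) (hpa i)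
  have hinj : Function.Injective a := by
    intro i j hij
    by_contra hne
    have hd := hf i j hne
    obtain ⟨s, t, hst⟩ : ∃ s t : ℕ, (p i (M i)).2 + s = (p j (M j)).2 + t :=
      ⟨((p j (M j)).2 - (p i (M i)).2).toNat, ((p i (M i)).2 - (p j (M j)).2).toNat, by omega⟩
    refine hd _ _ ((hp i (M i + s)).trans (Eq.trans ?_ (hp j (M j + t)).symm))
    rw [hM, hM, hij, hst]
  have : ∃ i, i ≠ 0 ∧ (q 0).1 ≤ a i := by
    by_contra hcon
    push Not at hcon
    have hfin : (Set.range fun i => a (i+1)).Finite :=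
      (Set.finite_Icc 0 (q 0).1).subset (by
        rintro _ ⟨i, rfl⟩
        exact ⟨ha _, (hcon (i+1) (by omega)).le⟩)
    exact Set.infinite_range_of_injective (fun x y h => by simpa using hinj h) hfin
  obtain ⟨i, hi, hai⟩ := this
  obtain ⟨s, t, hst⟩ := crossing (N+1) (by omega) (p i) q (hpa i) hqa (by rw [hp0]) (a i) (M i)
    (hM i) hai
  exact hf i 0 hi _ _ ((hp i s).trans (by rw [hst, hq t]))

lemma main_norm (o : ℤ → Bool) (N : ℤ) (hN : 0 < N) (hneg : ∀ n < 0, o n = true)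
    (hpos : ∀ n, N ≤ n → o n = true) (h0 : o 0 = false) (hN1 : o (N - 1) = false) :
    ¬ Ubiquitous (doubleRay o) := fun h =>
  not_inf o N hN hneg hpos h0 hN1 (h _ _ (many o N hN hneg hpos))

/-- Precompose a copy with an isomorphism. -/
def pre {V V' W : Type} {H : Digraph V} {H' : Digraph V'} {D : Digraph W} (e : V ≃ V')
    (he : ∀ u v, H.Adj u v → H'.Adj (e u) (e v)) (c : DCopy H' D) : DCopy H D :=
  ⟨fun v => c.toFun (e v), c.inj.comp e.injective, fun u v h => c.adj _ _ (he u v h)⟩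

lemma transfer {V V' : Type} {H : Digraph V} {H' : Digraph V'} (e : V ≃ V')
    (he : ∀ u v, H.Adj u v ↔ H'.Adj (e u) (e v)) (h : Ubiquitous H) : Ubiquitous H' := by
  intro W D hm
  have hm' : ManyDisjointCopies H D := by
    intro k
    obtain ⟨f, hf⟩ := hm k
    exact ⟨fun i => pre e (fun u v => (he u v).1) (f i), fun i j hij u v => hf i j hij _ _⟩
  obtain ⟨f, hf⟩ := h W D hm'
  exact ⟨fun i => pre e.symm (fun u v h => (he _ _).2 (by simpa using h)) (f i),
    fun i j hij u v => hf i j hij _ _⟩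

lemma const_of (o : ℤ → Bool) (x y : ℤ) (hxy : x ≤ y) (h : ∀ n, x < n → n ≤ y → ¬ IsTurn o n) :
    o y = o x := by
  induction y, hxy using Int.leInduction with
  | base => rfl
  | succ y hy ih =>
    have h1 := h (y+1) (by omega) le_rfl
    simp only [IsTurn, not_not, add_sub_cancel_right] at h1
    rw [← h1]
    exact ih fun n h2 h3 => h n h2 (by omega)

lemma parity (o : ℤ → Bool) (T : Finset ℤ) (hT : ∀ n, n ∈ T ↔ IsTurn o n) (x y : ℤ) (hxy : x ≤ y) :
    o y = o x ↔ Even (T.filter fun n => x < n ∧ n ≤ y).card := by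
  induction y, hxy using Int.leInduction with
  | base =>
    have : (T.filter fun n => x < n ∧ n ≤ x) = ∅ := by
      ext n; simp
    simp [this]
  | succ y hy ih =>
    by_cases ht : IsTurn o (y+1)
    · have e : (T.filter fun n => x < n ∧ n ≤ y+1) =
          insert (y+1) (T.filter fun n => x < n ∧ n ≤ y) := by
        ext n
        simp only [Finset.mem_filter, Finset.mem_insert, hT]
        constructor
        · rintro ⟨h1, h2, h3⟩
          by_cases h : n = y + 1
          · exact Or.inl h
          · exact Or.inr ⟨h1, h2, by omega⟩
        · rintro (rfl | ⟨h1, h2, h3⟩)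
          · exact ⟨ht, by omega, le_rfl⟩
          · exact ⟨h1, h2, by omega⟩
      rw [e, Finset.card_insert_of_notMem (by simp), Nat.even_add_one, ← ih]
      simp only [IsTurn, add_sub_cancel_right] at ht
      revert ht
      cases o x <;> cases o y <;> cases o (y+1) <;> simp
    · have e : (T.filter fun n => x < n ∧ n ≤ y+1) = (T.filter fun n => x < n ∧ n ≤ y) := by
        ext n
        simp only [Finset.mem_filter, hT]
        constructor
        · rintro ⟨h1, h2, h3⟩
          have : n ≠ y + 1 := by rintro rfl; exact ht h1
          exact ⟨h1, h2, by omega⟩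
        · rintro ⟨h1, h2, h3⟩
          exact ⟨h1, h2, by omega⟩
      rw [e, ← ih]
      simp only [IsTurn, add_sub_cancel_right, not_not] at ht
      rw [ht]

end EvenTurns

open EvenTurns in
/-- every oriented double ray with an even but non-zero (finite)
number of turns is non-ubiquitous. -/
theorem even_nonzero_turns_not_ubiquitous (o : ℤ → Bool)
    (hfin : {n : ℤ | IsTurn o n}.Finite)
    (hne : {n : ℤ | IsTurn o n}.ncard ≠ 0)
    (heven : Even {n : ℤ | IsTurn o n}.ncard) :
    ¬ Ubiquitous (doubleRay o) := by
  classical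
  obtain ⟨T, hT⟩ : ∃ T : Finset ℤ, ∀ n, n ∈ T ↔ IsTurn o n := ⟨hfin.toFinset, by simp⟩
  have hTe : {n : ℤ | IsTurn o n} = (T : Set ℤ) := by ext n; simp [hT]
  rw [hTe, Set.ncard_coe_finset] at hne heven
  have hTn : T.Nonempty := Finset.card_ne_zero.1 hne
  obtain ⟨a, ha, hamin⟩ := T.exists_min_image id hTn
  obtain ⟨b, hb, hbmax⟩ := T.exists_max_image id hTn
  simp only [id] at hamin hbmax
  have hab : a ≤ b := hamin b hb
  have hlo : ∀ n, n < a → o n = o (a-1) := by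
    intro n hn
    refine (const_of o n (a-1) (by omega) fun k _ h2 h3 => ?_).symm
    have := hamin k ((hT k).2 h3); omega
  have hhi : ∀ n, b ≤ n → o n = o b := by
    intro n hn
    refine const_of o b n hn fun k h1 _ h3 => ?_
    have := hbmax k ((hT k).2 h3); omega
  have hbe : o b = o (a-1) := by
    rw [parity o T hT (a-1) b (by omega)]
    rwa [Finset.filter_true_of_mem]
    intro n hn
    have := hamin n hn
    have := hbmax n hn
    omega
  have hta : o (a-1) ≠ o a := (hT a).1 ha
  have htb : o (b-1) ≠ o b := (hT b).1 hb
  have hlt : a < b := by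
    rcases hab.lt_or_eq with h | h
    · exact h
    · subst h; exact (hta hbe.symm).elim
  intro hU
  cases hv : o (a-1)
  · rw [hv] at hbe hta
    rw [hbe] at htb
    simp only [ne_eq, Bool.not_eq_false, Bool.false_eq, ] at hta htb
    refine main_norm (fun n => !o (b - n - 1)) (b - a) (by omega) ?_ ?_ ?_ ?_
      (transfer (Equiv.subLeft b) ?_ hU)
    · intro n hn; rw [hhi _ (by omega), hbe]; rfl
    · intro n hn; rw [hlo _ (by omega), hv]; rfl
    · simp [htb]
    · rw [show b - (b - a - 1) - 1 = a by ring, hta]; rfl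
    · intro u v
      simp only [doubleRay, Equiv.subLeft_apply, Bool.not_eq_true', Bool.not_eq_false']
      constructor
      · rintro (⟨rfl, h⟩ | ⟨rfl, h⟩)
        · exact Or.inr ⟨by ring, by rw [← h]; congr 1; ring⟩
        · exact Or.inl ⟨by ring, by rw [← h]; congr 1; ring⟩
      · rintro (⟨h1, h⟩ | ⟨h1, h⟩)
        · exact Or.inr ⟨by omega, by rw [← h]; congr 1; omega⟩
        · exact Or.inl ⟨by omega, by rw [← h]; congr 1; omega⟩
  · rw [hv] at hbe hta
    rw [hbe] at htb
    simp only [ne_eq, Bool.not_eq_true, Bool.true_eq] at hta htb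
    refine main_norm (fun n => o (n + a)) (b - a) (by omega) ?_ ?_ ?_ ?_
      (transfer (Equiv.subRight a) ?_ hU)
    · intro n hn; rw [hlo _ (by omega), hv]
    · intro n hn; rw [hhi _ (by omega), hbe]
    · simp [hta]
    · rw [show b - a - 1 + a = b - 1 by ring, htb]
    · intro u v
      simp only [doubleRay, Equiv.subRight_apply, sub_add_cancel]
      constructor
      · rintro (⟨rfl, h⟩ | ⟨rfl, h⟩)
        · exact Or.inl ⟨by ring, h⟩
        · exact Or.inr ⟨by ring, h⟩
      · rintro (⟨h1, h⟩ | ⟨h1, h⟩)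
        · exact Or.inl ⟨by omega, h⟩
        · exact Or.inr ⟨by omega, h⟩
end

section
/- Every non-periodic oriented double ray with infinitely many turns is non-ubiquitous. -/
namespace NPU

/-- Reading of the double ray in direction `ε`: is the arc from `ε * i` to `ε * (i + 1)`
directed outwards? -/
def P (o : ℤ → Bool) (ε i : ℤ) : Bool := if ε = 1 then o i else !o (-i - 1)

/-- The side `ε` of the double ray has infinitely many turns. -/
def Turnful (o : ℤ → Bool) (ε : ℤ) : Prop :=
  (ε = 1 ∨ ε = -1) ∧ ∀ K : ℤ, ∃ y : ℤ, K ≤ y ∧ P o ε y ≠ P o ε (y - 1)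

lemma P_neg (o : ℤ → Bool) (ε i : ℤ) (h : ε = 1 ∨ ε = -1) :
    P o (-ε) (-i) = !P o ε (i - 1) := by
  rcases h with rfl | rfl
  · simp [P]
  · simp only [P]
    norm_num

lemma exists_turnful (o : ℤ → Bool) (hinf : {n : ℤ | IsTurn o n}.Infinite) :
    ∃ ε, Turnful o ε := by
  by_contra hcon
  push Not at hcon
  have h1 := hcon 1
  have h2 := hcon (-1)
  simp only [Turnful, P, not_and, not_forall, not_exists] at h1 h2
  obtain ⟨K1, h1⟩ := h1 (by norm_num)
  obtain ⟨K2, h2⟩ := h2 (by norm_num)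
  apply hinf
  apply (Set.finite_Icc (-K2) K1).subset
  intro n hn
  simp only [Set.mem_ofPred_eq, IsTurn] at hn
  constructor
  · by_contra hlt
    apply h2 (-n) (by omega)
    have e1 : - -n - 1 = n - 1 := by ring
    have e2 : -(-n - 1) - 1 = n := by ring
    simp only [e1, e2]
    simpa using hn
  · by_contra hlt
    apply h1 n (by omega)
    simpa using hn.symm

lemma turnful_type (o : ℤ → Bool) (ε : ℤ) (h : Turnful o ε) (τ : Bool) (K : ℤ) :
    ∃ y : ℤ, K ≤ y ∧ P o ε y = τ ∧ P o ε (y - 1) = !τ := by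
  by_contra hcon
  push Not at hcon
  obtain ⟨a, ha, hne⟩ := h.2 K
  have hs : P o ε a = !τ := by
    by_contra hh
    have h3 : P o ε a = τ := by simpa using hh
    apply hcon a ha h3
    cases h4 : P o ε (a - 1) <;> simp_all
  have hall : ∀ n : ℕ, P o ε (a + n) = !τ := by
    intro n
    induction n with
    | zero => simpa using hs
    | succ n ih =>
      by_contra hh
      have h3 : P o ε (a + (n + 1 : ℕ)) = τ := by simpa using hh
      refine hcon _ (by omega) h3 ?_
      rw [← ih]
      congr 1
      push_cast
      ring
  obtain ⟨b, hb, hne2⟩ := h.2 (a + 1)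
  apply hne2
  have e1 := hall (b - a).toNat
  have e2 := hall (b - 1 - a).toNat
  rw [show a + ((b - a).toNat : ℤ) = b by omega] at e1
  rw [show a + ((b - 1 - a).toNat : ℤ) = b - 1 by omega] at e2
  rw [e1, e2]

/-- `y` is so far out that every small shift symmetry up to `y` extends to `y`. -/
def Good (o : ℤ → Bool) (S δ y : ℤ) : Prop :=
  ∀ ε : ℤ, (ε = 1 ∨ ε = -1) → ∀ e : ℤ, |e| ≤ S →
    (∀ i, S ≤ i → i < y → P o ε (i - e) = P o δ i) → P o ε (y - e) = P o δ y

lemma eventually_good (o : ℤ → Bool) (S δ : ℤ) : ∃ K : ℤ, ∀ y, K ≤ y → Good o S δ y := by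
  have key : ∀ ε e : ℤ, ∀ᶠ y : ℤ in Filter.atTop,
      (∀ i, S ≤ i → i < y → P o ε (i - e) = P o δ i) → P o ε (y - e) = P o δ y := by
    intro ε e
    by_cases h : ∃ i, S ≤ i ∧ P o ε (i - e) ≠ P o δ i
    · obtain ⟨i, hi, hne⟩ := h
      filter_upwards [Filter.eventually_gt_atTop i] with y hy hh
      exact absurd (hh i hi hy) hne
    · push Not at h
      filter_upwards [Filter.eventually_ge_atTop S] with y hy _
      exact h y hy
  have hfin : ({1, -1} ×ˢ Set.Icc (-S) S : Set (ℤ × ℤ)).Finite :=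
    (Set.toFinite _).prod (Set.finite_Icc _ _)
  have := (Filter.eventually_all_finite hfin).2 (fun p _ => key p.1 p.2)
  obtain ⟨K, hK⟩ := Filter.eventually_atTop.1 this
  refine ⟨K, fun y hy ε hε e he => hK y hy (ε, e) ?_⟩
  refine ⟨by simpa using hε, ?_⟩
  exact abs_le.1 he

/-- The index set of the lines: `k` lines in class `k`. -/
abbrev Ln := Σ k : ℕ, Fin k

/-- Bookkeeping data of the identifications: node `2t` is identified with node `2t+1`. -/
structure Sys (o : ℤ → Bool) where
  L : ℕ → Ln
  sd : ℕ → ℤ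
  hsd : ∀ n, sd n = 1 ∨ sd n = -1
  Y : ℕ → ℤ
  Y_pos : ∀ n, 0 < Y n
  mono : StrictMono Y
  ty : ∀ n, P o (sd n) (Y n) = decide (n % 2 = 1)
  ty' : ∀ n, P o (sd n) (Y n - 1) = !decide (n % 2 = 1)
  cls : ∀ t, (L (2 * t)).1 ≠ (L (2 * t + 1)).1
  good : ∀ n : ℕ, Good o (Y n * (n + 2) + n + 2) (sd (n + 1)) (Y (n + 1))
  hit : ∀ c d : Ln, c.1 ≠ d.1 → ∀ δ η, Turnful o δ → Turnful o η → ∀ K : ℕ,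
    ∃ t, K ≤ t ∧ L (2 * t) = c ∧ sd (2 * t) = δ ∧ L (2 * t + 1) = d ∧ sd (2 * t + 1) = η

lemma exists_sys (o : ℤ → Bool) (hinf : {n : ℤ | IsTurn o n}.Infinite) : Nonempty (Sys o) := by
  obtain ⟨ε0, hε0⟩ := exists_turnful o hinf
  let J := Ln × {ε : ℤ // Turnful o ε}
  let T := {p : J × J // p.1.1.1 ≠ p.2.1.1}
  have hT : Nonempty T := ⟨⟨((⟨1, 0⟩, ⟨ε0, hε0⟩), (⟨2, 0⟩, ⟨ε0, hε0⟩)), by simp⟩⟩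
  obtain ⟨g, hg⟩ := exists_surjective_nat T
  let e : ℕ → T := fun t => g (Nat.unpair t).1
  let nd : ℕ → J := fun n => if n % 2 = 0 then (e (n / 2)).1.1 else (e (n / 2)).1.2
  have nd0 : ∀ t, nd (2 * t) = (e t).1.1 := by
    intro t
    have h1 : 2 * t % 2 = 0 := by omega
    have h2 : 2 * t / 2 = t := by omega
    simp only [nd, h1, h2, if_true]
  have nd1 : ∀ t, nd (2 * t + 1) = (e t).1.2 := by
    intro t
    have h1 : ¬ (2 * t + 1) % 2 = 0 := by omega
    have h2 : (2 * t + 1) / 2 = t := by omega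
    simp only [nd, h1, h2, if_false]
  have step : ∀ (n : ℕ) (S : ℤ), ∃ y : ℤ, S < y ∧ 0 < y ∧ Good o S (nd n).2.1 y ∧
      P o (nd n).2.1 y = decide (n % 2 = 1) ∧ P o (nd n).2.1 (y - 1) = !decide (n % 2 = 1) := by
    intro n S
    obtain ⟨K, hK⟩ := eventually_good o S (nd n).2.1
    obtain ⟨y, hy, h1, h2⟩ := turnful_type o _ (nd n).2.2 (decide (n % 2 = 1)) (max K (max (S + 1) 1))
    simp only [max_le_iff] at hy
    exact ⟨y, by omega, by omega, hK y hy.1, h1, h2⟩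
  choose F hF1 hF2 hF3 hF4 hF5 using step
  let Y : ℕ → ℤ := fun n => Nat.rec (F 0 0) (fun n y => F (n + 1) (y * (n + 2) + n + 2)) n
  have Ys : ∀ n, Y (n + 1) = F (n + 1) (Y n * (n + 2) + n + 2) := fun n => rfl
  have Yform : ∀ n, ∃ S, Y n = F n S := by
    intro n
    cases n with
    | zero => exact ⟨0, rfl⟩
    | succ n => exact ⟨_, Ys n⟩
  have Ypos : ∀ n, 0 < Y n := by
    intro n
    obtain ⟨S, hS⟩ := Yform n
    rw [hS]
    exact hF2 _ _
  refine ⟨{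
    L := fun n => (nd n).1
    sd := fun n => (nd n).2.1
    hsd := fun n => (nd n).2.2.1
    Y := Y
    Y_pos := Ypos
    mono := ?_
    ty := ?_
    ty' := ?_
    cls := ?_
    good := ?_
    hit := ?_ }⟩
  · apply strictMono_nat_of_lt_succ
    intro n
    have h1 := hF1 (n + 1) (Y n * (n + 2) + n + 2)
    rw [← Ys] at h1
    have h2 := Ypos n
    nlinarith
  · intro n
    obtain ⟨S, hS⟩ := Yform n
    rw [hS]
    exact hF4 _ _
  · intro n
    obtain ⟨S, hS⟩ := Yform n
    rw [hS]
    exact hF5 _ _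
  · intro t
    simp only [nd0, nd1]
    exact (e t).2
  · intro n
    rw [Ys]
    exact hF3 _ _
  · intro c d hcd δ η hδ hη K
    obtain ⟨a, ha⟩ := hg ⟨((c, ⟨δ, hδ⟩), (d, ⟨η, hη⟩)), hcd⟩
    refine ⟨Nat.pair a K, Nat.right_le_pair a K, ?_⟩
    have he : e (Nat.pair a K) = ⟨((c, ⟨δ, hδ⟩), (d, ⟨η, hη⟩)), hcd⟩ := by
      simp only [e, Nat.unpair_pair, ha]
    simp only [nd0, nd1, he]
    simp

namespace Sys

variable {o : ℤ → Bool} (s : Sys o)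

/-- The nodes. -/
def node (n : ℕ) : Ln × ℤ := (s.L n, s.sd n * s.Y n)

open Classical in
/-- Representative of a vertex after identification. -/
noncomputable def rho (p : Ln × ℤ) : Ln × ℤ :=
  if h : ∃ t, p = s.node (2 * t + 1) then s.node (2 * h.choose) else p

lemma abs_node (n : ℕ) : |(s.node n).2| = s.Y n := by
  have := s.Y_pos n
  rcases s.hsd n with h | h <;> simp [node, h, abs_of_pos this]

lemma node_inj {m n : ℕ} (h : s.node m = s.node n) : m = n := by
  apply s.mono.injective
  rw [← abs_node, ← abs_node, h]

lemma rho_odd (t : ℕ) : s.rho (s.node (2 * t + 1)) = s.node (2 * t) := by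
  have h : ∃ t', s.node (2 * t + 1) = s.node (2 * t' + 1) := ⟨t, rfl⟩
  have h2 := s.node_inj h.choose_spec
  unfold rho
  rw [dif_pos h]
  congr 1
  omega

lemma rho_not {p : Ln × ℤ} (h : ∀ t, p ≠ s.node (2 * t + 1)) : s.rho p = p := by
  unfold rho
  rw [dif_neg]
  push Not
  exact h

lemma rho_even (t : ℕ) : s.rho (s.node (2 * t)) = s.node (2 * t) := by
  apply rho_not
  intro t' h
  have := s.node_inj h
  omega

lemma rho_node (n : ℕ) : s.rho (s.node n) = s.node (2 * (n / 2)) := by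
  rcases Nat.even_or_odd' n with ⟨t, rfl | rfl⟩
  · rw [rho_even]; congr 1; omega
  · rw [rho_odd]; congr 1; omega

lemma rho_eq {p p' : Ln × ℤ} (h : s.rho p = s.rho p') (hne : p ≠ p') :
    ∃ n n', p = s.node n ∧ p' = s.node n' ∧ n / 2 = n' / 2 ∧ n ≠ n' := by
  by_cases h1 : ∃ t, p = s.node (2 * t + 1)
  · obtain ⟨t, rfl⟩ := h1
    by_cases h2 : ∃ t', p' = s.node (2 * t' + 1)
    · obtain ⟨t', rfl⟩ := h2
      rw [rho_odd, rho_odd] at h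
      have := s.node_inj h
      exact absurd (by congr 1; omega) hne
    · push Not at h2
      rw [rho_odd, rho_not s h2] at h
      exact ⟨2 * t + 1, 2 * t, rfl, h.symm, by omega, by omega⟩
  · push Not at h1
    by_cases h2 : ∃ t', p' = s.node (2 * t' + 1)
    · obtain ⟨t', rfl⟩ := h2
      rw [rho_odd, rho_not s h1] at h
      exact ⟨2 * t', 2 * t' + 1, h, rfl, by omega, by omega⟩
    · push Not at h2
      rw [rho_not s h1, rho_not s h2] at h
      exact absurd h hne

lemma rho_class {p p' : Ln × ℤ} (h : s.rho p = s.rho p') (hc : p.1.1 = p'.1.1) : p = p' := by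
  by_contra hne
  obtain ⟨n, n', rfl, rfl, h2, h3⟩ := s.rho_eq h hne
  simp only [node] at hc
  rcases Nat.even_or_odd' n with ⟨t, rfl | rfl⟩
  · have : n' = 2 * t + 1 := by omega
    subst this
    exact s.cls t hc
  · have : n' = 2 * t := by omega
    subst this
    exact s.cls t hc.symm

/-- The host digraph. -/
def D : Digraph (Ln × ℤ) where
  Adj w w' := ∃ (c : Ln) (x y : ℤ), (doubleRay o).Adj x y ∧ s.rho (c, x) = w ∧ s.rho (c, y) = w'

lemma many : ManyDisjointCopies (doubleRay o) s.D := by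
  intro k
  refine ⟨fun i => ⟨fun n => s.rho (⟨k, i⟩, n), ?_, ?_⟩, ?_⟩
  · intro a b h
    have := s.rho_class h rfl
    simpa using this
  · intro u v h
    exact ⟨_, u, v, h, rfl, rfl⟩
  · intro i j hij u v h
    have := s.rho_class h rfl
    simp at this
    exact hij this.1

lemma adj_out (ε x : ℤ) (h : ε = 1 ∨ ε = -1) (hp : P o ε (ε * x) = true) :
    (doubleRay o).Adj x (x + ε) := by
  rcases h with rfl | rfl
  · left; simpa [P] using hp
  · right; refine ⟨by ring, ?_⟩; simpa [P, sub_eq_add_neg] using hp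

lemma adj_in (ε x : ℤ) (h : ε = 1 ∨ ε = -1) (hp : P o ε (ε * x) = false) :
    (doubleRay o).Adj (x + ε) x := by
  rcases h with rfl | rfl
  · right; simpa [P] using hp
  · left; refine ⟨by ring, ?_⟩; simpa [P, sub_eq_add_neg] using hp

lemma adj_inv (x y : ℤ) (h : (doubleRay o).Adj x y) :
    ∃ δ : ℤ, (δ = 1 ∨ δ = -1) ∧ y = x + δ ∧ P o δ (δ * x) = true := by
  rcases h with ⟨rfl, h⟩ | ⟨rfl, h⟩
  · exact ⟨1, Or.inl rfl, rfl, by simpa [P] using h⟩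
  · exact ⟨-1, Or.inr rfl, by ring, by simpa [P] using h⟩

lemma adj_inv' (x y : ℤ) (h : (doubleRay o).Adj y x) :
    ∃ δ : ℤ, (δ = 1 ∨ δ = -1) ∧ y = x + δ ∧ P o δ (δ * x) = false := by
  rcases h with ⟨rfl, h⟩ | ⟨rfl, h⟩
  · exact ⟨-1, Or.inr rfl, by ring, by simpa [P] using h⟩
  · exact ⟨1, Or.inl rfl, by ring, by simpa [P] using h⟩

lemma edge (Q : DCopy (doubleRay o) s.D) (ε : ℤ) (hε : ε = 1 ∨ ε = -1) (n : ℕ) :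
    ∃ (c : Ln) (x δ : ℤ), (δ = 1 ∨ δ = -1) ∧ s.rho (c, x) = Q.toFun (ε * n) ∧
      s.rho (c, x + δ) = Q.toFun (ε * (n + 1 : ℕ)) ∧ P o δ (δ * x) = P o ε n := by
  have hee : ε * (ε * (n : ℤ)) = n := by rcases hε with rfl | rfl <;> ring
  have hs : ε * ((n + 1 : ℕ) : ℤ) = ε * n + ε := by push_cast; ring
  rw [hs]
  cases hP : P o ε n with
  | true =>
    obtain ⟨c, x, y, hxy, h1, h2⟩ := Q.adj _ _ (adj_out ε (ε * n) hε (by rw [hee]; exact hP))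
    obtain ⟨δ, hδ, rfl, hp⟩ := adj_inv x y hxy
    exact ⟨c, x, δ, hδ, h1, h2, hp⟩
  | false =>
    obtain ⟨c, y, x, hxy, h2, h1⟩ := Q.adj _ _ (adj_in ε (ε * n) hε (by rw [hee]; exact hP))
    obtain ⟨δ, hδ, rfl, hp⟩ := adj_inv' x y hxy
    exact ⟨c, x, δ, hδ, h1, h2, hp⟩

/-- At a node, the reading away from it has the type of the node, in both directions. -/
lemma node_type (n : ℕ) (δ : ℤ) (hδ : δ = 1 ∨ δ = -1) :
    P o δ (δ * (s.node n).2) = decide (n % 2 = 1) := by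
  by_cases h : δ = s.sd n
  · subst h
    rw [← s.ty n]
    congr 1
    rcases hδ with h | h <;> simp [node, h]
  · have h2 : δ = - s.sd n := by
      rcases hδ with h1 | h1 <;> rcases s.hsd n with h3 | h3 <;> simp_all
    have h3 : δ * (s.node n).2 = - s.Y n := by
      rw [h2]
      rcases s.hsd n with h3 | h3 <;> simp [node, h3]
    rw [h3, h2, P_neg _ _ _ (s.hsd n), s.ty' n]
    simp

set_option maxHeartbeats 2000000 in
/-- Every copy contains a tail of a turnful side of a line. -/
lemma tail (Q : DCopy (doubleRay o) s.D) (ε : ℤ) (hε : Turnful o ε) :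
    ∃ (c : Ln) (δ K : ℤ), Turnful o δ ∧ ∀ i, K ≤ i → ∃ u, Q.toFun u = s.rho (c, δ * i) := by
  choose c x δ hδ hq hq' hP using s.edge Q ε hε.1
  have qinj : ∀ m n : ℕ, Q.toFun (ε * m) = Q.toFun (ε * n) → m = n := by
    intro m n h
    have := Q.inj h
    rcases hε.1 with h | h <;> subst h <;> omega
  let sw : ℕ → Prop := fun n => (c n, x n + δ n) ≠ (c (n + 1), x (n + 1))
  have cont : ∀ n, ¬ sw n → c (n + 1) = c n ∧ x (n + 1) = x n + δ n ∧ δ (n + 1) = δ n := by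
    intro n hn
    have hn' : (c n, x n + δ n) = (c (n + 1), x (n + 1)) := not_not.1 hn
    rw [Prod.mk.injEq] at hn'
    refine ⟨hn'.1.symm, hn'.2.symm, ?_⟩
    by_contra hne
    have h1 : δ (n + 1) = - δ n := by
      rcases hδ n with h | h <;> rcases hδ (n + 1) with h' | h' <;> simp_all
    have h2 := hq' (n + 1)
    rw [← hn'.1, ← hn'.2, h1, add_neg_cancel_right, hq n] at h2
    have := qinj _ _ h2
    omega
  have hsw : ∀ n, sw n → ∃ a b, (c n, x n + δ n) = s.node a ∧
      (c (n + 1), x (n + 1)) = s.node b ∧ a / 2 = b / 2 ∧ a ≠ b := by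
    intro n hn
    exact s.rho_eq ((hq' n).trans (hq (n + 1)).symm) hn
  by_cases hfin : ∃ N, ∀ n, N ≤ n → ¬ sw n
  · obtain ⟨N, hN⟩ := hfin
    have hall : ∀ j : ℕ, c (N + j) = c N ∧ x (N + j) = x N + δ N * j ∧ δ (N + j) = δ N := by
      intro j
      induction j with
      | zero => simp
      | succ j ih =>
        obtain ⟨h1, h2, h3⟩ := cont (N + j) (hN _ (by omega))
        refine ⟨h1.trans ih.1, ?_, h3.trans ih.2.2⟩
        have : N + (j + 1) = N + j + 1 := by ring
        rw [this, h2, ih.2.1, ih.2.2]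
        push_cast
        ring
    have hdd : δ N * δ N = 1 := by rcases hδ N with h | h <;> rw [h] <;> norm_num
    have hread : ∀ j : ℕ, P o (δ N) (δ N * x N + j) = P o ε (N + j : ℕ) := by
      intro j
      obtain ⟨h1, h2, h3⟩ := hall j
      rw [← hP (N + j), h2, h3]
      congr 1
      rw [mul_add, ← mul_assoc, hdd]
      ring
    refine ⟨c N, δ N, δ N * x N, ⟨hδ N, ?_⟩, ?_⟩
    · intro K
      obtain ⟨y, hy, hne⟩ := hε.2 (max (N + 1) (K + N - δ N * x N))
      simp only [max_le_iff] at hy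
      refine ⟨δ N * x N + (y - N), by omega, ?_⟩
      have e1 := hread (y - N).toNat
      have e2 := hread (y - 1 - N).toNat
      rw [show ((y - N).toNat : ℤ) = y - N by omega,
        show ((N + (y - N).toNat : ℕ) : ℤ) = y by omega] at e1
      rw [show ((y - 1 - N).toNat : ℤ) = y - 1 - N by omega,
        show ((N + (y - 1 - N).toNat : ℕ) : ℤ) = y - 1 by omega] at e2
      rw [show δ N * x N + (y - N) - 1 = δ N * x N + (y - 1 - N) by ring, e1, e2]
      exact hne
    · intro i hi
      refine ⟨ε * (N + (i - δ N * x N).toNat : ℕ), ?_⟩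
      obtain ⟨h1, h2, h3⟩ := hall (i - δ N * x N).toNat
      rw [← hq, h1, h2]
      congr 2
      rw [show ((i - δ N * x N).toNat : ℤ) = i - δ N * x N by omega, mul_sub, ← mul_assoc, hdd]
      ring
  · exfalso
    push Not at hfin
    have hsw' : ∀ n, ∃ a b, sw n → ((c n, x n + δ n) = s.node a ∧
      (c (n + 1), x (n + 1)) = s.node b ∧ a / 2 = b / 2 ∧ a ≠ b) := by
      intro n
      by_cases h : sw n
      · obtain ⟨a, b, hab⟩ := hsw n h
        exact ⟨a, b, fun _ => hab⟩
      · exact ⟨0, 0, fun h' => absurd h' h⟩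
    choose a b hab using hsw'
    have tinj : ∀ m n, sw m → sw n → a m / 2 = a n / 2 → m = n := by
      intro m n hm hn h
      have h1 := hq' m
      have h2 := hq' n
      rw [(hab m hm).1, rho_node] at h1
      rw [(hab n hn).1, rho_node, ← h] at h2
      have := qinj _ _ (h1.symm.trans h2)
      omega
    obtain ⟨m0, -, hm0⟩ := hfin 0
    obtain ⟨T, hT1, hT2⟩ : ∃ T, m0 ≤ T ∧ a m0 / 2 ≤ T :=
      ⟨max m0 (a m0 / 2), le_max_left _ _, le_max_right _ _⟩
    have hrec : ∃ n, m0 < n ∧ sw n ∧ T < a n / 2 := by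
      by_contra hcon
      push Not at hcon
      have hinf : {n | m0 < n ∧ sw n}.Infinite := by
        rw [Set.infinite_iff_exists_gt]
        intro N
        obtain ⟨n, hn, hs⟩ := hfin (max N m0 + 1)
        exact ⟨n, ⟨by omega, hs⟩, by omega⟩
      obtain ⟨m, hm, n, hn, hne, he⟩ := hinf.exists_ne_map_eq_of_mapsTo
        (f := fun n => a n / 2) (t := Set.Iic T) (fun n hn => hcon n hn.1 hn.2)
        (Set.finite_Iic T)
      exact hne (tinj m n hm.2 hn.2 he)
    classical
    obtain ⟨hn1, hn2, hn3⟩ := Nat.find_spec hrec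
    have hmin := fun j (hj : j < Nat.find hrec) => Nat.find_min hrec hj
    generalize Nat.find hrec = n at hn1 hn2 hn3 hmin
    have hle : ∀ j, m0 ≤ j → j < n → sw j → a j / 2 ≤ T := by
      intro j h1 h2 h3
      rcases h1.eq_or_lt with rfl | h1
      · exact hT2
      · by_contra h4
        exact hmin j h2 ⟨h1, h3, by omega⟩
    obtain ⟨M, hMdef⟩ : ∃ M, M = s.Y (2 * T + 1) := ⟨_, rfl⟩
    have hM0 : 0 < M := hMdef ▸ s.Y_pos _
    have hYM : ∀ k, k / 2 ≤ T → |(s.node k).2| ≤ M := by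
      intro k hk
      rw [abs_node, hMdef]
      exact s.mono.monotone (by omega)
    have harr : ∀ j, m0 ≤ j → j < n → sw j → |x j + δ j| ≤ M := by
      intro j h1 h2 h3
      have := hYM (a j) (hle j h1 h2 h3)
      rwa [← (hab j h3).1] at this
    have hdep : ∀ j, m0 ≤ j → j < n → sw j → |x (j + 1)| ≤ M := by
      intro j h1 h2 h3
      have := hYM (b j) (by rw [← (hab j h3).2.2.1]; exact hle j h1 h2 h3)
      rwa [← (hab j h3).2.1] at this
    let cnt : ℕ → ℕ := fun j => ((Finset.Ico m0 j).filter sw).card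
    have hcnt : ∀ j, j < n → cnt j ≤ T + 1 := by
      intro j hj
      have := Finset.card_le_card_of_injOn (s := (Finset.Ico m0 j).filter sw)
        (t := Finset.range (T + 1)) (fun i => a i / 2) (by
          intro i hi
          simp only [Finset.coe_filter, Finset.mem_Ico, Set.mem_ofPred_eq] at hi
          simp only [Finset.coe_range, Set.mem_Iio]
          have := hle i hi.1.1 (by omega) hi.2
          omega) (by
          intro i hi k hk h
          simp only [Finset.coe_filter, Finset.mem_Ico, Set.mem_ofPred_eq] at hi hk
          exact tinj i k hi.2 hk.2 h)
      simpa using this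
    have main : ∀ j, m0 < j → j ≤ n → ∃ m, m0 ≤ m ∧ m < j ∧ sw m ∧
        (m : ℤ) ≤ m0 + 2 * M * cnt m ∧
        ∀ i, m < i → i ≤ j → c i = c (m + 1) ∧ x i = x (m + 1) + δ (m + 1) * (i - m - 1) ∧
          δ i = δ (m + 1) := by
      intro j hj
      induction j, hj using Nat.le_induction with
      | base =>
        intro _
        refine ⟨m0, le_rfl, by omega, hm0, ?_, ?_⟩
        · have : (0 : ℤ) ≤ 2 * M * cnt m0 := by positivity
          omega
        · intro i h1 h2
          have : i = m0 + 1 := by omega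
          subst this
          simp
      | succ j hj ih =>
        intro hjn
        obtain ⟨m, h1, h2, h3, h4, h5⟩ := ih (by omega)
        by_cases hs : sw j
        · refine ⟨j, by omega, by omega, hs, ?_, ?_⟩
          · have hc : cnt m + 1 ≤ cnt j := by
              have hsub : insert m ((Finset.Ico m0 m).filter sw) ⊆ (Finset.Ico m0 j).filter sw := by
                intro i hi
                simp only [Finset.mem_insert, Finset.mem_filter, Finset.mem_Ico] at hi ⊢
                rcases hi with rfl | hi
                · exact ⟨⟨h1, h2⟩, h3⟩
                · exact ⟨⟨hi.1.1, by omega⟩, hi.2⟩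
              have := Finset.card_le_card hsub
              rwa [Finset.card_insert_of_notMem (by simp)] at this
            have hd1 := harr j (by omega) (by omega) hs
            have hd2 := hdep m (by omega) (by omega) h3
            obtain ⟨-, e2, e3⟩ := h5 j (by omega) le_rfl
            rw [e2, e3] at hd1
            have hjm : (j : ℤ) - m ≤ 2 * M := by
              rw [abs_le] at hd1 hd2
              rcases hδ (m + 1) with h | h <;> rw [h] at hd1 <;> linarith [hd1.1, hd1.2, hd2.1, hd2.2]
            have hc' : (cnt m : ℤ) + 1 ≤ cnt j := by exact_mod_cast hc
            nlinarith
          · intro i h1 h2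
            have : i = j + 1 := by omega
            subst this
            simp
        · refine ⟨m, h1, by omega, h3, h4, ?_⟩
          intro i hi1 hi2
          rcases hi2.eq_or_lt with rfl | hi2
          · obtain ⟨d1, d2, d3⟩ := cont j hs
            obtain ⟨e1, e2, e3⟩ := h5 j (by omega) le_rfl
            refine ⟨d1.trans e1, ?_, d3.trans e3⟩
            rw [d2, e2, e3]
            push_cast
            ring
          · exact h5 i hi1 (by omega)
    obtain ⟨m, h1, h2, h3, h4, h5⟩ := main n hn1 le_rfl
    clear_value cnt
    obtain ⟨A1, A2, A3, A4⟩ := hab n hn2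
    generalize a n = N at A1 A3 A4 hn3
    obtain ⟨N', hN'⟩ : ∃ N', N = N' + 1 := ⟨N - 1, by omega⟩
    have hxm := hdep m h1 h2 h3
    obtain ⟨-, e2, e3⟩ := h5 n h2 le_rfl
    have hd1 : δ (m + 1) = 1 ∨ δ (m + 1) = -1 := hδ (m + 1)
    generalize δ (m + 1) = d at e2 e3 h5 hd1
    have hdd : d * d = 1 := by rcases hd1 with h | h <;> rw [h] <;> norm_num
    have hMY : M ≤ s.Y N' := hMdef ▸ s.mono.monotone (by omega)
    have hYY : s.Y N' < s.Y N := s.mono (by omega)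
    have hpos : x (m + 1) + d * (n - m) = s.sd N * s.Y N := by
      have := congrArg Prod.snd A1
      simp only [node] at this
      rw [← this, e2, e3]
      ring
    have hnm : (m : ℤ) < n := by exact_mod_cast h2
    have hdsd : s.sd N = d := by
      rw [abs_le] at hxm
      rcases hd1 with h | h <;> rcases s.hsd N with h' | h' <;> rw [h, h'] at hpos <;> rw [h, h'] <;>
        (exfalso; linarith [hxm.1, hxm.2])
    have hYN : d * x (m + 1) + (n - m) = s.Y N := by
      have := congrArg (fun z => d * z) hpos
      simp only [hdsd, mul_add, ← mul_assoc, hdd, one_mul] at this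
      exact this
    have hdx : |d * x (m + 1)| ≤ M := by
      rcases hd1 with h | h <;> rw [h] <;> simpa using hxm
    have hTN : (T : ℤ) + 1 ≤ N / 2 := by omega
    have hcm : (cnt m : ℤ) ≤ T + 1 := by exact_mod_cast hcnt m h2
    have hm0T : (m0 : ℤ) ≤ T := by exact_mod_cast hT1
    have hN2 : 2 * (T : ℤ) + 1 ≤ N' := by omega
    have hMcnt : 2 * M * cnt m ≤ s.Y N' * (N' + 1) := by
      have : M * (2 * cnt m) ≤ s.Y N' * (N' + 1) :=
        mul_le_mul hMY (by linarith) (by positivity) (by linarith)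
      linarith
    have hg := s.good N'
    rw [← hN', hdsd] at hg
    have hfinal := hg ε hε.1 (d * x (m + 1) - m - 1) (by
      rw [abs_le] at hdx ⊢
      constructor <;> nlinarith [hdx.1, hdx.2]) (by
      intro i hi1 hi2
      have hi3 : d * x (m + 1) ≤ i := by
        rw [abs_le] at hdx
        nlinarith [hdx.1, hdx.2]
      obtain ⟨j, hj⟩ : ∃ j : ℕ, (j : ℤ) = i - (d * x (m + 1) - m - 1) :=
        ⟨(i - (d * x (m + 1) - m - 1)).toNat, by omega⟩
      obtain ⟨-, f2, f3⟩ := h5 j (by omega) (by omega)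
      rw [← hj, ← hP j, f2, f3]
      congr 1
      rw [mul_add, ← mul_assoc, hdd]
      linarith)
    rw [show s.Y N - (d * x (m + 1) - m - 1) = ((n + 1 : ℕ) : ℤ) by push_cast; linarith,
      ← hP (n + 1), show x (n + 1) = (s.node (b n)).2 from congrArg Prod.snd A2, s.node_type _ _ (hδ _), ← hdsd, s.ty] at hfinal
    have hpar : b n % 2 ≠ N % 2 := by omega
    simp only [decide_eq_decide] at hfinal
    omega

lemma not_inf (hinf : {n : ℤ | IsTurn o n}.Infinite) : ¬ InfDisjointCopies (doubleRay o) s.D := by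
  rintro ⟨f, hf⟩
  obtain ⟨ε, hε⟩ := exists_turnful o hinf
  choose c δ K hδ hK using fun i => s.tail (f i) ε hε
  have hcls : ∀ i, (c i).1 = (c 0).1 := by
    intro i
    by_contra hne
    have hi : i ≠ 0 := by rintro rfl; exact hne rfl
    obtain ⟨t, ht, h1, h2, h3, h4⟩ := s.hit (c i) (c 0) hne (δ i) (δ 0) (hδ i) (hδ 0)
      (max (K i).toNat (K 0).toNat)
    have hY : ∀ n : ℕ, (n : ℤ) ≤ s.Y n := by
      intro n
      induction n with
      | zero => exact (s.Y_pos 0).le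
      | succ n ih =>
        have : s.Y n < s.Y (n + 1) := s.mono (Nat.lt_succ_self n)
        push_cast
        omega
    have y1 := hY (2 * t)
    have y2 := hY (2 * t + 1)
    push_cast at y1 y2
    obtain ⟨u, hu⟩ := hK i (s.Y (2 * t)) (by omega)
    obtain ⟨v, hv⟩ := hK 0 (s.Y (2 * t + 1)) (by omega)
    apply hf i 0 hi u v
    rw [hu, hv, ← h1, ← h2, ← h3, ← h4]
    exact (s.rho_even t).trans (s.rho_odd t).symm
  have hfin : (Set.range (fun j : Fin (c 0).1 => (⟨(c 0).1, j⟩ : Ln)) ×ˢ ({1, -1} : Set ℤ)).Finite :=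
    (Set.finite_range _).prod (Set.toFinite _)
  obtain ⟨i, -, j, -, hij, he⟩ := Set.infinite_univ.exists_ne_map_eq_of_mapsTo
    (f := fun i : ℕ => (c i, δ i)) (by
      intro i _
      refine ⟨?_, by simpa using (hδ i).1⟩
      have key : ∀ (k : ℕ) (p : Ln), p.1 = k →
          p ∈ Set.range (fun j : Fin k => (⟨k, j⟩ : Ln)) := by
        rintro k ⟨k', r⟩ rfl
        exact ⟨r, rfl⟩
      exact key _ _ (hcls i)) hfin
  simp only [Prod.mk.injEq] at he
  obtain ⟨u, hu⟩ := hK i (max (K i) (K j)) (le_max_left _ _)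
  obtain ⟨v, hv⟩ := hK j (max (K i) (K j)) (le_max_right _ _)
  apply hf i j hij u v
  rw [hu, hv, he.1, he.2]

end Sys

end NPU

/-- every non-periodic oriented double ray with infinitely many
turns is non-ubiquitous. -/
theorem nonperiodic_infinite_turns_not_ubiquitous (o : ℤ → Bool)
    (hinf : {n : ℤ | IsTurn o n}.Infinite)
    (hnp : ¬ DRayPeriodic o) :
    ¬ Ubiquitous (doubleRay o) := by
  intro hU
  obtain ⟨s⟩ := NPU.exists_sys o hinf
  exact s.not_inf hinf (hU _ s.D s.many)
end

section
/- An oriented double ray with at least one turn is ubiquitous if and only if it has a finite, odd number of turns. -/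
namespace LinkAux

variable {W ι κ : Type}

/-- A finite profile of visited positions in which every passed position was rejected. -/
def Valid (R : ι → ℕ → W) (S : κ → ℕ → W) (p : ι → ℕ) : Prop :=
  ∀ i q, q < p i → (∀ j b, R i q ≠ S j b) ∨
    ∃ j b i' q' b', R i q = S j b ∧ q' ≤ p i' ∧ R i' q' = S j b' ∧ b < b'

def Vis (R : ι → ℕ → W) (S : κ → ℕ → W) (i : ι) (q : ℕ) : Prop :=
  ∃ p, Valid R S p ∧ q ≤ p i

lemma valid_zero (R : ι → ℕ → W) (S : κ → ℕ → W) : Valid R S (fun _ => 0) := by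
  intro i q h; simp at h

lemma valid_sup {R : ι → ℕ → W} {S : κ → ℕ → W} {p p' : ι → ℕ}
    (h : Valid R S p) (h' : Valid R S p') : Valid R S (fun i => max (p i) (p' i)) := by
  intro i q hq
  rcases lt_max_iff.1 hq with hq | hq
  · rcases h i q hq with h1 | ⟨j, b, i', q', b', h1, h2, h3, h4⟩
    · exact Or.inl h1
    · exact Or.inr ⟨j, b, i', q', b', h1, le_max_of_le_left h2, h3, h4⟩
  · rcases h' i q hq with h1 | ⟨j, b, i', q', b', h1, h2, h3, h4⟩
    · exact Or.inl h1
    · exact Or.inr ⟨j, b, i', q', b', h1, le_max_of_le_right h2, h3, h4⟩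

lemma vis_mono {R : ι → ℕ → W} {S : κ → ℕ → W} {i : ι} {q q' : ℕ} (h : Vis R S i q)
    (hq : q' ≤ q) : Vis R S i q' := by
  obtain ⟨p, hp, h⟩ := h
  exact ⟨p, hp, hq.trans h⟩

lemma vis_free {R : ι → ℕ → W} {S : κ → ℕ → W} {i : ι} {q : ℕ} (h : Vis R S i q)
    (hf : ∀ j b, R i q ≠ S j b) : Vis R S i (q + 1) := by
  classical
  obtain ⟨p, hp, h⟩ := h
  refine ⟨fun k => if k = i then max (p i) (q+1) else p k, ?_, by simp⟩
  have hle : ∀ k, p k ≤ (fun k => if k = i then max (p i) (q+1) else p k) k := by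
    intro k; by_cases hk : k = i <;> simp [hk]
  intro k r hr
  by_cases hk : r < p k
  · rcases hp k r hk with h1 | ⟨j, b, i', q', b', h1, h2, h3, h4⟩
    · exact Or.inl h1
    · exact Or.inr ⟨j, b, i', q', b', h1, h2.trans (hle i'), h3, h4⟩
  · by_cases hki : k = i
    · subst hki
      simp at hr
      have : r = q := by omega
      subst this
      exact Or.inl hf
    · simp [hki] at hr; omega

lemma vis_beat {R : ι → ℕ → W} {S : κ → ℕ → W} {i i' : ι} {q q' : ℕ} {j : κ} {b b' : ℕ}
    (h : Vis R S i q) (h' : Vis R S i' q')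
    (h1 : R i q = S j b) (h2 : R i' q' = S j b') (hb : b < b') : Vis R S i (q + 1) := by
  classical
  obtain ⟨p0, hp0, h⟩ := h
  obtain ⟨p1, hp1, h'⟩ := h'
  obtain ⟨p, hp, hpi, hpi'⟩ : ∃ p, Valid R S p ∧ q ≤ p i ∧ q' ≤ p i' :=
    ⟨_, valid_sup hp0 hp1, le_max_of_le_left h, le_max_of_le_right h'⟩
  refine ⟨fun k => if k = i then max (p i) (q+1) else p k, ?_, by simp⟩
  have hle : ∀ k, p k ≤ (fun k => if k = i then max (p i) (q+1) else p k) k := by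
    intro k; by_cases hk : k = i <;> simp [hk]
  intro k r hr
  by_cases hk : r < p k
  · rcases hp k r hk with h1 | ⟨j, b, i', q', b', h1, h2, h3, h4⟩
    · exact Or.inl h1
    · exact Or.inr ⟨j, b, i', q', b', h1, h2.trans (hle i'), h3, h4⟩
  · by_cases hki : k = i
    · subst hki
      simp at hr
      have : r = q := by omega
      subst this
      exact Or.inr ⟨j, b, i', q', b', h1, hpi'.trans (hle i'), h2, hb⟩
    · simp [hki] at hr; omega

/-- A finite set of engaged target rays has at most as many elements as there are sources. -/
lemma engaged_card [Fintype ι] {R : ι → ℕ → W} {S : κ → ℕ → W}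
    (hS : ∀ j b j' b', S j b = S j' b' → j = j' ∧ b = b')
    (E : Finset κ) (hE : ∀ j ∈ E, ∃ i q b, Vis R S i q ∧ R i q = S j b) :
    E.card ≤ Fintype.card ι := by
  classical
  -- a common valid profile
  have key : ∀ E' : Finset κ, E' ⊆ E → ∃ p, Valid R S p ∧ ∀ j ∈ E', ∃ i q b, q ≤ p i ∧
      R i q = S j b := by
    intro E'
    induction E' using Finset.induction_on with
    | empty => intro _; exact ⟨_, valid_zero R S, by simp⟩
    | insert a s ha ih =>
      intro hs
      obtain ⟨p, hp, hpj⟩ := ih (fun x hx => hs (Finset.mem_insert_of_mem hx))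
      obtain ⟨i, q, b, ⟨p', hp', hq⟩, hR⟩ := hE a (hs (Finset.mem_insert_self a s))
      refine ⟨_, valid_sup hp hp', ?_⟩
      intro j hj
      rcases Finset.mem_insert.1 hj with rfl | hj
      · exact ⟨i, q, b, le_max_of_le_right hq, hR⟩
      · obtain ⟨i, q, b, hq, hR⟩ := hpj j hj
        exact ⟨i, q, b, le_max_of_le_left hq, hR⟩
  obtain ⟨p, hp, hpj⟩ := key E subset_rfl
  have key2 : ∀ j ∈ E, ∃ i, ∃ b, R i (p i) = S j b := by
    intro j hj
    -- the maximal b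
    let A : Set ℕ := {b | ∃ i q, q ≤ p i ∧ R i q = S j b}
    have hfin : A.Finite := by
      have : (Set.range (fun x : (Σ i : ι, Fin (p i + 1)) => R x.1 x.2)).Finite :=
        Set.finite_range _
      refine Set.Finite.of_finite_image (f := S j) (this.subset ?_) ?_
      · rintro _ ⟨b, ⟨i, q, hq, hR⟩, rfl⟩
        exact ⟨⟨i, ⟨q, by omega⟩⟩, hR⟩
      · intro b _ b' _ h
        exact (hS _ _ _ _ h).2
    have hne : A.Nonempty := by
      obtain ⟨i, q, b, hq, hR⟩ := hpj j hj
      exact ⟨b, i, q, hq, hR⟩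
    obtain ⟨b, ⟨i, q, hq, hR⟩, hmax⟩ := hfin.exists_maximal hne
    rcases hq.lt_or_eq with hlt | rfl
    · exfalso
      rcases hp i q hlt with h1 | ⟨j', b1, i', q', b', h1, h2, h3, h4⟩
      · exact h1 _ _ hR
      · obtain ⟨rfl, rfl⟩ := hS _ _ _ _ (hR.symm.trans h1)
        have := hmax (y := b') ⟨i', q', h2, h3⟩ h4.le
        omega
    · exact ⟨i, b, hR⟩
  choose φ hφ using key2
  rw [← Fintype.card_coe E]
  refine Fintype.card_le_of_injective (fun x : E => φ x.1 x.2) ?_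
  rintro ⟨j, hj⟩ ⟨j', hj'⟩ h
  obtain ⟨b, hb⟩ := hφ j hj
  obtain ⟨b', hb'⟩ := hφ j' hj'
  simp only at h
  rw [h] at hb
  exact Subtype.ext (hS _ _ _ _ (hb.symm.trans hb')).1

theorem link [Fintype ι] (adj : W → W → Prop) (R : ι → ℕ → W) (S : κ → ℕ → W)
    (hR : ∀ j b j' b', R j b = R j' b' → j = j' ∧ b = b')
    (hS : ∀ j b j' b', S j b = S j' b' → j = j' ∧ b = b')
    (aR : ∀ i q, adj (R i q) (R i (q+1))) (aS : ∀ i q, adj (S i q) (S i (q+1))) :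
    ∃ (R' : ι → ℕ → W) (E : Set κ),
      (∀ j b j' b', R' j b = R' j' b' → j = j' ∧ b = b') ∧
      (∀ i q, adj (R' i q) (R' i (q+1))) ∧ (∀ i, R' i 0 = R i 0) ∧
      (∀ i q, (∃ i' q', R' i q = R i' q') ∨ ∃ j b, R' i q = S j b) ∧
      (∀ E' : Finset κ, (∀ j ∈ E', j ∈ E) → E'.card ≤ Fintype.card ι) ∧
      (∀ j, j ∉ E → ∀ i q b, R' i q ≠ S j b) := by
  classical
  have hset : ∀ i, (∀ q, Vis R S i q) ∨ ∃ P j b, Vis R S i P ∧ (∀ q, Vis R S i q ↔ q ≤ P) ∧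
      R i P = S j b ∧ ∀ i' q' b', Vis R S i' q' → R i' q' = S j b' → b' ≤ b := by
    intro i
    by_cases hall : ∀ q, Vis R S i q
    · exact Or.inl hall
    · right
      push Not at hall
      have h0 : Vis R S i 0 := ⟨_, valid_zero R S, le_rfl⟩
      let n := Nat.find hall
      have hn : ¬ Vis R S i n := Nat.find_spec hall
      have hn0 : n ≠ 0 := by intro h; rw [h] at hn; exact hn h0
      obtain ⟨P, hP⟩ := Nat.exists_eq_succ_of_ne_zero hn0
      have hPv : Vis R S i P := by
        by_contra h
        have := Nat.find_min' hall h
        have : n ≤ P := this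
        omega
      rw [hP] at hn
      have hex : ∃ j b, R i P = S j b := by
        by_contra h
        push Not at h
        exact hn (vis_free hPv h)
      obtain ⟨j, b, hjb⟩ := hex
      refine ⟨P, j, b, hPv, ?_, hjb, ?_⟩
      · intro q
        constructor
        · intro h
          by_contra hlt
          exact hn (vis_mono h (by omega))
        · intro h; exact vis_mono hPv h
      · intro i' q' b' hv hR'
        by_contra hlt
        exact hn (vis_beat hPv hv hjb hR' (by omega))
  have hex : ∀ i, ∃ r : ℕ → W, r 0 = R i 0 ∧ (∀ q, adj (r q) (r (q+1))) ∧
      ((∀ q, Vis R S i q ∧ r q = R i q) ∨ ∃ P j b, Vis R S i P ∧ R i P = S j b ∧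
        (∀ i' q' b', Vis R S i' q' → R i' q' = S j b' → b' ≤ b) ∧
        ∀ q, (q ≤ P ∧ Vis R S i q ∧ r q = R i q) ∨ (P < q ∧ r q = S j (b + (q - P)))) := by
    intro i
    rcases hset i with h | ⟨P, j, b, hv, hiff, hRP, hmax⟩
    · exact ⟨R i, rfl, aR i, Or.inl (fun q => ⟨h q, rfl⟩)⟩
    · refine ⟨fun q => if q ≤ P then R i q else S j (b + (q - P)), by simp, ?_, Or.inr
        ⟨P, j, b, hv, hRP, hmax, ?_⟩⟩
      · intro q
        rcases lt_trichotomy q P with h | h | h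
        · have h1 : q ≤ P := h.le
          have h2 : q + 1 ≤ P := h
          simp only [h1, h2, if_true]; exact aR i q
        · subst h
          simp only [le_refl, if_true, show ¬ (q + 1 ≤ q) by omega, if_false, hRP]
          have := aS j b
          simpa using this
        · have h1 : ¬ q ≤ P := by omega
          have h2 : ¬ q + 1 ≤ P := by omega
          simp only [h1, h2, if_false]
          have := aS j (b + (q - P))
          rwa [show b + (q - P) + 1 = b + (q + 1 - P) by omega] at this
      · intro q
        by_cases h : q ≤ P
        · left; exact ⟨h, (hiff q).2 h, by simp [h]⟩
        · right; exact ⟨by omega, by simp [h]⟩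
  choose R' h0 ha hcase using hex
  -- uniform description of values
  have hval : ∀ i q, (Vis R S i q ∧ R' i q = R i q) ∨ ∃ P j b, P < q ∧ Vis R S i P ∧ R i P = S j b ∧
        (∀ i' q' b', Vis R S i' q' → R i' q' = S j b' → b' ≤ b) ∧ R' i q = S j (b + (q - P)) := by
    intro i q
    rcases hcase i with h | ⟨P, j, b, hv, hRP, hmax, h⟩
    · exact Or.inl (h q)
    · rcases h q with h | h
      · exact Or.inl h.2
      · exact Or.inr ⟨P, j, b, h.1, hv, hRP, hmax, h.2⟩
  refine ⟨R', {j | ∃ i q b, Vis R S i q ∧ R i q = S j b}, ?_, ha, h0, ?_, ?_, ?_⟩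
  · intro i q i' q' h
    rcases hval i q with ⟨hv, he⟩ | ⟨P, j, b, hlt, hv, hRP, hmax, he⟩ <;>
    rcases hval i' q' with ⟨hv', he'⟩ | ⟨P', j', b', hlt', hv', hRP', hmax', he'⟩
    · exact hR _ _ _ _ (he.symm.trans (h.trans he'))
    · exfalso
      have := hmax' _ _ _ hv (he.symm.trans (h.trans he'))
      omega
    · exfalso
      have := hmax _ _ _ hv' (he'.symm.trans (h.symm.trans he))
      omega
    · obtain ⟨rfl, hb⟩ := hS _ _ _ _ (he.symm.trans (h.trans he'))
      have h1 := hmax _ _ _ hv' hRP'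
      have h2 := hmax' _ _ _ hv hRP
      have h3 : b = b' := le_antisymm h2 h1
      subst h3
      obtain ⟨h4, h5⟩ := hR _ _ _ _ (hRP.trans hRP'.symm)
      exact ⟨h4, by omega⟩
  · intro i q
    rcases hval i q with ⟨hv, he⟩ | ⟨P, j, b, hlt, hv, hRP, hmax, he⟩
    · exact Or.inl ⟨_, _, he⟩
    · exact Or.inr ⟨_, _, he⟩
  · intro E' hE'
    exact engaged_card hS E' hE'
  · intro j hj i q b h
    rcases hval i q with ⟨hv, he⟩ | ⟨P, j', b', hlt, hv, hRP, hmax, he⟩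
    · exact hj ⟨i, q, b, hv, he.symm.trans h⟩
    · obtain ⟨rfl, hb⟩ := hS _ _ _ _ (he.symm.trans h)
      exact hj ⟨_, _, _, hv, hRP⟩

end LinkAux

namespace FamAux

variable {W C : Type}

def Many (im : C → Set W) (A : Set C) : Prop :=
  ∀ k : ℕ, ∃ f : Fin k → C, (∀ i, f i ∈ A) ∧ ∀ i j, i ≠ j → Disjoint (im (f i)) (im (f j))

lemma card_meet {α : Type} [Fintype α] [DecidableEq α] (im : C → Set W) (f : α → C)
    (hf : ∀ i j, i ≠ j → Disjoint (im (f i)) (im (f j))) (X : Finset W)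
    (B : Finset α) (hB : ∀ g ∈ B, ¬ Disjoint (im (f g)) (X : Set W)) : B.card ≤ X.card := by
  have h : ∀ g ∈ B, ∃ w, w ∈ im (f g) ∧ w ∈ X := by
    intro g hg
    obtain ⟨w, hw1, hw2⟩ := Set.not_disjoint_iff.1 (hB g hg)
    exact ⟨w, hw1, hw2⟩
  choose φ h1 h2 using h
  rw [← Fintype.card_coe B, ← Fintype.card_coe X]
  refine Fintype.card_le_of_injective (fun x : B => (⟨φ x.1 x.2, h2 x.1 x.2⟩ : X)) ?_
  rintro ⟨j, hj⟩ ⟨j', hj'⟩ h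
  by_contra hne
  have hne' : j ≠ j' := fun h => hne (Subtype.ext h)
  have h' : φ j hj = φ j' hj' := congrArg Subtype.val h
  exact Set.disjoint_left.1 (hf j j' hne') (h1 j hj) (h' ▸ h1 j' hj')

def restr {ι : Type} (im : C → Set W) (co : C → Finset W) (A : Set C) (f : ι → C) : Set C :=
  {G | G ∈ A ∧ ∀ i, Disjoint (co G : Set W) (im (f i)) ∧ Disjoint (im G) (co (f i) : Set W)}

theorem nonblock (im : C → Set W) (co : C → Finset W) (c : ℕ) (hc : ∀ G, (co G).card ≤ c)
    (A : Set C) (hA : Many im A) (n : ℕ) :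
    ∃ f : Fin n → C, (∀ i, f i ∈ A) ∧ (∀ i j, i ≠ j → Disjoint (im (f i)) (im (f j))) ∧
      Many im (restr im co A f) := by
  classical
  obtain ⟨F, hFA, hFd⟩ := hA ((c + 1) * n)
  by_contra hcon
  push Not at hcon
  let F' : Fin (c+1) → Fin n → C := fun a i => F (finProdFinEquiv (a, i))
  have hF'd : ∀ a a' i i', (a, i) ≠ (a', i') → Disjoint (im (F' a i)) (im (F' a' i')) := by
    intro a a' i i' h
    exact hFd _ _ (fun h' => h (finProdFinEquiv.injective h'))
  have hm : ∀ a, ∃ m : ℕ, ∀ g : Fin m → C, (∀ i, g i ∈ restr im co A (F' a)) →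
      ∃ i j, i ≠ j ∧ ¬ Disjoint (im (g i)) (im (g j)) := by
    intro a
    have := hcon (F' a) (fun i => hFA _) (fun i j hij => hF'd _ _ _ _ (by simpa using hij))
    unfold Many at this
    push Not at this
    exact this
  choose m hm using hm
  obtain ⟨G, hGA, hGd⟩ := hA ((∑ a, m a) + (c+1) * n * c + 1)
  let Good : Fin (c+1) → Finset (Fin ((∑ a, m a) + (c+1) * n * c + 1)) :=
    fun a => Finset.univ.filter (fun g => G g ∈ restr im co A (F' a))
  let Bad : Fin ((c+1) * n) → Finset (Fin ((∑ a, m a) + (c+1) * n * c + 1)) :=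
    fun x => Finset.univ.filter (fun g => ¬ Disjoint (im (G g)) (co (F x) : Set W))
  have hgood : ∀ a, (Good a).card ≤ m a := by
    intro a
    by_contra hlt
    push Not at hlt
    obtain ⟨T, hT, hTc⟩ := Finset.exists_subset_card_eq hlt.le
    let e := T.equivFinOfCardEq hTc
    obtain ⟨i, j, hij, hd⟩ := hm a (fun i => G (e.symm i).1) (fun i => by
      have := hT (e.symm i).2
      exact (Finset.mem_filter.1 this).2)
    exact hd (hGd _ _ (fun h => hij (e.symm.injective (Subtype.ext h))))
  have hbad : ∀ x, (Bad x).card ≤ c := by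
    intro x
    refine (card_meet im G hGd (co (F x)) (Bad x) ?_).trans (hc _)
    intro g hg
    exact (Finset.mem_filter.1 hg).2
  let U := (Finset.univ.biUnion Good) ∪ (Finset.univ.biUnion Bad)
  have hU : U.card < (∑ a, m a) + (c+1) * n * c + 1 := by
    have h1 : (Finset.univ.biUnion Good).card ≤ ∑ a, m a :=
      Finset.card_biUnion_le.trans (Finset.sum_le_sum (fun a _ => hgood a))
    have h2 : (Finset.univ.biUnion Bad).card ≤ (c+1) * n * c := by
      refine Finset.card_biUnion_le.trans ((Finset.sum_le_sum (fun a _ => hbad a)).trans ?_)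
      simp
    have := Finset.card_union_le (Finset.univ.biUnion Good) (Finset.univ.biUnion Bad)
    show (Finset.univ.biUnion Good ∪ Finset.univ.biUnion Bad).card < _
    omega
  obtain ⟨g, hg⟩ : ∃ g, g ∉ U := by
    by_contra h
    push Not at h
    have : U = Finset.univ := Finset.eq_univ_iff_forall.2 h
    rw [this] at hU
    simp at hU
  have hg1 : ∀ a, G g ∉ restr im co A (F' a) := by
    intro a h
    apply hg
    refine Finset.mem_union_left _ (Finset.mem_biUnion.2 ⟨a, Finset.mem_univ _, ?_⟩)
    exact Finset.mem_filter.2 ⟨Finset.mem_univ _, h⟩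
  have hg2 : ∀ x, Disjoint (im (G g)) (co (F x) : Set W) := by
    intro x
    by_contra h
    apply hg
    refine Finset.mem_union_right _ (Finset.mem_biUnion.2 ⟨x, Finset.mem_univ _, ?_⟩)
    exact Finset.mem_filter.2 ⟨Finset.mem_univ _, h⟩
  have hw : ∀ a, ∃ w i, w ∈ co (G g) ∧ w ∈ im (F' a i) := by
    intro a
    by_contra h
    push Not at h
    apply hg1 a
    refine ⟨hGA g, fun i => ⟨?_, hg2 _⟩⟩
    rw [Set.disjoint_left]
    intro w hw
    exact h w i hw
  choose w i hw1 hw2 using hw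
  have hinj : Function.Injective (fun a => (⟨w a, hw1 a⟩ : co (G g))) := by
    intro a a' h
    by_contra hne
    have h' : w a = w a' := congrArg Subtype.val h
    have := hF'd a a' (i a) (i a') (by simp [hne])
    exact Set.disjoint_left.1 this (hw2 a) (h' ▸ hw2 a')
  have := Fintype.card_le_of_injective _ hinj
  simp at this
  have := hc (G g)
  omega

theorem exists_families (im : C → Set W) (co : C → Finset W) (c : ℕ) (hc : ∀ G, (co G).card ≤ c)
    (hA : Many im (Set.univ : Set C)) :
    ∃ F : (k : ℕ) → Fin k → C,
      (∀ k i j, i ≠ j → Disjoint (im (F k i)) (im (F k j))) ∧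
      (∀ k l i j, k ≠ l → Disjoint (co (F k i) : Set W) (im (F l j))) := by
  classical
  choose f hfA hfd hfm using fun (A : {A : Set C // Many im A}) n => nonblock im co c hc A.1 A.2 n
  let A : ℕ → {A : Set C // Many im A} := fun k =>
    Nat.rec ⟨Set.univ, hA⟩ (fun k A => ⟨restr im co A.1 (f A k), hfm A k⟩) k
  have hAs : ∀ k, (A (k+1)).1 = restr im co (A k).1 (f (A k) k) := fun k => rfl
  have hanti : Antitone (fun k => (A k).1) := by
    refine antitone_nat_of_succ_le (fun k => ?_)
    show (A (k+1)).1 ≤ (A k).1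
    rw [hAs]
    exact fun G hG => hG.1
  have hlt : ∀ k l i j, k < l → Disjoint (co (f (A l) l j) : Set W) (im (f (A k) k i)) ∧
      Disjoint (im (f (A l) l j)) (co (f (A k) k i) : Set W) := by
    intro k l i j hkl
    have h1 : f (A l) l j ∈ (A l).1 := hfA _ _ _
    have h2 := hanti (show k + 1 ≤ l from hkl) h1
    simp only [hAs] at h2
    exact h2.2 i
  refine ⟨fun k => f (A k) k, fun k i j h => hfd _ _ i j h, ?_⟩
  intro k l i j hkl
  rcases lt_or_gt_of_ne hkl with h | h
  · exact (hlt k l i j h).2.symm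
  · exact (hlt l k j i h).1

end FamAux

namespace OddAux

variable {W : Type} {o : ℤ → Bool} {D : Digraph W}

def sg (b : Bool) : ℤ := if b then 1 else -1

lemma edge_of (G : DCopy (doubleRay o) D) (n : ℤ) :
    (o n = true → D.Adj (G.toFun n) (G.toFun (n+1))) ∧
    (o n = false → D.Adj (G.toFun (n+1)) (G.toFun n)) :=
  ⟨fun h => G.adj _ _ (Or.inl ⟨rfl, h⟩), fun h => G.adj _ _ (Or.inr ⟨rfl, h⟩)⟩

lemma mk_copy (φ : ℤ → W) (hinj : Function.Injective φ)
    (h : ∀ n, (o n = true → D.Adj (φ n) (φ (n+1))) ∧ (o n = false → D.Adj (φ (n+1)) (φ n))) :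
    ∃ G : DCopy (doubleRay o) D, G.toFun = φ := by
  refine ⟨⟨φ, hinj, ?_⟩, rfl⟩
  rintro u v (⟨rfl, hu⟩ | ⟨rfl, hv⟩)
  · exact (h u).1 hu
  · exact (h v).2 hv

lemma tail_adj (N : ℕ) (hpos : ∀ n : ℤ, N ≤ n → o n = true) (hneg : ∀ n : ℤ, n < -N → o n = false)
    (G : DCopy (doubleRay o) D) (b : Bool) (L k : ℕ) (hL : N ≤ L) :
    D.Adj (G.toFun (sg b * (L + k : ℕ))) (G.toFun (sg b * (L + (k + 1) : ℕ))) := by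
  cases b
  · have := (edge_of G (-((L + (k + 1) : ℕ) : ℤ))).2 (hneg _ (by push_cast; omega))
    simp only [sg]
    convert this using 2 <;> · push_cast; simp; try ring
  · have := (edge_of G ((L + k : ℕ) : ℤ)).1 (hpos _ (by push_cast; omega))
    simp only [sg]
    convert this using 2 <;> · push_cast; simp; try ring

/-- Replace the tails of a copy beyond the window `|n| ≤ L` by new out-rays. -/
lemma glue (N : ℕ) (hpos : ∀ n : ℤ, N ≤ n → o n = true) (hneg : ∀ n : ℤ, n < -N → o n = false)
    (G : DCopy (doubleRay o) D) (L : ℕ) (hL : N ≤ L) (r : Bool → ℕ → W)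
    (hr0 : ∀ b, r b 0 = G.toFun (sg b * (L + 1 : ℕ)))
    (hra : ∀ b t, D.Adj (r b t) (r b (t+1)))
    (hri : ∀ b t b' t', r b t = r b' t' → b = b' ∧ t = t')
    (hrG : ∀ b t n, |n| ≤ (L : ℤ) → r b t ≠ G.toFun n) :
    ∃ G' : DCopy (doubleRay o) D, (∀ n, |n| ≤ (L : ℤ) → G'.toFun n = G.toFun n) ∧
      (∀ n, (L : ℤ) < |n| → ∃ b t, G'.toFun n = r b t) := by
  let φ : ℤ → W := fun n => if |n| ≤ (L : ℤ) then G.toFun n else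
    if 0 < n then r true (n.toNat - L - 1) else r false ((-n).toNat - L - 1)
  have h1 : ∀ n, |n| ≤ (L : ℤ) → φ n = G.toFun n := fun n hn => by simp [φ, hn]
  have h2 : ∀ t : ℕ, φ ((L : ℤ) + 1 + t) = r true t := by
    intro t
    have ha : ¬ |(L : ℤ) + 1 + t| ≤ (L : ℤ) := by
      rw [abs_of_nonneg (by omega)]; omega
    have hb : 0 < (L : ℤ) + 1 + t := by omega
    simp only [φ, ha, hb, if_true, if_false]
    congr 1; omega
  have h3 : ∀ t : ℕ, φ (-((L : ℤ) + 1 + t)) = r false t := by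
    intro t
    have ha : ¬ |-((L : ℤ) + 1 + t)| ≤ (L : ℤ) := by
      rw [abs_neg, abs_of_nonneg (by omega)]; omega
    have hb : ¬ 0 < -((L : ℤ) + 1 + t) := by omega
    simp only [φ, ha, hb, if_false]
    congr 1; omega
  have hcases : ∀ n : ℤ, |n| ≤ (L : ℤ) ∨ (∃ t : ℕ, n = (L : ℤ) + 1 + t) ∨
      (∃ t : ℕ, n = -((L : ℤ) + 1 + t)) := by
    intro n
    by_cases h : |n| ≤ (L : ℤ)
    · exact Or.inl h
    · right
      rw [not_le, lt_abs] at h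
      rcases h with h | h
      · left; exact ⟨(n - L - 1).toNat, by omega⟩
      · right; exact ⟨(-n - L - 1).toNat, by omega⟩
  have hinj : Function.Injective φ := by
    intro m n h
    rcases hcases m with hm | ⟨t, rfl⟩ | ⟨t, rfl⟩ <;>
    rcases hcases n with hn | ⟨t', rfl⟩ | ⟨t', rfl⟩
    · rw [h1 _ hm, h1 _ hn] at h; exact G.inj h
    · rw [h1 _ hm, h2] at h; exact absurd h.symm (hrG _ _ _ hm)
    · rw [h1 _ hm, h3] at h; exact absurd h.symm (hrG _ _ _ hm)
    · rw [h1 _ hn, h2] at h; exact absurd h (hrG _ _ _ hn)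
    · rw [h2, h2] at h; rw [(hri _ _ _ _ h).2]
    · rw [h2, h3] at h; exact absurd (hri _ _ _ _ h).1 (by simp)
    · rw [h1 _ hn, h3] at h; exact absurd h (hrG _ _ _ hn)
    · rw [h3, h2] at h; exact absurd (hri _ _ _ _ h).1 (by simp)
    · rw [h3, h3] at h; rw [(hri _ _ _ _ h).2]
  have h1' : ∀ n, |n| ≤ (L : ℤ) + 1 → φ n = G.toFun n := by
    intro n hn
    rcases hcases n with hm | ⟨t, rfl⟩ | ⟨t, rfl⟩
    · exact h1 n hm
    · have ht : t = 0 := by rw [abs_of_nonneg (by omega)] at hn; omega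
      subst ht
      rw [h2, hr0]; simp [sg]
    · have ht : t = 0 := by rw [abs_neg, abs_of_nonneg (by omega)] at hn; omega
      subst ht
      rw [h3, hr0]; simp [sg]
  obtain ⟨G', hG'⟩ := mk_copy (D := D) (o := o) φ hinj (by
    intro n
    by_cases ha : (L : ℤ) + 1 ≤ n
    · obtain ⟨t, rfl⟩ : ∃ t : ℕ, n = (L : ℤ) + 1 + t := ⟨(n - L - 1).toNat, by omega⟩
      have ho : o ((L : ℤ) + 1 + t) = true := hpos _ (by omega)
      rw [h2, show (L : ℤ) + 1 + t + 1 = (L : ℤ) + 1 + ((t + 1 : ℕ) : ℤ) by push_cast; ring, h2]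
      simp only [ho, true_implies]
      exact ⟨hra _ _, fun h => by simp at h⟩
    · by_cases hb : n ≤ -((L : ℤ) + 2)
      · obtain ⟨t, rfl⟩ : ∃ t : ℕ, n = -((L : ℤ) + 1 + ((t + 1 : ℕ) : ℤ)) :=
          ⟨(-n - L - 2).toNat, by omega⟩
        have ho : o (-((L : ℤ) + 1 + ((t + 1 : ℕ) : ℤ))) = false := hneg _ (by push_cast; omega)
        rw [h3, show -((L : ℤ) + 1 + ((t + 1 : ℕ) : ℤ)) + 1 = -((L : ℤ) + 1 + t) by
          push_cast; ring, h3]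
        simp only [ho, true_implies]
        exact ⟨fun h => by simp at h, hra _ _⟩
      · rw [h1' n (abs_le.2 ⟨by omega, by omega⟩), h1' (n+1) (abs_le.2 ⟨by omega, by omega⟩)]
        exact edge_of G n)
  refine ⟨G', ?_, ?_⟩
  · intro n hn; rw [hG', h1 n hn]
  · intro n hn
    rw [hG']
    rcases hcases n with hm | ⟨t, rfl⟩ | ⟨t, rfl⟩
    · omega
    · exact ⟨true, t, h2 t⟩
    · exact ⟨false, t, h3 t⟩

lemma abs_sg (b : Bool) (m : ℕ) : |sg b * (m : ℤ)| = m := by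
  cases b <;> simp [sg]

lemma sg_inj {b b' : Bool} {m m' : ℕ} (hm : 0 < m) (h : sg b * (m : ℤ) = sg b' * (m' : ℤ)) :
    b = b' ∧ m = m' := by
  cases b <;> cases b' <;> simp [sg] at h ⊢ <;> omega

lemma step (N : ℕ) (hpos : ∀ n : ℤ, N ≤ n → o n = true) (hneg : ∀ n : ℤ, n < -N → o n = false)
    (F : (k : ℕ) → Fin k → DCopy (doubleRay o) D)
    (hFd : ∀ k i j, i ≠ j → (F k i).VDisjoint (F k j))
    (Z : Set W) (hZt : ∀ k i n, (N : ℤ) < |n| → (F k i).toFun n ∉ Z)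
    (hZc : ∀ k i n, |n| ≤ (N : ℤ) → (F k i).toFun n ∈ Z)
    (s : ℕ) (g : ℕ → DCopy (doubleRay o) D)
    (hgZ : ∀ i < s, ∀ n, (N : ℤ) < |n| → (g i).toFun n ∉ Z)
    (hgd : ∀ i < s, ∀ j < s, i ≠ j → (g i).VDisjoint (g j)) :
    ∃ g' : ℕ → DCopy (doubleRay o) D,
      (∀ i < s + 1, ∀ n, (N : ℤ) < |n| → (g' i).toFun n ∉ Z) ∧
      (∀ i < s + 1, ∀ j < s + 1, i ≠ j → (g' i).VDisjoint (g' j)) ∧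
      (∀ i < s, ∀ n, |n| ≤ ((N + s : ℕ) : ℤ) → (g' i).toFun n = (g i).toFun n) := by
  classical
  set L := N + s with hLdef
  let Fx : Finset W := ((Finset.univ : Finset (Fin s)) ×ˢ (Finset.Icc (-(L : ℤ)) L)).image
    (fun x => (g x.1).toFun x.2)
  have hFx : ∀ i < s, ∀ n, |n| ≤ (L : ℤ) → (g i).toFun n ∈ Fx := by
    intro i hi n hn
    refine Finset.mem_image.2 ⟨(⟨i, hi⟩, n), ?_, rfl⟩
    rw [abs_le] at hn
    simp [hn.1, hn.2]
  have hFx' : ∀ w ∈ Fx, ∃ i, i < s ∧ ∃ n, |n| ≤ (L : ℤ) ∧ w = (g i).toFun n := by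
    intro w hw
    obtain ⟨⟨i, n⟩, hin, rfl⟩ := Finset.mem_image.1 hw
    simp at hin
    exact ⟨i, i.2, n, abs_le.2 hin, rfl⟩
  set k := Fx.card + (2 * s + 1) with hk
  let J : Finset (Fin k) := Finset.univ.filter
    (fun j => Disjoint (Set.range (F k j).toFun) (Fx : Set W))
  have hJ : 2 * s + 1 ≤ J.card := by
    have h1 := FamAux.card_meet (C := DCopy (doubleRay o) D) (fun G => Set.range G.toFun) (F k)
      (fun i j hij => by
        rw [Set.disjoint_left]
        rintro _ ⟨u, rfl⟩ ⟨v, hv⟩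
        exact hFd k i j hij u v hv.symm) Fx
        (Finset.univ.filter (fun j => ¬ Disjoint (Set.range (F k j).toFun) (Fx : Set W)))
        (fun j hj => (Finset.mem_filter.1 hj).2)
    have h2 := Finset.card_filter_add_card_filter_not (s := (Finset.univ : Finset (Fin k)))
      (fun j => Disjoint (Set.range (F k j).toFun) (Fx : Set W))
    rw [Finset.card_univ, Fintype.card_fin] at h2
    show 2 * s + 1 ≤ (Finset.univ.filter _).card
    omega
  have hJ' : ∀ j : J, ∀ n, (F k j.1).toFun n ∉ Fx := by
    intro j n hn
    exact Set.disjoint_left.1 (Finset.mem_filter.1 j.2).2 ⟨n, rfl⟩ hn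
  let R : Fin s × Bool → ℕ → W := fun x t => (g x.1).toFun (sg x.2 * ((L + 1 + t : ℕ) : ℤ))
  let S : J × Bool → ℕ → W := fun x t => (F k x.1.1).toFun (sg x.2 * ((N + 1 + t : ℕ) : ℤ))
  have hRinj : ∀ j b j' b', R j b = R j' b' → j = j' ∧ b = b' := by
    rintro ⟨i, e⟩ t ⟨i', e'⟩ t' h
    by_cases hi : i = i'
    · subst hi
      obtain ⟨h1, h2⟩ := sg_inj (by omega) ((g i).inj h)
      exact ⟨Prod.ext rfl h1, by omega⟩
    · exact absurd h (hgd i i.2 i' i'.2 (fun h => hi (Fin.ext h)) _ _)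
  have hSinj : ∀ j b j' b', S j b = S j' b' → j = j' ∧ b = b' := by
    rintro ⟨i, e⟩ t ⟨i', e'⟩ t' h
    by_cases hi : i = i'
    · subst hi
      obtain ⟨h1, h2⟩ := sg_inj (by omega) ((F k i.1).inj h)
      exact ⟨Prod.ext rfl h1, by omega⟩
    · exact absurd h (hFd k _ _ (fun h => hi (Subtype.ext h)) _ _)
  obtain ⟨R', E, hR'inj, hR'a, hR'0, hR'v, hEc, hEd⟩ := LinkAux.link D.Adj R S hRinj hSinj
    (fun i q => tail_adj N hpos hneg (g i.1) i.2 (L + 1) q (by omega))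
    (fun i q => tail_adj N hpos hneg (F k i.1.1) i.2 (N + 1) q (by omega))
  obtain ⟨j, hj⟩ : ∃ j : J, ∀ b, (j, b) ∉ E := by
    by_contra h
    push Not at h
    choose b hb using h
    have h1 := hEc (Finset.univ.image (fun j : J => (j, b j))) (by
      intro x hx
      obtain ⟨j, -, rfl⟩ := Finset.mem_image.1 hx
      exact hb j)
    rw [Finset.card_image_of_injective _ (fun x y hxy => (Prod.ext_iff.1 hxy).1)] at h1
    simp at h1
    omega
  have hR'Z : ∀ x t, R' x t ∉ Z := by
    intro x t
    rcases hR'v x t with ⟨i', q', h⟩ | ⟨j', b', h⟩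
    · rw [h]; refine hgZ _ i'.1.2 _ ?_
      rw [abs_sg]; push_cast; omega
    · rw [h]; refine hZt _ _ _ ?_
      rw [abs_sg]; push_cast; omega
  have hR'Fx : ∀ x t, R' x t ∉ Fx := by
    intro x t
    rcases hR'v x t with ⟨i', q', h⟩ | ⟨j', b', h⟩
    · rw [h]; intro hmem
      obtain ⟨i, hi, n, hn, he⟩ := hFx' _ hmem
      by_cases hii : (i'.1 : ℕ) = i
      · subst hii
        have := (g i'.1).inj he
        rw [← this, abs_sg] at hn
        push_cast at hn; omega
      · exact hgd _ i'.1.2 _ hi hii _ _ he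
    · rw [h]; exact hJ' _ _
  have hR'j : ∀ x t n, R' x t ≠ (F k j.1).toFun n := by
    intro x t n h
    by_cases hn : |n| ≤ (N : ℤ)
    · exact hR'Z x t (h ▸ hZc _ _ _ hn)
    · rw [not_le, lt_abs] at hn
      rcases hn with hn | hn
      · refine hEd (j, true) (hj true) x t (n - N - 1).toNat (h.trans ?_)
        simp only [S]; congr 1; simp [sg]; omega
      · refine hEd (j, false) (hj false) x t (-n - N - 1).toNat (h.trans ?_)
        simp only [S]; congr 1; simp [sg]; omega
  have hglue : ∀ i : Fin s, ∃ G' : DCopy (doubleRay o) D,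
      (∀ n, |n| ≤ (L : ℤ) → G'.toFun n = (g i).toFun n) ∧
      (∀ n, (L : ℤ) < |n| → ∃ b t, G'.toFun n = R' (i, b) t) := by
    intro i
    refine glue N hpos hneg (g i) L (by omega) (fun b t => R' (i, b) t) ?_ ?_ ?_ ?_
    · intro b; rw [hR'0]
    · intro b t; exact hR'a _ _
    · intro b t b' t' h
      obtain ⟨h1, h2⟩ := hR'inj _ _ _ _ h
      exact ⟨(Prod.ext_iff.1 h1).2, h2⟩
    · intro b t n hn h
      exact hR'Fx _ _ (h ▸ hFx i i.2 n hn)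
  choose G' hG1 hG2 using hglue
  let g' : ℕ → DCopy (doubleRay o) D := fun i => if h : i < s then G' ⟨i, h⟩ else F k j.1
  have hg'1 : ∀ i (h : i < s), g' i = G' ⟨i, h⟩ := fun i h => by simp [g', h]
  have hg'2 : g' s = F k j.1 := by simp [g']
  have hnew : ∀ i (h : i < s) u v, (g' i).toFun u ≠ (F k j.1).toFun v := by
    intro i h u v he
    rw [hg'1 i h] at he
    by_cases hu : |u| ≤ (L : ℤ)
    · rw [hG1 _ _ hu] at he
      exact hJ' j v (he ▸ hFx i h u hu)
    · obtain ⟨b, t, hbt⟩ := hG2 ⟨i, h⟩ u (not_le.1 hu)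
      exact hR'j _ _ _ (hbt.symm.trans he)
  refine ⟨g', ?_, ?_, ?_⟩
  · intro i hi n hn
    rcases Nat.lt_succ_iff_lt_or_eq.1 hi with h | rfl
    · rw [hg'1 i h]
      by_cases hu : |n| ≤ (L : ℤ)
      · rw [hG1 _ _ hu]; exact hgZ i h n hn
      · obtain ⟨b, t, hbt⟩ := hG2 ⟨i, h⟩ n (not_le.1 hu)
        rw [hbt]; exact hR'Z _ _
    · rw [hg'2]; exact hZt _ _ _ hn
  · intro i hi i' hi' hne u v he
    rcases Nat.lt_succ_iff_lt_or_eq.1 hi with h | rfl <;>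
    rcases Nat.lt_succ_iff_lt_or_eq.1 hi' with h' | rfl
    · rw [hg'1 i h, hg'1 i' h'] at he
      by_cases hu : |u| ≤ (L : ℤ) <;> by_cases hv : |v| ≤ (L : ℤ)
      · rw [hG1 _ _ hu, hG1 _ _ hv] at he
        exact hgd i h i' h' hne _ _ he
      · obtain ⟨b, t, hbt⟩ := hG2 ⟨i', h'⟩ v (not_le.1 hv)
        rw [hG1 _ _ hu, hbt] at he
        exact hR'Fx _ _ (he ▸ hFx i h u hu)
      · obtain ⟨b, t, hbt⟩ := hG2 ⟨i, h⟩ u (not_le.1 hu)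
        rw [hG1 _ _ hv, hbt] at he
        exact hR'Fx _ _ (he ▸ hFx i' h' v hv)
      · obtain ⟨b, t, hbt⟩ := hG2 ⟨i, h⟩ u (not_le.1 hu)
        obtain ⟨b', t', hbt'⟩ := hG2 ⟨i', h'⟩ v (not_le.1 hv)
        rw [hbt, hbt'] at he
        have := (hR'inj _ _ _ _ he).1
        simp at this
        exact hne this.1
    · rw [hg'2] at he; exact hnew i h u v he
    · rw [hg'2] at he; exact hnew i' h' v u he.symm
    · exact hne rfl
  · intro i hi n hn
    rw [hg'1 i hi, hG1 _ _ hn]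

theorem odd_ubiquitous (N : ℕ) (hpos : ∀ n : ℤ, N ≤ n → o n = true)
    (hneg : ∀ n : ℤ, n < -N → o n = false) : Ubiquitous (doubleRay o) := by
  classical
  intro W D hmany
  let im : DCopy (doubleRay o) D → Set W := fun G => Set.range G.toFun
  let co : DCopy (doubleRay o) D → Finset W := fun G => (Finset.Icc (-(N : ℤ)) N).image G.toFun
  have hco : ∀ G n, |n| ≤ (N : ℤ) → G.toFun n ∈ co G := by
    intro G n hn
    exact Finset.mem_image.2 ⟨n, by rw [abs_le] at hn; simpa using hn, rfl⟩
  have hdisj : ∀ G G' : DCopy (doubleRay o) D, Disjoint (im G) (im G') ↔ G.VDisjoint G' := by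
    intro G G'
    rw [Set.disjoint_left]
    constructor
    · intro h u v huv
      exact h ⟨u, rfl⟩ ⟨v, huv.symm⟩
    · rintro h _ ⟨u, rfl⟩ ⟨v, hv⟩
      exact h u v hv.symm
  obtain ⟨F, hF1, hF2⟩ := FamAux.exists_families im co (2 * N + 1)
    (fun G => Finset.card_image_le.trans (by simp; omega)) (by
      intro k
      obtain ⟨f, hf⟩ := hmany k
      exact ⟨f, fun _ => Set.mem_univ _, fun i j hij => (hdisj _ _).2 (hf i j hij)⟩)
  let Z : Set W := {w | ∃ k i n, |n| ≤ (N : ℤ) ∧ w = (F k i).toFun n}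
  have hZc : ∀ k i n, |n| ≤ (N : ℤ) → (F k i).toFun n ∈ Z := fun k i n hn => ⟨k, i, n, hn, rfl⟩
  have hZt : ∀ k i n, (N : ℤ) < |n| → (F k i).toFun n ∉ Z := by
    rintro k i n hn ⟨k', i', n', hn', he⟩
    by_cases hk : k' = k
    · subst hk
      by_cases hi : i = i'
      · subst hi
        have := (F _ i).inj he
        subst this
        omega
      · exact (hdisj _ _).1 (hF1 _ i i' hi) _ _ he
    · exact Set.disjoint_left.1 (hF2 k' k i' i hk) (hco _ _ hn') ⟨n, he⟩
  have hFd : ∀ k i j, i ≠ j → (F k i).VDisjoint (F k j) := fun k i j h => (hdisj _ _).1 (hF1 k i j h)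
  let P : ℕ → (ℕ → DCopy (doubleRay o) D) → Prop := fun s g =>
    (∀ i < s, ∀ n, (N : ℤ) < |n| → (g i).toFun n ∉ Z) ∧
    (∀ i < s, ∀ j < s, i ≠ j → (g i).VDisjoint (g j))
  have hstep : ∀ s (g : {g // P s g}), ∃ g' : {g // P (s+1) g},
      ∀ i < s, ∀ n, |n| ≤ ((N + s : ℕ) : ℤ) → (g'.1 i).toFun n = (g.1 i).toFun n := by
    rintro s ⟨g, hg1, hg2⟩
    obtain ⟨g', h1, h2, h3⟩ := step N hpos hneg F hFd Z hZt hZc s g hg1 hg2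
    exact ⟨⟨g', h1, h2⟩, h3⟩
  choose nxt hnxt using hstep
  let G : (s : ℕ) → {g // P s g} := fun s =>
    Nat.rec ⟨fun _ => F 1 0, by simp [P]⟩ (fun s g => nxt s g) s
  have hGs : ∀ s, ∀ i < s, ∀ n, |n| ≤ ((N + s : ℕ) : ℤ) →
      ((G (s+1)).1 i).toFun n = ((G s).1 i).toFun n := fun s => hnxt s (G s)
  have hstab : ∀ (i : ℕ) (n : ℤ) (s : ℕ), i + 1 + n.natAbs ≤ s →
      ((G s).1 i).toFun n = ((G (i + 1 + n.natAbs)).1 i).toFun n := by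
    intro i n s hs
    induction s, hs using Nat.le_induction with
    | base => rfl
    | succ s hs ih =>
      rw [hGs s i (by omega) n (by rw [Int.abs_eq_natAbs]; omega), ih]
  let f : ℕ → ℤ → W := fun i n => ((G (i + 1 + n.natAbs)).1 i).toFun n
  have hf : ∀ i n s, i + 1 + n.natAbs ≤ s → f i n = ((G s).1 i).toFun n :=
    fun i n s hs => (hstab i n s hs).symm
  have hcopy : ∀ i, ∃ c : DCopy (doubleRay o) D, c.toFun = f i := by
    intro i
    refine mk_copy (f i) ?_ ?_
    · intro m n h
      rw [hf i m (i + 1 + m.natAbs + n.natAbs) (by omega),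
        hf i n (i + 1 + m.natAbs + n.natAbs) (by omega)] at h
      exact DCopy.inj _ h
    · intro n
      rw [hf i n (i + 1 + n.natAbs + (n+1).natAbs) (by omega),
        hf i (n+1) (i + 1 + n.natAbs + (n+1).natAbs) (by omega)]
      exact edge_of _ n
  choose c hc using hcopy
  refine ⟨c, ?_⟩
  intro i j hij u v he
  rw [hc, hc, hf i u (i + j + 1 + u.natAbs + v.natAbs) (by omega),
    hf j v (i + j + 1 + u.natAbs + v.natAbs) (by omega)] at he
  exact (G (i + j + 1 + u.natAbs + v.natAbs)).2.2 i (by omega) j (by omega) hij u v he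

end OddAux

namespace NonUb

/-- The union of a family of copies. -/
def unionD {W : Type} (o : ℤ → Bool) (h : ℕ → ℤ → W) : Digraph W where
  Adj u v := ∃ c n m, (doubleRay o).Adj n m ∧ h c n = u ∧ h c m = v

lemma not_ubiq {W : Type} (o : ℤ → Bool) (h : ℕ → ℤ → W)
    (hinj : ∀ c, Function.Injective (h c))
    (hdisj : ∀ c c', c ≠ c' → Nat.sqrt c = Nat.sqrt c' → ∀ n n', h c n ≠ h c' n')
    (P : DCopy (doubleRay o) (unionD o h) → ℕ → Prop)
    (hP : ∀ T, ∃ c, P T c)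
    (hPP : ∀ T T' c c', P T c → P T' c' → (c = c' ∨ Nat.sqrt c < Nat.sqrt c') →
      ∃ u v, T.toFun u = T'.toFun v) :
    ¬ Ubiquitous (doubleRay o) := by
  intro hU
  obtain ⟨f, hf⟩ := hU W (unionD o h) (by
    intro k
    refine ⟨fun i => ⟨h (k * k + i), hinj _, fun u v huv => ⟨_, u, v, huv, rfl, rfl⟩⟩, ?_⟩
    intro i j hij u v
    refine hdisj _ _ (fun h => hij (Fin.ext (by omega))) ?_ u v
    have hk : ∀ a : Fin k, Nat.sqrt (k * k + a) = k := by
      intro a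
      exact Nat.sqrt_add_eq k (by have := a.2; omega)
    rw [hk, hk])
  choose c hc using fun i => hP (f i)
  have key : ∀ i j, i ≠ j → c i ≠ c j ∧ ¬ Nat.sqrt (c i) < Nat.sqrt (c j) := by
    intro i j hij
    constructor
    · intro he
      obtain ⟨u, v, huv⟩ := hPP _ _ _ _ (hc i) (hc j) (Or.inl he)
      exact hf i j hij u v huv
    · intro he
      obtain ⟨u, v, huv⟩ := hPP _ _ _ _ (hc i) (hc j) (Or.inr he)
      exact hf i j hij u v huv
  have hcinj : Function.Injective c := by
    intro i j hij
    by_contra hne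
    exact (key i j hne).1 hij
  have hbd : ∀ i, c i < (Nat.sqrt (c 0) + 1) * (Nat.sqrt (c 0) + 1) := by
    intro i
    rw [← Nat.sqrt_lt]
    by_cases h0 : i = 0
    · subst h0; omega
    · have := (key 0 i (Ne.symm h0)).2
      omega
  exact Set.infinite_of_injective_forall_mem hcinj (s := Set.Iio _) hbd (Set.finite_Iio _)

lemma rev_ubiq {o : ℤ → Bool} (h : Ubiquitous (doubleRay o)) :
    Ubiquitous (doubleRay (fun n => !o n)) := by
  intro W D hM
  have hadj : ∀ u v, (doubleRay (fun n => !o n)).Adj u v ↔ (doubleRay o).Adj v u := by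
    intro u v
    simp only [doubleRay, Bool.not_eq_true', Bool.not_eq_false']
    tauto
  let D' : Digraph W := ⟨fun u v => D.Adj v u⟩
  obtain ⟨f, hf⟩ := h W D' (by
    intro k
    obtain ⟨f, hf⟩ := hM k
    refine ⟨fun i => ⟨(f i).toFun, (f i).inj, fun u v huv => ?_⟩, hf⟩
    exact (f i).adj _ _ ((hadj _ _).2 huv))
  exact ⟨fun i => ⟨(f i).toFun, (f i).inj, fun u v huv => (f i).adj _ _ ((hadj _ _).1 huv)⟩, hf⟩

lemma refl_ubiq {o : ℤ → Bool} (h : Ubiquitous (doubleRay o)) :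
    Ubiquitous (doubleRay (fun n => !o (-1 - n))) := by
  intro W D hM
  have hadj : ∀ u v, (doubleRay (fun n => !o (-1 - n))).Adj u v ↔ (doubleRay o).Adj (-u) (-v) := by
    intro u v
    simp only [doubleRay, Bool.not_eq_true', Bool.not_eq_false']
    constructor
    · rintro (⟨rfl, h⟩ | ⟨rfl, h⟩)
      · exact Or.inr ⟨by ring, by rw [← h]; congr 1; ring⟩
      · exact Or.inl ⟨by ring, by rw [← h]; congr 1; ring⟩
    · rintro (⟨h1, h⟩ | ⟨h1, h⟩)
      · exact Or.inr ⟨by omega, by rw [← h]; congr 1; omega⟩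
      · exact Or.inl ⟨by omega, by rw [← h]; congr 1; omega⟩
  obtain ⟨f, hf⟩ := h W D (by
    intro k
    obtain ⟨f, hf⟩ := hM k
    refine ⟨fun i => ⟨fun n => (f i).toFun (-n), (f i).inj.comp neg_injective,
      fun u v huv => ?_⟩, fun i j hij u v => hf i j hij _ _⟩
    exact (f i).adj _ _ ((hadj _ _).2 (by simpa using huv)))
  refine ⟨fun i => ⟨fun n => (f i).toFun (-n), (f i).inj.comp neg_injective,
      fun u v huv => ?_⟩, fun i j hij u v => hf i j hij _ _⟩
  exact (f i).adj _ _ ((hadj _ _).1 huv)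

lemma parity (o : ℤ → Bool) (a : ℤ) (n : ℕ) [DecidablePred (IsTurn o)] :
    o a = o (a + n) ↔ Even ((Finset.Ioc a (a + n)).filter (IsTurn o)).card := by
  induction n with
  | zero => simp
  | succ n ih =>
    have : Finset.Ioc a (a + (n + 1 : ℕ)) = insert (a + n + 1) (Finset.Ioc a (a + n)) := by
      ext x; simp only [Finset.mem_Ioc, Finset.mem_insert]; push_cast; omega
    rw [this, Finset.filter_insert]
    have e : a + ((n + 1 : ℕ) : ℤ) = a + n + 1 := by push_cast; ring
    rw [e]
    split_ifs with ht
    · rw [Finset.card_insert_of_notMem (by simp), Nat.even_add_one, ← ih]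
      unfold IsTurn at ht
      rw [show a + n + 1 - 1 = a + (n : ℤ) by ring] at ht
      revert ht
      cases o a <;> cases o (a + n) <;> cases o (a + n + 1) <;> simp
    · rw [← ih]
      unfold IsTurn at ht
      rw [show a + n + 1 - 1 = a + (n : ℤ) by ring] at ht
      rw [not_not.1 ht]

lemma const_above (o : ℤ → Bool) (a : ℤ) (h : ∀ n, a < n → ¬ IsTurn o n) :
    ∀ n, a ≤ n → o n = o a := by
  intro n hn
  induction n, hn using Int.leInduction with
  | base => rfl
  | succ n hn ih =>
    have := h (n + 1) (by omega)
    unfold IsTurn at this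
    rw [not_not, add_sub_cancel_right] at this
    rw [← this, ih]

lemma const_below (o : ℤ → Bool) (a : ℤ) (h : ∀ n, n ≤ a → ¬ IsTurn o n) :
    ∀ n, n ≤ a → o n = o a := by
  intro n hn
  induction n, hn using Int.leInductionDown with
  | base => rfl
  | pred n hn ih =>
    have := h n hn
    unfold IsTurn at this
    rw [not_not] at this
    rw [this, ih]

lemma ends (o : ℤ → Bool) (hfin : {n : ℤ | IsTurn o n}.Finite) :
    ∃ N : ℕ, (∀ n : ℤ, N ≤ n → o n = o N) ∧ (∀ n : ℤ, n ≤ -N → o n = o (-N)) ∧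
      (o (-N) = o N ↔ Even {n : ℤ | IsTurn o n}.ncard) := by
  classical
  obtain ⟨a, ha⟩ := hfin.bddAbove
  obtain ⟨b, hb⟩ := hfin.bddBelow
  refine ⟨a.natAbs + b.natAbs + 1, ?_, ?_, ?_⟩
  · exact const_above o _ (fun n hn ht => by have := ha ht; omega)
  · exact const_below o _ (fun n hn ht => by have := hb ht; omega)
  · set N := a.natAbs + b.natAbs + 1 with hN
    have := parity o (-N) (2 * N)
    rw [show -(N : ℤ) + ((2 * N : ℕ) : ℤ) = N by push_cast; ring] at this
    rw [this, ← Set.ncard_coe_finset]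
    suffices h : ((Finset.filter (IsTurn o) (Finset.Ioc (-(N : ℤ)) N) : Finset ℤ) : Set ℤ) =
        {n | IsTurn o n} by rw [h]
    ext x
    simp only [Finset.coe_filter, Finset.mem_Ioc, Set.mem_ofPred_eq, and_iff_right_iff_imp]
    intro hx
    have := ha hx; have := hb hx
    omega

end NonUb

namespace EvenAux

lemma le_of_mul {M a b : ℤ} (hM : 0 < M) (h : M * a < M * b + M) : a ≤ b := by
  by_contra hc
  have : M * (b + 1) ≤ M * a := mul_le_mul_of_nonneg_left (by omega) hM.le
  rw [mul_add, mul_one] at this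
  omega

lemma mul_mono' {M a b : ℤ} (hM : 0 < M) (h : a ≤ b) : M * a ≤ M * b :=
  mul_le_mul_of_nonneg_left h hM.le

lemma eq_of_mul {M a b : ℤ} (hM : 0 < M) (h : M * a = M * b) : a = b :=
  mul_left_cancel₀ hM.ne' h

def sF (c : ℕ) : ℤ := ((Nat.sqrt c * Nat.sqrt c : ℕ) : ℤ)
def eF (c : ℕ) : ℤ := (((Nat.sqrt c + 1) * (Nat.sqrt c + 1) : ℕ) : ℤ)

lemma sF_le (c : ℕ) : sF c ≤ c := by
  unfold sF; exact_mod_cast Nat.sqrt_le c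

lemma lt_eF (c : ℕ) : (c : ℤ) < eF c := by
  unfold eF; exact_mod_cast Nat.lt_succ_sqrt c

lemma eF_le_sF {r c : ℕ} (h : Nat.sqrt r < Nat.sqrt c) : eF r ≤ sF c := by
  unfold eF sF; exact_mod_cast Nat.mul_self_le_mul_self (by omega)

lemma sqrt_lt_of {r c : ℕ} (h : (r : ℤ) < sF c) : Nat.sqrt r < Nat.sqrt c := by
  unfold sF at h; exact Nat.sqrt_lt.2 (by exact_mod_cast h)

lemma eF_mono {r c : ℕ} (h : sF c ≤ r) : eF c ≤ eF r := by
  have : Nat.sqrt c ≤ Nat.sqrt r := Nat.le_sqrt.2 (by unfold sF at h; exact_mod_cast h)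
  unfold eF; exact_mod_cast Nat.mul_self_le_mul_self (by omega)

/-- Grid points. -/
def Gr (h : ℤ) (x y : ℤ) : Prop :=
  (∃ c : ℕ, x = 2 * h * c ∧ y ≤ 2 * h * sF c - h) ∨ (∃ r : ℕ, y = 2 * h * r ∧ 2 * h * eF r - h ≤ x)

lemma gr_basic {h x y : ℤ} (hh : 0 < h) (hg : Gr h x y) : 0 ≤ x ∧ y < x := by
  have hM : 0 < 2 * h := by omega
  rcases hg with ⟨c, rfl, hy⟩ | ⟨r, rfl, hx⟩
  · have h1 := mul_mono' hM (sF_le c)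
    exact ⟨by positivity, by omega⟩
  · have h1 := mul_mono' hM (show (r : ℤ) + 1 ≤ eF r from lt_eF r)
    have h2 : 0 ≤ 2 * h * (r : ℤ) := by positivity
    rw [mul_add, mul_one] at h1
    exact ⟨by omega, by omega⟩

lemma gr_left {h x y : ℤ} (hh : 0 < h) (hg : Gr h x y) (r : ℕ) (hy : y = 2 * h * r) :
    2 * h * eF r - h ≤ x := by
  have hM : 0 < 2 * h := by omega
  rcases hg with ⟨c, rfl, hy'⟩ | ⟨r', hy', hx⟩
  · have h0 : (r : ℤ) ≤ sF c - 1 := le_of_mul hM (by rw [mul_sub, mul_one]; omega)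
    have h1 := eF_le_sF (sqrt_lt_of (r := r) (c := c) (by omega))
    have h2 := mul_mono' hM (h1.trans (sF_le c))
    omega
  · have : (r : ℤ) = r' := eq_of_mul hM (by omega)
    obtain rfl : r = r' := by exact_mod_cast this
    exact hx

lemma gr_right {h x y : ℤ} (hh : 0 < h) (hg : Gr h x y) (c : ℕ) (hx : x = 2 * h * c) :
    y ≤ 2 * h * sF c - h := by
  have hM : 0 < 2 * h := by omega
  rcases hg with ⟨c', hx', hy'⟩ | ⟨r', rfl, hx'⟩
  · have : (c : ℤ) = c' := eq_of_mul hM (by omega)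
    obtain rfl : c = c' := by exact_mod_cast this
    exact hy'
  · by_contra hcon
    have h0 : sF c ≤ r' := le_of_mul hM (by omega)
    have h1 := mul_mono' hM ((show (c : ℤ) + 1 ≤ eF c from lt_eF c).trans (eF_mono h0))
    rw [mul_add, mul_one] at h1
    omega

lemma grid_cross {h : ℤ} (hh : 0 < h) (r c : ℕ) (hrc : Nat.sqrt r < Nat.sqrt c)
    (bx yb qx qy : ℕ → ℤ)
    (hb0 : bx 0 = 2 * h * eF r - h) (hb0' : yb 0 = 2 * h * r)
    (hq0 : qx 0 = 2 * h * c) (hq0' : qy 0 = 2 * h * sF c - h)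
    (hb : ∀ i, (bx (i+1) = bx i + 1 ∧ yb (i+1) = yb i) ∨ (bx (i+1) = bx i ∧ yb (i+1) = yb i + 1))
    (hq : ∀ i, (qx (i+1) = qx i - 1 ∧ qy (i+1) = qy i) ∨ (qx (i+1) = qx i ∧ qy (i+1) = qy i - 1))
    (hbg : ∀ i, Gr h (bx i) (yb i)) (hqg : ∀ i, Gr h (qx i) (qy i)) :
    ∃ i j, bx i = qx j ∧ yb i = qy j := by
  have hM : 0 < 2 * h := by omega
  have hbs : ∀ i : ℕ, bx i + yb i = bx 0 + yb 0 + i := by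
    intro i
    induction i with
    | zero => simp
    | succ i ih => push_cast; rcases hb i with h | h <;> omega
  have hqs : ∀ i : ℕ, qx i + qy i = qx 0 + qy 0 - i := by
    intro i
    induction i with
    | zero => simp
    | succ i ih => push_cast; rcases hq i with h | h <;> omega
  have hS : bx 0 + yb 0 ≤ qx 0 + qy 0 := by
    rw [hb0, hb0', hq0, hq0']
    have h1 := eF_le_sF hrc
    have h2 := mul_mono' hM h1
    have h3 := mul_mono' hM (show (r : ℤ) ≤ c by have := lt_eF r; have := sF_le c; omega)
    omega
  obtain ⟨K, hK⟩ : ∃ K : ℕ, qx 0 + qy 0 - (bx 0 + yb 0) = K :=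
    ⟨(qx 0 + qy 0 - (bx 0 + yb 0)).toNat, by omega⟩
  have f0 : bx 0 ≤ qx K := by
    by_contra hc
    have inv : ∀ j, qx (K + j) < 2 * h * eF r - h ∧ 2 * h * r < qy (K + j) := by
      intro j
      induction j with
      | zero => have := hqs K; simp only [add_zero]; omega
      | succ j ih =>
        have hg := hqg (K + (j + 1))
        have hg' := gr_left hh hg r
        rcases hq (K + j) with h | h <;> rw [add_assoc] at h <;> omega
    have h1 := inv ((qx 0 + qy 0).natAbs + (2 * h * r).natAbs)
    have h2 := (gr_basic hh (hqg (K + ((qx 0 + qy 0).natAbs + (2 * h * r).natAbs)))).1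
    have h3 := hqs (K + ((qx 0 + qy 0).natAbs + (2 * h * r).natAbs))
    rw [Nat.cast_add, Nat.cast_add] at h3
    omega
  have fK : qx 0 ≤ bx K := by
    by_contra hc
    have inv : ∀ j, bx (K + j) < 2 * h * c ∧ 2 * h * sF c - h < yb (K + j) := by
      intro j
      induction j with
      | zero => have := hbs K; simp only [add_zero]; omega
      | succ j ih =>
        have hg := hbg (K + (j + 1))
        have hg' := gr_right hh hg c
        rcases hb (K + j) with h | h <;> rw [add_assoc] at h <;> omega
    have h1 := inv ((bx 0 + yb 0).natAbs + 2 * (2 * h * c).natAbs)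
    have h2 := (gr_basic hh (hbg (K + ((bx 0 + yb 0).natAbs + 2 * (2 * h * c).natAbs)))).2
    have h3 := hbs (K + ((bx 0 + yb 0).natAbs + 2 * (2 * h * c).natAbs))
    rw [Nat.cast_add, Nat.cast_add, Nat.cast_mul] at h3
    omega
  have main : ∀ i : ℕ, i ≤ K → (bx i ≤ qx (K - i) ∨ ∃ i j, bx i = qx j ∧ yb i = qy j) := by
    intro i
    induction i with
    | zero => intro _; exact Or.inl f0
    | succ i ih =>
      intro hi
      rcases ih (by omega) with h1 | h1
      · have e : K - i = K - (i + 1) + 1 := by omega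
        by_cases heq : bx i = qx (K - i)
        · right
          refine ⟨i, K - i, heq, ?_⟩
          have := hbs i
          have := hqs (K - i)
          omega
        · left
          have h2 := hb i
          have h3 := hq (K - (i + 1))
          rw [← e] at h3
          omega
      · exact Or.inr h1
  rcases main K le_rfl with h1 | h1
  · rw [Nat.sub_self] at h1
    refine ⟨K, 0, by omega, ?_⟩
    have := hbs K
    omega
  · exact h1

end EvenAux

namespace EvenAux
open NonUb

/-- The copies in the even construction. -/
def vtx (t0 t1 : ℤ) (c : ℕ) (m : ℤ) : ℤ × ℤ × ℤ :=
  if m ≤ t0 then (2 * (t1 - t0 + 1) * c, 2 * (t1 - t0 + 1) * sF c - (t1 - t0 + 1) + (m - t0), 0)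
  else if t1 ≤ m then
    (2 * (t1 - t0 + 1) * eF c - (t1 - t0 + 1) + (m - t1), 2 * (t1 - t0 + 1) * c, 0)
  else (c, m, 1)

def Xp (t0 t1 m : ℤ) : Prop :=
  (∃ k : ℤ, 1 ≤ k ∧ m = t0 + (t1 - t0 + 1) - 2 * (t1 - t0 + 1) * k) ∨
  (∃ k : ℤ, 0 ≤ k ∧ m = t1 + (t1 - t0 + 1) + 2 * (t1 - t0 + 1) * k)

variable {t0 t1 : ℤ} {o : ℤ → Bool}

lemma Xp_far (ht : t0 < t1) {m : ℤ} (h : Xp t0 t1 m) :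
    m ≤ t0 - (t1 - t0 + 1) ∨ t1 + (t1 - t0 + 1) ≤ m := by
  have hM : 0 < 2 * (t1 - t0 + 1) := by omega
  rcases h with ⟨k, hk, h⟩ | ⟨k, hk, h⟩
  · have := mul_mono' hM hk
    rw [mul_one] at this
    left; omega
  · have := mul_mono' hM hk
    rw [mul_zero] at this
    right; omega

lemma Xp_sep (ht : t0 < t1) {m m' : ℤ} (h : Xp t0 t1 m) (h' : Xp t0 t1 m')
    (h1 : m - m' ≤ t1 - t0) (h2 : m' - m ≤ t1 - t0) : m = m' := by
  have hM : 0 < 2 * (t1 - t0 + 1) := by omega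
  have f := Xp_far ht h
  have f' := Xp_far ht h'
  rcases h with ⟨k, hk, h⟩ | ⟨k, hk, h⟩ <;> rcases h' with ⟨k', hk', h'⟩ | ⟨k', hk', h'⟩
  · have a1 : k ≤ k' := le_of_mul hM (by omega)
    have a2 : k' ≤ k := le_of_mul hM (by omega)
    obtain rfl : k = k' := by omega
    omega
  · have := mul_mono' hM hk
    have := mul_mono' hM hk'
    rw [mul_one] at *
    rw [mul_zero] at *
    omega
  · have := mul_mono' hM hk
    have := mul_mono' hM hk'
    rw [mul_one] at *
    rw [mul_zero] at *
    omega
  · have a1 : k ≤ k' := le_of_mul hM (by omega)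
    have a2 : k' ≤ k := le_of_mul hM (by omega)
    obtain rfl : k = k' := by omega
    omega

lemma vtx_cross (ht : t0 < t1) {c c' : ℕ} {m m' : ℤ} (hm : m ≤ t0) (hm' : t1 ≤ m')
    (h : vtx t0 t1 c m = vtx t0 t1 c' m') :
    Xp t0 t1 m ∧ Xp t0 t1 m' ∧ (c' : ℤ) < sF c := by
  have hM : 0 < 2 * (t1 - t0 + 1) := by omega
  rw [vtx, vtx, if_pos hm, if_neg (by omega), if_pos hm'] at h
  simp only [Prod.mk.injEq, and_true] at h
  obtain ⟨h1, h2⟩ := h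
  have a1 : (c' : ℤ) ≤ sF c - 1 := le_of_mul hM (by rw [mul_sub, mul_one]; omega)
  have a2 : eF c' ≤ c := le_of_mul hM (by omega)
  refine ⟨Or.inl ⟨sF c - c', by omega, ?_⟩, Or.inr ⟨c - eF c', by omega, ?_⟩, by omega⟩
  · rw [mul_sub]; omega
  · rw [mul_sub]; omega

lemma vtx_eq (ht : t0 < t1) {c c' : ℕ} {m m' : ℤ} (h : vtx t0 t1 c m = vtx t0 t1 c' m') :
    (c = c' ∧ m = m') ∨ (Xp t0 t1 m ∧ Xp t0 t1 m' ∧ ((c' : ℤ) < sF c ∨ (c : ℤ) < sF c')) := by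
  have hM : 0 < 2 * (t1 - t0 + 1) := by omega
  by_cases a : m ≤ t0 <;> by_cases a' : m' ≤ t0
  · left
    rw [vtx, vtx, if_pos a, if_pos a'] at h
    simp only [Prod.mk.injEq, and_true] at h
    obtain ⟨h1, h2⟩ := h
    have : (c : ℤ) = c' := eq_of_mul hM h1
    obtain rfl : c = c' := by exact_mod_cast this
    exact ⟨rfl, by omega⟩
  · by_cases b' : t1 ≤ m'
    · obtain ⟨h1, h2, h3⟩ := vtx_cross ht a b' h
      exact Or.inr ⟨h1, h2, Or.inl h3⟩
    · rw [vtx, vtx, if_pos a, if_neg a', if_neg b'] at h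
      simp at h
  · by_cases b : t1 ≤ m
    · obtain ⟨h1, h2, h3⟩ := vtx_cross ht a' b h.symm
      exact Or.inr ⟨h2, h1, Or.inr h3⟩
    · rw [vtx, vtx, if_neg a, if_neg b, if_pos a'] at h
      simp at h
  · by_cases b : t1 ≤ m <;> by_cases b' : t1 ≤ m'
    · left
      rw [vtx, vtx, if_neg a, if_neg a', if_pos b, if_pos b'] at h
      simp only [Prod.mk.injEq, and_true] at h
      obtain ⟨h1, h2⟩ := h
      have : (c : ℤ) = c' := eq_of_mul hM h2
      obtain rfl : c = c' := by exact_mod_cast this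
      exact ⟨rfl, by omega⟩
    · rw [vtx, vtx, if_neg a, if_neg a', if_pos b, if_neg b'] at h
      simp at h
    · rw [vtx, vtx, if_neg a, if_neg a', if_neg b, if_pos b'] at h
      simp at h
    · left
      rw [vtx, vtx, if_neg a, if_neg a', if_neg b, if_neg b'] at h
      simpa using h

/-- Each edge of a copy comes from some edge in one of the defining double rays. -/
lemma step_edge {W : Type} {h : ℕ → ℤ → W} (T : DCopy (doubleRay o) (unionD o h)) (n : ℤ) :
    ∃ c p, T.toFun n = h c p ∧
      ((T.toFun (n+1) = h c (p+1) ∧ o p = o n) ∨ (T.toFun (n+1) = h c (p-1) ∧ o (p-1) = !o n)) := by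
  have := OddAux.edge_of T n
  cases hn : o n
  · obtain ⟨c, a, b, hab, h1, h2⟩ := this.2 hn
    refine ⟨c, b, h2.symm, ?_⟩
    rcases hab with ⟨rfl, hab⟩ | ⟨rfl, hab⟩
    · right; rw [add_sub_cancel_right]; exact ⟨h1.symm, by simpa using hab⟩
    · left; exact ⟨h1.symm, hab⟩
  · obtain ⟨c, a, b, hab, h1, h2⟩ := this.1 hn
    refine ⟨c, a, h1.symm, ?_⟩
    rcases hab with ⟨rfl, hab⟩ | ⟨rfl, hab⟩
    · left; exact ⟨h2.symm, hab⟩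
    · right; rw [add_sub_cancel_right]; exact ⟨h2.symm, by simpa using hab⟩

lemma step_edge_back {W : Type} {h : ℕ → ℤ → W} (T : DCopy (doubleRay o) (unionD o h)) (n : ℤ) :
    ∃ c p, T.toFun n = h c p ∧
      ((T.toFun (n-1) = h c (p-1) ∧ o (p-1) = o (n-1)) ∨
        (T.toFun (n-1) = h c (p+1) ∧ o p = !o (n-1))) := by
  obtain ⟨c, p, h1, h2⟩ := step_edge T (n - 1)
  rw [sub_add_cancel] at h2
  rcases h2 with ⟨h2, h3⟩ | ⟨h2, h3⟩
  · exact ⟨c, p + 1, h2, Or.inl ⟨by rw [add_sub_cancel_right, h1],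
      by rw [add_sub_cancel_right, h3]⟩⟩
  · exact ⟨c, p - 1, h2, Or.inr ⟨by rw [sub_add_cancel, h1], h3⟩⟩

lemma step_fwd (ht : t0 < t1) (T : DCopy (doubleRay o) (unionD o (vtx t0 t1))) (n : ℤ) {c : ℕ}
    {m : ℤ} (hX : ¬ Xp t0 t1 m) (h : T.toFun n = vtx t0 t1 c m) :
    (T.toFun (n+1) = vtx t0 t1 c (m+1) ∧ o m = o n) ∨
      (T.toFun (n+1) = vtx t0 t1 c (m-1) ∧ o (m-1) = !o n) := by
  obtain ⟨c', p, h1, h2⟩ := step_edge T n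
  rcases vtx_eq ht (h.symm.trans h1) with ⟨rfl, rfl⟩ | h3
  · exact h2
  · exact absurd h3.1 hX

lemma step_back (ht : t0 < t1) (T : DCopy (doubleRay o) (unionD o (vtx t0 t1))) (n : ℤ) {c : ℕ}
    {m : ℤ} (hX : ¬ Xp t0 t1 m) (h : T.toFun n = vtx t0 t1 c m) :
    (T.toFun (n-1) = vtx t0 t1 c (m-1) ∧ o (m-1) = o (n-1)) ∨
      (T.toFun (n-1) = vtx t0 t1 c (m+1) ∧ o m = !o (n-1)) := by
  obtain ⟨c', p, h1, h2⟩ := step_edge_back T n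
  rcases vtx_eq ht (h.symm.trans h1) with ⟨rfl, rfl⟩ | h3
  · exact h2
  · exact absurd h3.1 hX

lemma dead_a (ht : t0 < t1) (h1 : ∀ n < t0, o n = true) (h2 : ∀ n, t1 ≤ n → o n = true)
    (h3 : o t0 = false) 
    (T : DCopy (doubleRay o) (unionD o (vtx t0 t1))) {n : ℤ} (hn : n ≤ t0) {c : ℕ} {m : ℤ}
    (hm : t0 < m) (hm' : m ≤ t1) : T.toFun n ≠ vtx t0 t1 c m := by
  intro h
  have key : ∀ i : ℕ, ∃ p, (t0 < p ∧ p ≤ t1) ∧ T.toFun (n - i) = vtx t0 t1 c p := by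
    intro i
    induction i with
    | zero => exact ⟨m, ⟨hm, hm'⟩, by simpa using h⟩
    | succ i ih =>
      obtain ⟨p, hp, h4⟩ := ih
      have hX : ¬ Xp t0 t1 p := fun hX => by have := Xp_far ht hX; omega
      have e : n - ((i + 1 : ℕ) : ℤ) = n - i - 1 := by push_cast; ring
      rw [e]
      have ho : o (n - i - 1) = true := h1 _ (by omega)
      rcases step_back ht T _ hX h4 with ⟨h5, h6⟩ | ⟨h5, h6⟩
      · refine ⟨p - 1, ⟨?_, by omega⟩, h5⟩
        by_contra hc
        obtain hc : p - 1 = t0 := by omega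
        rw [hc, h3, ho] at h6
        simp at h6
      · refine ⟨p + 1, ⟨by omega, ?_⟩, h5⟩
        by_contra hc
        rw [h2 p (by omega), ho] at h6
        simp at h6
  have hfin : ((vtx t0 t1 c) '' Set.Ioc t0 t1).Finite := (Set.finite_Ioc _ _).image _
  refine Set.infinite_of_injective_forall_mem (f := fun i : ℕ => T.toFun (n - i)) ?_ ?_ hfin
  · intro i j hij
    have := T.inj hij
    omega
  · intro i
    obtain ⟨p, hp, h4⟩ := key i
    exact ⟨p, ⟨hp.1, hp.2⟩, h4.symm⟩

lemma dead_b (ht : t0 < t1) (h1 : ∀ n < t0, o n = true) (h2 : ∀ n, t1 ≤ n → o n = true)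
    (h3 : o (t1 - 1) = false)
    (T : DCopy (doubleRay o) (unionD o (vtx t0 t1))) {n : ℤ} (hn : t1 ≤ n) {c : ℕ} {m : ℤ}
    (hm : t0 ≤ m) (hm' : m < t1) : T.toFun n ≠ vtx t0 t1 c m := by
  intro h
  have key : ∀ i : ℕ, ∃ p, (t0 ≤ p ∧ p < t1) ∧ T.toFun (n + i) = vtx t0 t1 c p := by
    intro i
    induction i with
    | zero => exact ⟨m, ⟨hm, hm'⟩, by simpa using h⟩
    | succ i ih =>
      obtain ⟨p, hp, h4⟩ := ih
      have hX : ¬ Xp t0 t1 p := fun hX => by have := Xp_far ht hX; omega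
      have e : n + ((i + 1 : ℕ) : ℤ) = n + i + 1 := by push_cast; ring
      rw [e]
      have ho : o (n + i) = true := h2 _ (by omega)
      rcases step_fwd ht T _ hX h4 with ⟨h5, h6⟩ | ⟨h5, h6⟩
      · refine ⟨p + 1, ⟨by omega, ?_⟩, h5⟩
        by_contra hc
        obtain hc : p = t1 - 1 := by omega
        rw [hc, h3, ho] at h6
        simp at h6
      · refine ⟨p - 1, ⟨?_, by omega⟩, h5⟩
        by_contra hc
        rw [h1 (p - 1) (by omega), ho] at h6
        simp at h6
  have hfin : ((vtx t0 t1 c) '' Set.Ico t0 t1).Finite := (Set.finite_Ico _ _).image _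
  refine Set.infinite_of_injective_forall_mem (f := fun i : ℕ => T.toFun (n + i)) ?_ ?_ hfin
  · intro i j hij
    have := T.inj hij
    omega
  · intro i
    obtain ⟨p, hp, h4⟩ := key i
    exact ⟨p, ⟨hp.1, hp.2⟩, h4.symm⟩

/-- At a turn of the copy mapped to a non-crossing vertex, the ray turns in the same way. -/
lemma turn_pos (ht : t0 < t1) (T : DCopy (doubleRay o) (unionD o (vtx t0 t1))) (n : ℤ) {c : ℕ}
    {m : ℤ} (hX : ¬ Xp t0 t1 m) (h : T.toFun n = vtx t0 t1 c m) (hn : o (n-1) = !o n) :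
    o m = o n ∧ o (m-1) = o (n-1) := by
  have hne : T.toFun (n+1) ≠ T.toFun (n-1) := fun h => by have := T.inj h; omega
  rcases step_fwd ht T _ hX h with ⟨h1, h2⟩ | ⟨h1, h2⟩ <;>
    rcases step_back ht T _ hX h with ⟨h3, h4⟩ | ⟨h3, h4⟩
  · exact ⟨h2, h4⟩
  · exact absurd (h1.trans h3.symm) hne
  · exact absurd (h1.trans h3.symm) hne
  · exact ⟨by rw [h4, hn]; simp, by rw [h2, hn]⟩

lemma core (ht : t0 < t1) (h1 : ∀ n < t0, o n = true) (h2 : ∀ n, t1 ≤ n → o n = true)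
    (h3 : o t0 = false) (h4 : o (t1 - 1) = false)
    (T : DCopy (doubleRay o) (unionD o (vtx t0 t1))) :
    ∃ c, T.toFun t0 = vtx t0 t1 c t0 ∧ T.toFun t1 = vtx t0 t1 c t1 := by
  obtain ⟨c, p, hp, hp'⟩ := step_edge T t0
  have hturn1 : ∀ {c' m'}, ¬ Xp t0 t1 m' → T.toFun t1 = vtx t0 t1 c' m' → m' = t1 := by
    intro c' m' hX he
    have := turn_pos ht T t1 hX he (by rw [h4, h2 t1 le_rfl]; rfl)
    rw [h4, h2 t1 le_rfl] at this
    have hlo : t0 ≤ m' - 1 := by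
      by_contra hc
      rw [h1 (m' - 1) (by omega)] at this
      simp at this
    have hhi : m' - 1 < t1 := by
      by_contra hc
      rw [h2 (m' - 1) (by omega)] at this
      simp at this
    by_contra hc
    exact dead_b ht h1 h2 h4 T le_rfl (by omega) (by omega) he
  -- the walk stays close
  have walk : (∀ m, m ≠ p → m - p ≤ t1 - t0 → p - m ≤ t1 - t0 → ¬ Xp t0 t1 m) →
      ∀ i : ℕ, (i : ℤ) + 1 ≤ t1 - t0 → ∃ m, T.toFun (t0 + (i + 1 : ℕ)) = vtx t0 t1 c m ∧
        m - p ≤ i + 1 ∧ p - m ≤ i + 1 := by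
    intro hX i
    induction i with
    | zero =>
      intro _
      rcases hp' with ⟨h5, _⟩ | ⟨h5, _⟩
      · exact ⟨p + 1, by simpa using h5, by simp, by omega⟩
      · exact ⟨p - 1, by simpa using h5, by omega, by simp⟩
    | succ i ih =>
      intro hi
      push_cast at hi
      obtain ⟨m, h5, h6, h7⟩ := ih (by omega)
      have hne : m ≠ p := by
        rintro rfl
        have := T.inj (h5.trans hp.symm)
        omega
      have e : t0 + ((i + 1 + 1 : ℕ) : ℤ) = t0 + ((i + 1 : ℕ) : ℤ) + 1 := by push_cast; ring
      rw [e]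
      rcases step_fwd ht T _ (hX m hne (by omega) (by omega)) h5 with ⟨h8, _⟩ | ⟨h8, _⟩
      · exact ⟨_, h8, by push_cast; omega, by push_cast; omega⟩
      · exact ⟨_, h8, by push_cast; omega, by push_cast; omega⟩
  obtain ⟨j, hj⟩ : ∃ j : ℕ, t1 - t0 = j + 1 := ⟨(t1 - t0 - 1).toNat, by omega⟩
  have ej : t0 + ((j + 1 : ℕ) : ℤ) = t1 := by push_cast; omega
  by_cases hX : Xp t0 t1 p
  · exfalso
    have hXn : ∀ m, m ≠ p → m - p ≤ t1 - t0 → p - m ≤ t1 - t0 → ¬ Xp t0 t1 m := by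
      intro m hm h5 h6 h7
      exact hm (Xp_sep ht h7 hX h5 h6)
    obtain ⟨m, h5, h6, h7⟩ := walk hXn j (by omega)
    rw [ej] at h5
    have hne : m ≠ p := by
      rintro rfl
      have := T.inj (h5.trans hp.symm)
      omega
    have := hturn1 (hXn m hne (by omega) (by omega)) h5
    have := Xp_far ht hX
    omega
  · have h5 := turn_pos ht T t0 hX hp (by rw [h3, h1 (t0 - 1) (by omega)]; rfl)
    rw [h3, h1 (t0 - 1) (by omega)] at h5
    have hlo : t0 ≤ p := by
      by_contra hc
      rw [h1 p (by omega)] at h5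
      simp at h5
    have hhi : p < t1 := by
      by_contra hc
      rw [h2 p (by omega)] at h5
      simp at h5
    obtain rfl : p = t0 := by
      by_contra hc
      exact dead_a ht h1 h2 h3 T le_rfl (by omega) (by omega) hp
    have hXn : ∀ m, m - p ≤ t1 - p → p - m ≤ t1 - p → ¬ Xp p t1 m := by
      intro m h5 h6 h7
      have := Xp_far ht h7
      omega
    obtain ⟨m, h6, h7, h8⟩ := walk (fun m _ => hXn m) j (by omega)
    rw [ej] at h6
    have := hturn1 (hXn m (by omega) (by omega)) h6
    exact ⟨c, hp, this ▸ h6⟩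

lemma vtx_row (ht : t0 < t1) (c : ℕ) {m : ℤ} (hm : t1 ≤ m) : vtx t0 t1 c m =
    (2 * (t1 - t0 + 1) * eF c - (t1 - t0 + 1) + (m - t1), 2 * (t1 - t0 + 1) * c, 0) := by
  rw [vtx, if_neg (by omega), if_pos hm]

lemma vtx_col (c : ℕ) {m : ℤ} (hm : m ≤ t0) : vtx t0 t1 c m =
    (2 * (t1 - t0 + 1) * c, 2 * (t1 - t0 + 1) * sF c - (t1 - t0 + 1) + (m - t0), 0) := by
  rw [vtx, if_pos hm]

lemma vtx_gr (ht : t0 < t1) (c : ℕ) {m : ℤ} (hm : m ≤ t0 ∨ t1 ≤ m) :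
    Gr (t1 - t0 + 1) (vtx t0 t1 c m).1 (vtx t0 t1 c m).2.1 ∧ (vtx t0 t1 c m).2.2 = 0 := by
  rcases hm with hm | hm
  · rw [vtx_col c hm]
    exact ⟨Or.inl ⟨c, rfl, by simp only; omega⟩, rfl⟩
  · rw [vtx_row ht c hm]
    exact ⟨Or.inr ⟨c, rfl, by simp only; omega⟩, rfl⟩

lemma vtx_step (ht : t0 < t1) (c : ℕ) {m : ℤ} (hm : m < t0 ∨ t1 ≤ m) :
    ((vtx t0 t1 c (m+1)).1 = (vtx t0 t1 c m).1 + 1 ∧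
      (vtx t0 t1 c (m+1)).2.1 = (vtx t0 t1 c m).2.1) ∨
    ((vtx t0 t1 c (m+1)).1 = (vtx t0 t1 c m).1 ∧
      (vtx t0 t1 c (m+1)).2.1 = (vtx t0 t1 c m).2.1 + 1) := by
  rcases hm with hm | hm
  · rw [vtx_col c hm.le, vtx_col c (show m + 1 ≤ t0 by omega)]
    right; exact ⟨rfl, by simp only; ring⟩
  · rw [vtx_row ht c hm, vtx_row ht c (show t1 ≤ m + 1 by omega)]
    left; exact ⟨by simp only; ring, rfl⟩

lemma out_step (ht : t0 < t1) (h1 : ∀ n < t0, o n = true) (h2 : ∀ n, t1 ≤ n → o n = true)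
    (h4 : o (t1 - 1) = false)
    (T : DCopy (doubleRay o) (unionD o (vtx t0 t1))) {n : ℤ} (hn : t1 ≤ n) :
    ∃ c p, (p < t0 ∨ t1 ≤ p) ∧ T.toFun n = vtx t0 t1 c p ∧ T.toFun (n+1) = vtx t0 t1 c (p+1) := by
  obtain ⟨c, p, h5, h6⟩ := step_edge T n
  have hp : p < t0 ∨ t1 ≤ p := by
    by_contra hc
    exact dead_b ht h1 h2 h4 T hn (by omega) (by omega) h5
  refine ⟨c, p, hp, h5, ?_⟩
  rcases h6 with ⟨h6, _⟩ | ⟨h6, h7⟩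
  · exact h6
  · exfalso
    have hp' : p - 1 < t0 ∨ t1 ≤ p - 1 := by
      by_contra hc
      exact dead_b ht h1 h2 h4 T (n := n + 1) (by omega) (by omega) (by omega) h6
    rw [h2 n hn] at h7
    rcases hp' with hp' | hp'
    · rw [h1 _ hp'] at h7; simp at h7
    · rw [h2 _ hp'] at h7; simp at h7

lemma in_step (ht : t0 < t1) (h1 : ∀ n < t0, o n = true) (h2 : ∀ n, t1 ≤ n → o n = true)
    (h3 : o t0 = false)
    (T : DCopy (doubleRay o) (unionD o (vtx t0 t1))) {n : ℤ} (hn : n ≤ t0) :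
    ∃ c p, (p ≤ t0 ∨ t1 < p) ∧ T.toFun n = vtx t0 t1 c p ∧ T.toFun (n-1) = vtx t0 t1 c (p-1) := by
  obtain ⟨c, p, h5, h6⟩ := step_edge_back T n
  have hp : p ≤ t0 ∨ t1 < p := by
    by_contra hc
    exact dead_a ht h1 h2 h3 T hn (by omega) (by omega) h5
  refine ⟨c, p, hp, h5, ?_⟩
  rcases h6 with ⟨h6, _⟩ | ⟨h6, h7⟩
  · exact h6
  · exfalso
    have hp' : p + 1 ≤ t0 ∨ t1 < p + 1 := by
      by_contra hc
      exact dead_a ht h1 h2 h3 T (n := n - 1) (by omega) (by omega) (by omega) h6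
    rw [h1 (n - 1) (by omega)] at h7
    rcases hp' with hp' | hp'
    · rw [h1 p (by omega)] at h7; simp at h7
    · rw [h2 p (by omega)] at h7; simp at h7

theorem even_not_ubiq (ht : t0 < t1) (h1 : ∀ n < t0, o n = true) (h2 : ∀ n, t1 ≤ n → o n = true)
    (h3 : o t0 = false) (h4 : o (t1 - 1) = false) : ¬ Ubiquitous (doubleRay o) := by
  have hsF : ∀ {c c' : ℕ}, Nat.sqrt c = Nat.sqrt c' → sF c = sF c' := by
    intro c c' h; unfold sF; rw [h]
  refine not_ubiq o (vtx t0 t1) ?_ ?_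
    (fun T c => T.toFun t0 = vtx t0 t1 c t0 ∧ T.toFun t1 = vtx t0 t1 c t1) ?_ ?_
  · intro c m m' h
    rcases vtx_eq ht h with ⟨_, h⟩ | ⟨_, _, h⟩
    · exact h
    · have := sF_le c
      omega
  · intro c c' hne hs n n' h
    rcases vtx_eq ht h with ⟨h, _⟩ | ⟨_, _, h⟩
    · exact hne h
    · have := sF_le c
      have := sF_le c'
      have := hsF hs
      omega
  · intro T
    exact core ht h1 h2 h3 h4 T
  · rintro T T' r c ⟨ha, hb⟩ ⟨ha', hb'⟩ (rfl | hrc)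
    · exact ⟨t0, t0, ha.trans ha'.symm⟩
    · have hB : ∀ i : ℕ, ∃ c p, (p < t0 ∨ t1 ≤ p) ∧ T.toFun (t1 + i) = vtx t0 t1 c p ∧
          T.toFun (t1 + (i + 1 : ℕ)) = vtx t0 t1 c (p+1) := by
        intro i
        have := out_step ht h1 h2 h4 T (n := t1 + i) (by omega)
        rwa [show t1 + ((i + 1 : ℕ) : ℤ) = t1 + i + 1 by push_cast; ring]
      have hQ : ∀ i : ℕ, ∃ c p, (p ≤ t0 ∨ t1 < p) ∧ T'.toFun (t0 - i) = vtx t0 t1 c p ∧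
          T'.toFun (t0 - (i + 1 : ℕ)) = vtx t0 t1 c (p-1) := by
        intro i
        have := in_step ht h1 h2 h3 T' (n := t0 - i) (by omega)
        rwa [show t0 - ((i + 1 : ℕ) : ℤ) = t0 - i - 1 by push_cast; ring]
      have hBg : ∀ i : ℕ, Gr (t1 - t0 + 1) (T.toFun (t1 + i)).1 (T.toFun (t1 + i)).2.1 ∧
          (T.toFun (t1 + i)).2.2 = 0 := by
        intro i
        obtain ⟨c, p, hp, h5, _⟩ := hB i
        rw [h5]
        exact vtx_gr ht c (by omega)
      have hQg : ∀ i : ℕ, Gr (t1 - t0 + 1) (T'.toFun (t0 - i)).1 (T'.toFun (t0 - i)).2.1 ∧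
          (T'.toFun (t0 - i)).2.2 = 0 := by
        intro i
        obtain ⟨c, p, hp, h5, _⟩ := hQ i
        rw [h5]
        exact vtx_gr ht c (by omega)
      obtain ⟨i, j, hx, hy⟩ := grid_cross (h := t1 - t0 + 1) (by omega) r c hrc
        (fun i => (T.toFun (t1 + i)).1) (fun i => (T.toFun (t1 + i)).2.1)
        (fun i => (T'.toFun (t0 - i)).1) (fun i => (T'.toFun (t0 - i)).2.1)
        (by simp [hb, vtx_row ht r le_rfl]) (by simp [hb, vtx_row ht r le_rfl])
        (by simp [ha', vtx_col c le_rfl]) (by simp [ha', vtx_col c le_rfl])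
        (by
          intro i
          obtain ⟨c, p, hp, h5, h6⟩ := hB i
          simp only [h5, h6]
          exact vtx_step ht c hp)
        (by
          intro i
          obtain ⟨c, p, hp, h5, h6⟩ := hQ i
          simp only [h5, h6]
          have := vtx_step ht c (m := p - 1) (by omega)
          rw [sub_add_cancel] at this
          omega)
        (fun i => (hBg i).1) (fun i => (hQg i).1)
      refine ⟨t1 + i, t0 - j, Prod.ext hx (Prod.ext hy ?_)⟩
      rw [(hBg i).2, (hQg j).2]

end EvenAux

namespace InfAux
open NonUb

lemma exists_val {o : ℤ → Bool} (hinf : ∀ B : ℤ, ∃ n, B ≤ n ∧ IsTurn o n) (b : Bool) (B : ℤ) :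
    ∃ n, B ≤ n ∧ o n = b := by
  by_contra hc
  push Not at hc
  obtain ⟨n, hn, ht⟩ := hinf (B + 1)
  apply ht
  have h1 := hc n (by omega)
  have h2 := hc (n - 1) (by omega)
  revert h1 h2
  cases b <;> cases o n <;> cases o (n - 1) <;> simp

lemma exists_turn {o : ℤ → Bool} (hinf : ∀ B : ℤ, ∃ n, B ≤ n ∧ IsTurn o n) (b : Bool) (B : ℤ) :
    ∃ n, B ≤ n ∧ o (n - 1) = b ∧ o n = !b := by
  by_contra hc
  push Not at hc
  obtain ⟨n, hn, hb⟩ := exists_val hinf b B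
  have : ∀ m, n ≤ m → o m = b := by
    intro m hm
    induction m, hm using Int.leInduction with
    | base => exact hb
    | succ m hm ih =>
      have := hc (m + 1) (by omega) (by rw [add_sub_cancel_right, ih])
      revert this
      cases b <;> cases o (m + 1) <;> simp
  obtain ⟨m, hm, hb'⟩ := exists_val hinf (!b) n
  rw [this m hm] at hb'
  revert hb'
  cases b <;> simp

lemma claim_p0 (o : ℤ → Bool) :
    ∃ p0 : ℤ, ∀ p, p0 ≤ p → ∀ n, (∀ i : ℕ, o (n - 1 - i) = o (p - 1 - i)) → o n = o p := by
  by_contra hc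
  push Not at hc
  have bad : ∀ p0 : ℤ, ∃ q d, p0 ≤ q ∧ 0 < d ∧ (∀ m < q, o m = o (m - d)) ∧ o q ≠ o (q - d) := by
    intro p0
    obtain ⟨p, hp, n, hm, hne⟩ := hc p0
    rcases lt_trichotomy n p with h | h | h
    · refine ⟨p, p - n, hp, by omega, ?_, ?_⟩
      · intro m hmp
        have := hm (p - 1 - m).toNat
        rw [show (((p - 1 - m).toNat : ℕ) : ℤ) = p - 1 - m by omega] at this
        rw [show p - 1 - (p - 1 - m) = m by ring] at this
        rw [← this]; congr 1; ring
      · rw [sub_sub_cancel]; exact hne.symm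
    · exact absurd (by rw [h]) hne
    · refine ⟨n, n - p, by omega, by omega, ?_, ?_⟩
      · intro m hmp
        have := hm (n - 1 - m).toNat
        rw [show (((n - 1 - m).toNat : ℕ) : ℤ) = n - 1 - m by omega] at this
        rw [show n - 1 - (n - 1 - m) = m by ring] at this
        rw [this]; congr 1; ring
      · rw [sub_sub_cancel]; exact hne
  obtain ⟨q1, d1, _, hd1, hP1, hne1⟩ := bad 0
  obtain ⟨q, d, hq, hd, hP, _⟩ := bad (q1 + 1)
  have it : ∀ k : ℕ, ∀ m < q, o m = o (m - k * d) := by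
    intro k
    induction k with
    | zero => intro m _; simp
    | succ k ih =>
      intro m hm
      rw [ih m hm, hP (m - k * d) (by have : 0 ≤ (k : ℤ) * d := by positivity
                                      omega)]
      congr 1; push_cast; ring
  apply hne1
  have hk : d ≤ ((1 : ℕ) : ℤ) * d := by simp
  rw [it 1 q1 (by omega), it 1 (q1 - d1) (by omega), hP1 (q1 - (1 : ℕ) * d) (by omega)]
  congr 1; ring

structure Sys (o : ℤ → Bool) (α β : ℕ → ℤ) (ρ₀ ρ₁ : ℕ → ℕ) : Prop where
  ab : ∀ m, α m < β m
  ba : ∀ m, β m < α (m + 1)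
  a0 : 1 ≤ α 0
  sa : ∀ m, o (α m - 1) = true ∧ o (α m) = false
  sb : ∀ m, o (β m - 1) = false ∧ o (β m) = true
  rne : ∀ m, Nat.sqrt (ρ₀ m) ≠ Nat.sqrt (ρ₁ m)

open Classical in
/-- The copies in the construction for infinitely many turns. -/
noncomputable def hc (α β : ℕ → ℤ) (ρ₀ ρ₁ : ℕ → ℕ) (c : ℕ) (n : ℤ) : ℕ × ℤ :=
  if h : ∃ m, n = β m ∧ c = ρ₁ m then (ρ₀ h.choose, α h.choose) else (c, n)

variable {o : ℤ → Bool} {α β : ℕ → ℤ} {ρ₀ ρ₁ : ℕ → ℕ}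

lemma Sys.amono (S : Sys o α β ρ₀ ρ₁) : StrictMono α :=
  strictMono_nat_of_lt_succ fun m => (S.ab m).trans (S.ba m)

lemma Sys.bmono (S : Sys o α β ρ₀ ρ₁) : StrictMono β :=
  strictMono_nat_of_lt_succ fun m => (S.ba m).trans (S.ab (m + 1))

lemma Sys.ane (S : Sys o α β ρ₀ ρ₁) (m l : ℕ) : α m ≠ β l := by
  intro h
  have := (S.sa m).2
  rw [h, (S.sb l).2] at this
  simp at this

lemma Sys.hc_b (S : Sys o α β ρ₀ ρ₁) (m : ℕ) : hc α β ρ₀ ρ₁ (ρ₁ m) (β m) = (ρ₀ m, α m) := by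
  have h : ∃ l, β m = β l ∧ ρ₁ m = ρ₁ l := ⟨m, rfl, rfl⟩
  rw [hc, dif_pos h]
  have := S.bmono.injective h.choose_spec.1
  rw [← this]

lemma Sys.hc_n (c : ℕ) (n : ℤ) (h : ¬ ∃ m, n = β m ∧ c = ρ₁ m) :
    hc α β ρ₀ ρ₁ c n = (c, n) := by
  rw [hc, dif_neg h]

lemma Sys.hc_a (S : Sys o α β ρ₀ ρ₁) (c m : ℕ) : hc α β ρ₀ ρ₁ c (α m) = (c, α m) :=
  Sys.hc_n _ _ (by rintro ⟨l, h, _⟩; exact S.ane m l h)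

/-- Crossing partners. -/
def Par (α β : ℕ → ℤ) (ρ₀ ρ₁ : ℕ → ℕ) (c : ℕ) (n : ℤ) (c' : ℕ) (n' : ℤ) : Prop :=
  ∃ m, (n = α m ∧ n' = β m ∧ c = ρ₀ m ∧ c' = ρ₁ m) ∨ (n = β m ∧ n' = α m ∧ c = ρ₁ m ∧ c' = ρ₀ m)

lemma Sys.hc_eq (S : Sys o α β ρ₀ ρ₁) {c c' : ℕ} {n n' : ℤ}
    (h : hc α β ρ₀ ρ₁ c n = hc α β ρ₀ ρ₁ c' n') : (c' = c ∧ n' = n) ∨ Par α β ρ₀ ρ₁ c n c' n' := by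
  by_cases h1 : ∃ m, n = β m ∧ c = ρ₁ m <;> by_cases h2 : ∃ m, n' = β m ∧ c' = ρ₁ m
  · obtain ⟨m, rfl, rfl⟩ := h1
    obtain ⟨m', rfl, rfl⟩ := h2
    rw [S.hc_b, S.hc_b, Prod.mk.injEq] at h
    have := S.amono.injective h.2
    left; rw [this]; simp
  · obtain ⟨m, rfl, rfl⟩ := h1
    rw [S.hc_b, Sys.hc_n _ _ h2, Prod.mk.injEq] at h
    exact Or.inr ⟨m, Or.inr ⟨rfl, h.2.symm, rfl, h.1.symm⟩⟩
  · obtain ⟨m, rfl, rfl⟩ := h2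
    rw [S.hc_b, Sys.hc_n _ _ h1, Prod.mk.injEq] at h
    exact Or.inr ⟨m, Or.inl ⟨h.2, rfl, h.1, rfl⟩⟩
  · rw [Sys.hc_n _ _ h1, Sys.hc_n _ _ h2, Prod.mk.injEq] at h
    exact Or.inl ⟨h.1.symm, h.2.symm⟩

lemma Par.sqrt_ne (S : Sys o α β ρ₀ ρ₁) {c c' : ℕ} {n n' : ℤ} (h : Par α β ρ₀ ρ₁ c n c' n') :
    Nat.sqrt c ≠ Nat.sqrt c' := by
  rcases h with ⟨m, ⟨_, _, rfl, rfl⟩ | ⟨_, _, rfl, rfl⟩⟩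
  · exact S.rne m
  · exact (S.rne m).symm

lemma Par.ne_turn (S : Sys o α β ρ₀ ρ₁) {c c' : ℕ} {n n' : ℤ} (h : Par α β ρ₀ ρ₁ c n c' n') :
    o n' = !o n ∧ o (n' - 1) = o n := by
  rcases h with ⟨m, ⟨rfl, rfl, _, _⟩ | ⟨rfl, rfl, _, _⟩⟩
  · rw [(S.sa m).2, (S.sb m).1, (S.sb m).2]; simp
  · rw [(S.sb m).2, (S.sa m).1, (S.sa m).2]; simp

lemma Sys.a_ge (S : Sys o α β ρ₀ ρ₁) (m : ℕ) : α 0 + m ≤ α m := by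
  induction m with
  | zero => simp
  | succ m ih => have := S.ab m; have := S.ba m; push_cast; omega

lemma Par.ge (S : Sys o α β ρ₀ ρ₁) {c c' : ℕ} {n n' : ℤ} (h : Par α β ρ₀ ρ₁ c n c' n') :
    α 0 ≤ n ∧ α 0 ≤ n' := by
  rcases h with ⟨m, ⟨rfl, rfl, _, _⟩ | ⟨rfl, rfl, _, _⟩⟩ <;>
    · have := S.a_ge m; have := S.ab m; omega

/-- Crossings within the first `m` pairs. -/
lemma Par.le (S : Sys o α β ρ₀ ρ₁) {c c' : ℕ} {n n' : ℤ} (h : Par α β ρ₀ ρ₁ c n c' n') (m : ℕ)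
    (hn : n ≤ β m) : n' ≤ β m ∧ ∃ l ≤ m, c' = ρ₀ l ∨ c' = ρ₁ l := by
  rcases h with ⟨l, ⟨rfl, rfl, _, rfl⟩ | ⟨rfl, rfl, _, rfl⟩⟩
  · have : l ≤ m := by
      by_contra hl
      have := S.amono.monotone (show m + 1 ≤ l by omega)
      have := S.ba m
      omega
    exact ⟨S.bmono.monotone this, l, this, Or.inr rfl⟩
  · have : l ≤ m := S.bmono.le_iff_le.1 hn
    exact ⟨(S.ab l).le.trans hn, l, this, Or.inl rfl⟩

/-- No crossings strictly between `β m` and `α (m+1)`. -/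
lemma Par.not_between (S : Sys o α β ρ₀ ρ₁) {c c' : ℕ} {n n' : ℤ} (h : Par α β ρ₀ ρ₁ c n c' n')
    (m : ℕ) (h1 : β m < n) : α (m + 1) ≤ n := by
  rcases h with ⟨l, ⟨rfl, rfl, _, rfl⟩ | ⟨rfl, rfl, _, rfl⟩⟩
  · have : m + 1 ≤ l := by
      by_contra hl
      have := S.amono.monotone (show l ≤ m by omega)
      have := S.ab m
      omega
    exact S.amono.monotone this
  · have : m + 1 ≤ l := S.bmono.lt_iff_lt.1 h1
    exact (S.amono.monotone this).trans (S.ab l).le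

/-- The data of an end of a copy. -/
structure End (o : ℤ → Bool) (h : ℕ → ℤ → ℕ × ℤ) (w : ℕ → Bool) (t : ℕ → ℕ × ℤ) : Prop where
  inj : Function.Injective t
  edge : ∀ i, ∃ c p, t i = h c p ∧
    ((t (i+1) = h c (p+1) ∧ o p = w i) ∨ (t (i+1) = h c (p-1) ∧ o (p-1) = !w i))

variable {w : ℕ → Bool} {t : ℕ → ℕ × ℤ}

/-- Transition going outwards. -/
lemma End.out (E : End o (hc α β ρ₀ ρ₁) w t) (S : Sys o α β ρ₀ ρ₁) {i c : ℕ} {p : ℤ}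
    (h0 : t i = hc α β ρ₀ ρ₁ c p) (h1 : t (i+1) = hc α β ρ₀ ρ₁ c (p+1)) :
    (t (i+1+1) = hc α β ρ₀ ρ₁ c (p+1+1) ∧ o (p+1) = w (i+1)) ∨
      ((∃ c' p', Par α β ρ₀ ρ₁ c (p+1) c' p') ∧ o (p+1) = !w (i+1)) := by
  obtain ⟨c', p', h2, h3⟩ := E.edge (i+1)
  rcases S.hc_eq (h1.symm.trans h2) with ⟨rfl, rfl⟩ | hp
  · rcases h3 with h3 | h3
    · exact Or.inl h3
    · rw [add_sub_cancel_right, ← h0] at h3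
      have := E.inj h3.1
      omega
  · right
    refine ⟨⟨c', p', hp⟩, ?_⟩
    obtain ⟨h4, h5⟩ := hp.ne_turn S
    rcases h3 with ⟨_, h3⟩ | ⟨_, h3⟩
    · rw [← h3, h4]; simp
    · rw [← h5, h3]

/-- Transition going inwards at a non-crossing. -/
lemma End.inw (E : End o (hc α β ρ₀ ρ₁) w t) (S : Sys o α β ρ₀ ρ₁) {i c : ℕ} {p : ℤ}
    (h0 : t i = hc α β ρ₀ ρ₁ c p) (h1 : t (i+1) = hc α β ρ₀ ρ₁ c (p-1)) (hp : p ≤ α 0) :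
    t (i+1+1) = hc α β ρ₀ ρ₁ c (p-1-1) := by
  obtain ⟨c', p', h2, h3⟩ := E.edge (i+1)
  rcases S.hc_eq (h1.symm.trans h2) with ⟨rfl, rfl⟩ | hp
  · rcases h3 with h3 | h3
    · rw [sub_add_cancel, ← h0] at h3
      have := E.inj h3.1
      omega
    · exact h3.1
  · have := (hp.ge S).1
    omega

lemma End.inw_forever (E : End o (hc α β ρ₀ ρ₁) w t) (S : Sys o α β ρ₀ ρ₁) {N c : ℕ} {p : ℤ}
    (h0 : t N = hc α β ρ₀ ρ₁ c p) (h1 : t (N+1) = hc α β ρ₀ ρ₁ c (p-1)) (hp : p ≤ α 0) (i : ℕ) :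
    t (N + i) = hc α β ρ₀ ρ₁ c (p - i) := by
  have : ∀ i : ℕ, t (N + i) = hc α β ρ₀ ρ₁ c (p - i) ∧
      t (N + i + 1) = hc α β ρ₀ ρ₁ c (p - i - 1) := by
    intro i
    induction i with
    | zero => simpa using ⟨h0, h1⟩
    | succ i ih =>
      have := E.inw S ih.1 ih.2 (by omega)
      rw [show N + (i + 1) = N + i + 1 by ring,
        show p - ((i + 1 : ℕ) : ℤ) = p - i - 1 by push_cast; ring]
      exact ⟨ih.2, this⟩
  exact (this i).1

/-- A matched word goes outwards forever. -/
lemma End.out_forever (E : End o (hc α β ρ₀ ρ₁) w t) (S : Sys o α β ρ₀ ρ₁) {N c : ℕ} {p : ℤ}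
    (h0 : t N = hc α β ρ₀ ρ₁ c p) (h1 : t (N+1) = hc α β ρ₀ ρ₁ c (p+1))
    (hw : ∀ i : ℕ, w (N + i) = o (p + i)) (i : ℕ) :
    t (N + i) = hc α β ρ₀ ρ₁ c (p + i) := by
  have : ∀ i : ℕ, t (N + i) = hc α β ρ₀ ρ₁ c (p + i) ∧
      t (N + i + 1) = hc α β ρ₀ ρ₁ c (p + i + 1) := by
    intro i
    induction i with
    | zero => simpa using ⟨h0, h1⟩
    | succ i ih =>
      have h2 := hw (i + 1)
      rw [show N + (i + 1) = N + i + 1 by ring,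
        show p + ((i + 1 : ℕ) : ℤ) = p + i + 1 by push_cast; ring] at h2 ⊢
      rcases E.out S ih.1 ih.2 with ⟨h3, _⟩ | ⟨_, h3⟩
      · exact ⟨ih.2, h3⟩
      · rw [h2] at h3
        revert h3
        cases o (p + i + 1) <;> simp
  exact (this i).1

/-- The end goes outwards from `β m` to `α (m+1)` reading off the word of the ray. -/
lemma End.out_match (E : End o (hc α β ρ₀ ρ₁) w t) (S : Sys o α β ρ₀ ρ₁) {N c m : ℕ}
    (h0 : t N = hc α β ρ₀ ρ₁ c (β m)) (h1 : t (N+1) = hc α β ρ₀ ρ₁ c (β m +1))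
    (hw : o (β m) = w N) (i : ℕ) (hi : β m + i < α (m+1)) : w (N + i) = o (β m + i) := by
  have : ∀ i : ℕ, β m + i < α (m+1) → t (N + i) = hc α β ρ₀ ρ₁ c (β m + i) ∧
      t (N + i + 1) = hc α β ρ₀ ρ₁ c (β m + i + 1) ∧ w (N + i) = o (β m + i) := by
    intro i
    induction i with
    | zero => intro _; simpa using ⟨h0, h1, hw.symm⟩
    | succ i ih =>
      intro hi
      push_cast at hi
      obtain ⟨h2, h3, h4⟩ := ih (by omega)
      rw [show N + (i + 1) = N + i + 1 by ring,
        show β m + ((i + 1 : ℕ) : ℤ) = β m + i + 1 by push_cast; ring]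
      rcases E.out S h2 h3 with ⟨h5, h6⟩ | ⟨⟨c', p', h5⟩, _⟩
      · exact ⟨h3, h5, h6.symm⟩
      · have := h5.not_between S m (by omega)
        omega
  exact (this i hi).2.2

def Kill (o : ℤ → Bool) (w : ℕ → Bool) (m : ℕ) (b a : ℤ) : Prop :=
  ∀ n : ℕ, n ≤ (2 * m + 3) * (2 * b.toNat + 1) →
    (∀ i : ℕ, b + i < a → w (n + i) = o (b + i)) → ∀ i : ℕ, w (n + i) = o (b + i)

lemma End.main (E : End o (hc α β ρ₀ ρ₁) w t) (S : Sys o α β ρ₀ ρ₁)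
    (hK : ∀ m, Kill o w m (β m) (α (m+1))) :
    (∃ c N p, ∀ i : ℕ, t (N + i) = hc α β ρ₀ ρ₁ c (p + i)) ∨
    (∃ c N p, p ≤ α 0 ∧ ∀ i : ℕ, t (N + i) = hc α β ρ₀ ρ₁ c (p - i)) := by
  classical
  by_contra hcon
  rw [not_or] at hcon
  obtain ⟨hA, hB⟩ := hcon
  choose c p h0 hst using E.edge
  have hlow : ∀ i, t (i+1) = hc α β ρ₀ ρ₁ (c i) (p i - 1) → α 0 < p i := by
    intro i hi
    by_contra hp
    exact hB ⟨c i, i, p i, by omega, E.inw_forever S (h0 i) hi (by omega)⟩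
  obtain ⟨m, hm⟩ : ∃ m : ℕ, |p 0| ≤ β m :=
    ⟨(p 0).natAbs, by
      rw [Int.abs_eq_natAbs]
      have := S.a_ge (p 0).natAbs; have := S.ab (p 0).natAbs; have := S.a0; omega⟩
  have hE : ∀ i ≤ (2 * m + 3) * (2 * (β m).toNat + 1),
      ¬ (p i = β m ∧ t (i+1) = hc α β ρ₀ ρ₁ (c i) (p i + 1) ∧ o (p i) = w i) := by
    rintro i hi ⟨h1, h2, h3⟩
    have h0' := h0 i
    rw [h1] at h2 h3 h0'
    have hw := hK m i hi (E.out_match S h0' h2 h3)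
    exact hA ⟨_, _, _, E.out_forever S h0' h2 hw⟩
  let R : Finset ℕ := insert (c 0) ((Finset.range (m+1)).image ρ₀ ∪ (Finset.range (m+1)).image ρ₁)
  have hRcard : R.card ≤ 2 * m + 3 := by
    have h1 := Finset.card_insert_le (c 0)
      ((Finset.range (m+1)).image ρ₀ ∪ (Finset.range (m+1)).image ρ₁)
    have h2 := Finset.card_union_le ((Finset.range (m+1)).image ρ₀) ((Finset.range (m+1)).image ρ₁)
    have h3 := Finset.card_image_le (s := Finset.range (m+1)) (f := ρ₀)
    have h4 := Finset.card_image_le (s := Finset.range (m+1)) (f := ρ₁)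
    rw [Finset.card_range] at h3 h4
    show (insert (c 0) _ : Finset ℕ).card ≤ _
    omega
  have hbpos : 0 ≤ β m := (abs_nonneg _).trans hm
  have inv : ∀ i ≤ (2 * m + 3) * (2 * (β m).toNat + 1), c i ∈ R ∧ -β m ≤ p i ∧ p i ≤ β m := by
    intro i
    induction i with
    | zero =>
      intro _
      exact ⟨Finset.mem_insert_self _ _, (abs_le.1 hm).1, (abs_le.1 hm).2⟩
    | succ i ih =>
      intro hi
      obtain ⟨h1, h2, h3⟩ := ih (by omega)
      have h4 := hE i (by omega)
      obtain ⟨q, hq, hq1, hq2⟩ : ∃ q, t (i+1) = hc α β ρ₀ ρ₁ (c i) q ∧ -β m ≤ q ∧ q ≤ β m := by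
        rcases hst i with h5 | h5
        · refine ⟨p i + 1, h5.1, by omega, ?_⟩
          by_contra hq
          exact h4 ⟨by omega, h5⟩
        · refine ⟨p i - 1, h5.1, ?_, by omega⟩
          have := hlow i h5.1
          have := S.a0
          omega
      rcases S.hc_eq (hq.symm.trans (h0 (i+1))) with ⟨h5, h6⟩ | h5
      · rw [h5, h6]; exact ⟨h1, hq1, hq2⟩
      · have h6 := (h5.ge S).2
        have h7 := S.a0
        obtain ⟨h8, l, hl, h9⟩ := h5.le S m hq2
        refine ⟨?_, by omega, h8⟩
        refine Finset.mem_insert_of_mem (Finset.mem_union.2 ?_)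
        rcases h9 with h9 | h9
        · exact Or.inl (Finset.mem_image.2 ⟨l, Finset.mem_range.2 (by omega), h9.symm⟩)
        · exact Or.inr (Finset.mem_image.2 ⟨l, Finset.mem_range.2 (by omega), h9.symm⟩)
  set B := (2 * m + 3) * (2 * (β m).toNat + 1) with hBdef
  have hcard : (Finset.range (B + 1)).card ≤ (R ×ˢ Finset.Icc (-β m) (β m)).card := by
    refine Finset.card_le_card_of_injOn (fun i => (c i, p i)) ?_ ?_
    · intro i hi
      have hi' : i < B + 1 := by simpa using hi
      obtain ⟨h1, h2, h3⟩ := inv i (by omega)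
      simp only [Finset.coe_product, Set.mem_prod, Finset.mem_coe, Finset.mem_Icc]
      exact ⟨h1, h2, h3⟩
    · intro i _ j _ hij
      simp only [Prod.mk.injEq] at hij
      apply E.inj
      rw [h0 i, h0 j, hij.1, hij.2]
  rw [Finset.card_range, Finset.card_product, Int.card_Icc] at hcard
  have e : (β m + 1 - -β m).toNat = 2 * (β m).toNat + 1 := by omega
  rw [e] at hcard
  have := Nat.mul_le_mul_right (2 * (β m).toNat + 1) hRcard
  omega

/-- Every copy contains an outward tail of one of the defining double rays. -/
lemma tail_of_copy (S : Sys o α β ρ₀ ρ₁)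
    (hK : ∀ m, Kill o (fun k => !o (-1 - k)) m (β m) (α (m+1)))
    (hp0 : ∀ p, α 0 ≤ p → ∀ n, (∀ i : ℕ, o (n - 1 - i) = o (p - 1 - i)) → o n = o p)
    (T : DCopy (doubleRay o) (unionD o (hc α β ρ₀ ρ₁))) :
    ∃ c, ∃ a : ℤ, ∀ k, a ≤ k → ∃ n, T.toFun n = hc α β ρ₀ ρ₁ c k := by
  have E : End o (hc α β ρ₀ ρ₁) (fun k => !o (-1 - k)) (fun i : ℕ => T.toFun (-i)) := by
    constructor
    · intro i j hij
      have := T.inj hij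
      omega
    · intro i
      obtain ⟨c, p, h1, h2⟩ := EvenAux.step_edge_back T (-i)
      refine ⟨c, p, h1, ?_⟩
      try simp only
      rw [show -((i + 1 : ℕ) : ℤ) = -i - 1 by push_cast; ring, show (-1 - i : ℤ) = -i - 1 by ring]
      rw [Bool.not_not]
      exact h2.symm
  rcases E.main S hK with ⟨c, N, p, h⟩ | ⟨c, N, p, hp, h⟩
  · refine ⟨c, p, fun k hk => ⟨-((N + (k - p).toNat : ℕ) : ℤ), ?_⟩⟩
    rw [h]
    congr 1; omega
  · -- the inward case
    obtain ⟨δ, hδ⟩ : ∃ δ : ℤ, δ = p + N := ⟨_, rfl⟩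
    have hneg : ∀ m : ℤ, m ≤ -N → T.toFun m = hc α β ρ₀ ρ₁ c (m + δ) := by
      intro m hm
      have := h (-m - N).toNat
      try simp only at this
      rw [show -((N + (-m - N).toNat : ℕ) : ℤ) = m by omega,
        show p - (((-m - N).toNat : ℕ) : ℤ) = m + δ by omega] at this
      exact this
    let Q : ℤ → Prop := fun n => T.toFun n = hc α β ρ₀ ρ₁ c (n + δ) ∧
      T.toFun (n + 1) = hc α β ρ₀ ρ₁ c (n + 1 + δ) ∧ o n = o (n + δ)
    have hstep : ∀ n, T.toFun n = hc α β ρ₀ ρ₁ c (n + δ) →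
        T.toFun (n - 1) = hc α β ρ₀ ρ₁ c (n - 1 + δ) →
        Q n ∨ (α 0 ≤ n + δ ∧ o n = !o (n + δ)) := by
      intro n h1 h2
      obtain ⟨c', p', h3, h4⟩ := EvenAux.step_edge T n
      rcases S.hc_eq (h1.symm.trans h3) with ⟨rfl, rfl⟩ | h5
      · rcases h4 with ⟨h4, h5⟩ | ⟨h4, h5⟩
        · left
          refine ⟨h1, ?_, h5.symm⟩
          rw [h4]; congr 1; ring
        · rw [show n + δ - 1 = n - 1 + δ by ring, ← h2] at h4
          have := T.inj h4
          omega
      · right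
        refine ⟨(h5.ge S).1, ?_⟩
        obtain ⟨h6, h7⟩ := h5.ne_turn S
        rcases h4 with ⟨_, h4⟩ | ⟨_, h4⟩
        · rw [← h4, h6]
        · rw [← h7, h4]; simp
    have hQneg : ∀ m : ℤ, m < -N → Q m := by
      intro m hm
      rcases hstep m (hneg m (by omega)) (hneg _ (by omega)) with h1 | ⟨h1, _⟩
      · exact h1
      · omega
    have hQ : ∀ n : ℤ, -(N : ℤ) - 1 ≤ n → ∀ m ≤ n, Q m := by
      intro n hn
      induction n, hn using Int.leInduction with
      | base => intro m hm; exact hQneg m (by omega)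
      | succ n hn ih =>
        intro m hm
        by_cases hmn : m ≤ n
        · exact ih m hmn
        obtain rfl : m = n + 1 := by omega
        have hq := ih n le_rfl
        rcases hstep (n + 1) hq.2.1 (by rw [add_sub_cancel_right]; exact hq.1) with h1 | ⟨h1, h2⟩
        · exact h1
        · have h3 := hp0 (n + 1 + δ) h1 (n + 1) (by
            intro i
            have := (ih (n - i) (by omega)).2.2
            rw [show n + 1 - 1 - (i : ℤ) = n - i by ring, this]
            congr 1; ring)
          rw [h3] at h2
          revert h2
          cases o (n + 1 + δ) <;> simp
    refine ⟨c, 0, fun k _ => ⟨k - δ, ?_⟩⟩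
    have : Q (k - δ) := by
      by_cases hk : k - δ < -N
      · exact hQneg _ hk
      · exact hQ _ (by omega) _ le_rfl
    rw [this.1]
    congr 1; ring

lemma exists_kill (o : ℤ → Bool) (w : ℕ → Bool) (m : ℕ) (b : ℤ) :
    ∃ a0, ∀ a, a0 ≤ a → Kill o w m b a := by
  have h : ∀ n : ℕ, ∃ I : ℕ, ∀ a : ℤ, b + I ≤ a →
      (∀ i : ℕ, b + i < a → w (n + i) = o (b + i)) → ∀ i : ℕ, w (n + i) = o (b + i) := by
    intro n
    by_cases hn : ∀ i : ℕ, w (n + i) = o (b + i)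
    · exact ⟨0, fun _ _ _ => hn⟩
    · push Not at hn
      obtain ⟨i, hi⟩ := hn
      exact ⟨i + 1, fun a ha h => absurd (h i (by push_cast at ha; omega)) hi⟩
  choose I hI using h
  refine ⟨b + ((Finset.range ((2 * m + 3) * (2 * b.toNat + 1) + 1)).sup I : ℕ), ?_⟩
  intro a ha n hn hm
  refine hI n a ?_ hm
  have := Finset.le_sup (f := I) (Finset.mem_range.2 (Nat.lt_succ_of_le hn))
  simp only [Nat.succ_eq_add_one] at this
  omega

theorem inf_not_ubiq (o : ℤ → Bool) (hinf : ∀ B : ℤ, ∃ n, B ≤ n ∧ IsTurn o n) :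
    ¬ Ubiquitous (doubleRay o) := by
  obtain ⟨p0, hp0⟩ := claim_p0 o
  have hnext : ∀ (m : ℕ) (b : ℤ), ∃ x : ℤ × ℤ, b < x.1 ∧ x.1 < x.2 ∧
      (o (x.1 - 1) = true ∧ o x.1 = false) ∧ (o (x.2 - 1) = false ∧ o x.2 = true) ∧
      Kill o (fun k => !o (-1 - k)) m b x.1 := by
    intro m b
    obtain ⟨a0, ha0⟩ := exists_kill o (fun k => !o (-1 - k)) m b
    obtain ⟨x, hx, hx1, hx2⟩ := exists_turn hinf true (max a0 (b + 1))
    obtain ⟨y, hy, hy1, hy2⟩ := exists_turn hinf false (x + 1)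
    exact ⟨(x, y), by simp only; omega, by simp only; omega, ⟨hx1, hx2⟩, ⟨hy1, hy2⟩,
      ha0 _ (by simp only; omega)⟩
  choose F hF using hnext
  let s : ℕ → ℤ × ℤ := fun m => Nat.rec (F 0 (max p0 1)) (fun m x => F m x.2) m
  have hs0 : s 0 = F 0 (max p0 1) := rfl
  have hs : ∀ m, s (m + 1) = F m (s m).2 := fun m => rfl
  have hs' : ∀ m, ∃ k b, s m = F k b := by
    intro m
    cases m with
    | zero => exact ⟨_, _, hs0⟩
    | succ m => exact ⟨_, _, hs m⟩
  let r : ℕ → ℕ × ℕ := fun m =>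
    if Nat.sqrt (Nat.unpair (Nat.unpair m).1).1 ≠ Nat.sqrt (Nat.unpair (Nat.unpair m).1).2 then
      Nat.unpair (Nat.unpair m).1 else (0, 1)
  have S : Sys o (fun m => (s m).1) (fun m => (s m).2) (fun m => (r m).1) (fun m => (r m).2) := by
    constructor
    · intro m
      obtain ⟨k, b, h⟩ := hs' m
      simp only [h]
      exact (hF k b).2.1
    · intro m
      simp only [hs]
      exact (hF _ _).1
    · simp only [hs0]
      have := (hF 0 (max p0 1)).1
      omega
    · intro m
      obtain ⟨k, b, h⟩ := hs' m
      simp only [h]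
      exact (hF k b).2.2.1
    · intro m
      obtain ⟨k, b, h⟩ := hs' m
      simp only [h]
      exact (hF k b).2.2.2.1
    · intro m
      simp only [r]
      split_ifs with h
      · exact h
      · simp
  refine not_ubiq o _ ?_ ?_
    (fun T c => ∃ a : ℤ, ∀ k, a ≤ k → ∃ n, T.toFun n = hc _ _ _ _ c k)
    (tail_of_copy S ?_ ?_) ?_
  · intro c n n' h
    rcases S.hc_eq h with ⟨_, h⟩ | h
    · exact h.symm
    · exact absurd rfl (h.sqrt_ne S)
  · intro c c' hne hsq n n' h
    rcases S.hc_eq h with ⟨h, _⟩ | h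
    · exact hne h.symm
    · exact absurd hsq (h.sqrt_ne S)
  · intro m
    simp only [hs]
    exact (hF _ _).2.2.2.2
  · intro p hp
    refine hp0 p ?_
    have := (hF 0 (max p0 1)).1
    simp only [hs0] at hp
    omega
  · rintro T T' c c' ⟨a, ha⟩ ⟨a', ha'⟩ (rfl | hcc)
    · obtain ⟨u, hu⟩ := ha (max a a') (le_max_left _ _)
      obtain ⟨v, hv⟩ := ha' (max a a') (le_max_right _ _)
      exact ⟨u, v, hu.trans hv.symm⟩
    · obtain ⟨m, hm, hr⟩ : ∃ m : ℕ, a.natAbs + a'.natAbs ≤ m ∧ r m = (c, c') := by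
        refine ⟨Nat.pair (Nat.pair c c') (a.natAbs + a'.natAbs), Nat.right_le_pair _ _, ?_⟩
        simp only [r, Nat.unpair_pair]
        rw [if_pos hcc.ne]
      have h1 := S.a_ge m
      have h2 := S.ab m
      have h3 := S.a0
      obtain ⟨u, hu⟩ := ha ((s m).1) (by omega)
      obtain ⟨v, hv⟩ := ha' ((s m).2) (by omega)
      refine ⟨u, v, ?_⟩
      have h4 := S.hc_a c m
      have h5 := S.hc_b m
      simp only [hr] at h4 h5
      rw [hu, hv]
      exact h4.trans h5.symm

end InfAux

lemma even_case (o : ℤ → Bool) (N : ℕ) (hpos : ∀ n : ℤ, N ≤ n → o n = true)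
    (hneg : ∀ n : ℤ, n ≤ -N → o n = true) (hfin : {n : ℤ | IsTurn o n}.Finite)
    (hne : ∃ n : ℤ, IsTurn o n) : ¬ Ubiquitous (doubleRay o) := by
  obtain ⟨t0, ht0, hmin⟩ := Set.exists_min_image {n : ℤ | IsTurn o n} id hfin hne
  obtain ⟨t1, ht1, hmax⟩ := Set.exists_max_image {n : ℤ | IsTurn o n} id hfin hne
  replace ht0 : IsTurn o t0 := ht0
  replace ht1 : IsTurn o t1 := ht1
  have hlow := NonUb.const_below o (t0 - 1) (fun n hn ht => by
    have := hmin n ht; simp only [id] at this; omega)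
  have hup := NonUb.const_above o t1 (fun n hn ht => by
    have := hmax n ht; simp only [id] at this; omega)
  have e0 : o (t0 - 1) = true := by
    rw [← hlow (min (t0 - 1) (-N)) (min_le_left _ _)]
    exact hneg _ (min_le_right _ _)
  have e1 : o t1 = true := by
    rw [← hup (max t1 N) (le_max_left _ _)]
    exact hpos _ (le_max_right _ _)
  have f0 : o t0 = false := by
    unfold IsTurn at ht0
    rw [e0] at ht0
    simpa using ht0.symm
  have f1 : o (t1 - 1) = false := by
    unfold IsTurn at ht1
    rw [e1] at ht1
    simpa using ht1
  have hle : t0 ≤ t1 := hmin t1 ht1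
  have hlt : t0 < t1 := by
    rcases hle.lt_or_eq with h | h
    · exact h
    · rw [h, e1] at f0; simp at f0
  exact EvenAux.even_not_ubiq hlt (fun n hn => (hlow n (by omega)).trans e0)
    (fun n hn => (hup n hn).trans e1) f0 f1

/-- main theorem: an oriented double ray with at least one turn
is ubiquitous iff it has a finite, odd number of turns. -/
theorem doubleRay_ubiquitous_iff_odd_turns (o : ℤ → Bool)
    (h : ∃ n : ℤ, IsTurn o n) :
    Ubiquitous (doubleRay o) ↔
      ({n : ℤ | IsTurn o n}.Finite ∧ Odd {n : ℤ | IsTurn o n}.ncard) := by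
  have hrev : ∀ n, IsTurn (fun n => !o n) n ↔ IsTurn o n := by
    intro n; simp [IsTurn]
  constructor
  · intro hU
    have hfin : {n : ℤ | IsTurn o n}.Finite := by
      by_contra hinf
      by_cases hA : BddAbove {n : ℤ | IsTurn o n}
      · have hB : ¬ BddBelow {n : ℤ | IsTurn o n} := fun hB => hinf (hB.finite_of_bddAbove hA)
        refine InfAux.inf_not_ubiq (fun n => !o (-1 - n)) ?_ (NonUb.refl_ubiq hU)
        intro B
        rw [not_bddBelow_iff] at hB
        obtain ⟨n, hn, hlt⟩ := hB (-B)
        refine ⟨-n, by omega, ?_⟩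
        have hn' : o (n - 1) ≠ o n := hn
        show (!o (-1 - (-n - 1))) ≠ !o (-1 - -n)
        rw [show -1 - (-n - 1) = n by ring, show -1 - -n = n - 1 by ring]
        intro he
        exact hn' (by simpa using he.symm)
      · refine InfAux.inf_not_ubiq o ?_ hU
        intro B
        rw [not_bddAbove_iff] at hA
        obtain ⟨n, hn, hlt⟩ := hA B
        exact ⟨n, hlt.le, hn⟩
    refine ⟨hfin, ?_⟩
    by_contra hodd
    rw [Nat.not_odd_iff_even] at hodd
    obtain ⟨N, hpos, hneg, hpar⟩ := NonUb.ends o hfin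
    have hee := hpar.2 hodd
    cases hN : o N
    · refine even_case (fun n => !o n) N ?_ ?_ ?_ ?_ (NonUb.rev_ubiq hU)
      · intro n hn; simp [hpos n hn, hN]
      · intro n hn; simp [hneg n hn, hee, hN]
      · simpa only [hrev] using hfin
      · simpa only [hrev] using h
    · refine even_case o N ?_ ?_ hfin h hU
      · intro n hn; simp [hpos n hn, hN]
      · intro n hn; simp [hneg n hn, hee, hN]
  · rintro ⟨hfin, hodd⟩
    obtain ⟨N, hpos, hneg, hpar⟩ := NonUb.ends o hfin
    have hee : o (-N) ≠ o N := fun he => (Nat.not_even_iff_odd.2 hodd) (hpar.1 he)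
    cases hN : o N
    · rw [hN] at hee
      have hN' : o (-N) = true := by simpa using hee
      have := OddAux.odd_ubiquitous (o := fun n => !o n) N
        (fun n hn => by simp [hpos n hn, hN]) (fun n hn => by simp [hneg n hn.le, hN'])
      have := NonUb.rev_ubiq this
      simpa using this
    · rw [hN] at hee
      have hN' : o (-N) = false := by simpa using hee
      exact OddAux.odd_ubiquitous N
        (fun n hn => by simp [hpos n hn, hN]) (fun n hn => by simp [hneg n hn.le, hN'])
end
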